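/- Assume (P₂), (Q₂) with p̄ < q⁻ := inf q, and (E_∞): lim_{|x|,|y|→∞} p(x,y) = p̄ and lim_{|x|→∞} q(x) = q_∞ for some q_∞ ∈ (1,∞), and let f satisfy (F1)–(F4). Define h(x) := p̄/(q(x)−p̄), h⁺ := sup h, h⁻ := inf h, (qh)⁺ := sup q·h, (qh)⁻ := inf q·h. Then for any λ > 0 the functional J_λ satisfies the (PS)_c condition for every c < (1/α − 1/q⁻)·min{S_q^{(qh)⁺}, S_q^{(qh)⁻}}·min{λ^{−h⁺}, λ^{−h⁻}} − ‖g‖_{L¹(ℝ^N)}/α, where α and g are as in (F4). -/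

import Mathlib

open MeasureTheory Filter Topology Set
open scoped ENNReal NNReal

noncomputable section

/-- Euclidean space `ℝ^N`. -/
abbrev Euc (N : ℕ) := EuclideanSpace ℝ (Fin N)

/-- The modular of the variable exponent Lebesgue space `L^{h(·)}_μ`. -/
def varModular {α : Type*} [MeasurableSpace α] (μ : Measure α) (h : α → ℝ) (u : α → ℝ) : ℝ≥0∞ :=
  ∫⁻ x, ENNReal.ofReal (|u x| ^ (h x)) ∂μ

/-- The Luxemburg norm on the variable exponent Lebesgue space `L^{h(·)}_μ`. -/
def luxNorm {α : Type*} [MeasurableSpace α] (μ : Measure α) (h : α → ℝ) (u : α → ℝ) : ℝ :=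
  sInf {c : ℝ | 0 < c ∧ varModular μ h (fun x => u x / c) ≤ 1}

/-- Membership in the variable exponent Lebesgue space `L^{h(·)}_μ`. -/
def MemVarLp {α : Type*} [MeasurableSpace α] (μ : Measure α) (h : α → ℝ) (u : α → ℝ) : Prop :=
  AEStronglyMeasurable u μ ∧ varModular μ h u < ⊤

/-- The integrand of the Gagliardo-type seminorm with variable exponent. -/
def sobKernel {N : ℕ} (s : ℝ) (p : Euc N → Euc N → ℝ) (u : Euc N → ℝ) (x y : Euc N) : ℝ≥0∞ :=
  ENNReal.ofReal (|u x - u y| ^ (p x y) / dist x y ^ ((N : ℝ) + s * p x y))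

/-- The modular of the fractional Sobolev space `W^{s,p(·,·)}(Ω)`. -/
def sobModular {N : ℕ} (Ω : Set (Euc N)) (s : ℝ) (p : Euc N → Euc N → ℝ)
    (u : Euc N → ℝ) : ℝ≥0∞ :=
  (∫⁻ x in Ω, ENNReal.ofReal (|u x| ^ (p x x))) + ∫⁻ x in Ω, ∫⁻ y in Ω, sobKernel s p u x y

/-- The Luxemburg-type norm of the fractional Sobolev space `W^{s,p(·,·)}(Ω)`. -/
def sobNorm {N : ℕ} (Ω : Set (Euc N)) (s : ℝ) (p : Euc N → Euc N → ℝ) (u : Euc N → ℝ) : ℝ :=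
  sInf {c : ℝ | 0 < c ∧ sobModular Ω s p (fun x => u x / c) ≤ 1}

/-- Membership in the fractional Sobolev space `W^{s,p(·,·)}(Ω)`. -/
def MemSob {N : ℕ} (Ω : Set (Euc N)) (s : ℝ) (p : Euc N → Euc N → ℝ) (u : Euc N → ℝ) : Prop :=
  AEStronglyMeasurable u (volume.restrict Ω) ∧ sobModular Ω s p u < ⊤

/-- The best constant `S_q` of the imbedding `W^{s,p(·,·)}(ℝ^N) ↪ L^{q(·)}(ℝ^N)`. -/
def Sq {N : ℕ} (s : ℝ) (p : Euc N → Euc N → ℝ) (q : Euc N → ℝ) : ℝ :=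
  sInf {c : ℝ | ∃ u : Euc N → ℝ, MemSob Set.univ s p u ∧ ¬ u =ᵐ[volume] 0 ∧
    c = sobNorm Set.univ s p u / luxNorm volume q u}

/-- `F(x,t) = ∫_0^t f(x,τ) dτ`. -/
def Fint {N : ℕ} (f : Euc N → ℝ → ℝ) (x : Euc N) (t : ℝ) : ℝ :=
  ∫ τ in (0 : ℝ)..t, f x τ

/-- Weak solution of `L u + |u|^{p̄-2} u = f(x,u) + λ |u|^{q(x)-2} u` in `ℝ^N`. -/
def IsWeakSolution {N : ℕ} (s : ℝ) (p : Euc N → Euc N → ℝ) (pbar : ℝ) (q : Euc N → ℝ)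
    (f : Euc N → ℝ → ℝ) (lam : ℝ) (u : Euc N → ℝ) : Prop :=
  MemSob Set.univ s p u ∧
  ∀ v : Euc N → ℝ, MemSob Set.univ s p v →
    (∫ x, ∫ y, |u x - u y| ^ (p x y - 2) * (u x - u y) * (v x - v y) /
        dist x y ^ ((N : ℝ) + s * p x y)) +
      (∫ x, |u x| ^ (pbar - 2) * u x * v x) =
    (∫ x, f x (u x) * v x) + lam * ∫ x, |u x| ^ (q x - 2) * u x * v x

/-- The energy functional `J_λ` associated with the problem. -/
def Jfun {N : ℕ} (s : ℝ) (p : Euc N → Euc N → ℝ) (pbar : ℝ) (q : Euc N → ℝ)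
    (f : Euc N → ℝ → ℝ) (lam : ℝ) (u : Euc N → ℝ) : ℝ :=
  (∫ x, ∫ y, |u x - u y| ^ (p x y) / (p x y * dist x y ^ ((N : ℝ) + s * p x y))) +
    (∫ x, |u x| ^ pbar / pbar) - (∫ x, Fint f x (u x)) -
    lam * ∫ x, |u x| ^ (q x) / q x

/-- The Fréchet derivative pairing `⟨J_λ'(u), v⟩`. -/
def Jderiv {N : ℕ} (s : ℝ) (p : Euc N → Euc N → ℝ) (pbar : ℝ) (q : Euc N → ℝ)
    (f : Euc N → ℝ → ℝ) (lam : ℝ) (u v : Euc N → ℝ) : ℝ :=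
  (∫ x, ∫ y, |u x - u y| ^ (p x y - 2) * (u x - u y) * (v x - v y) /
      dist x y ^ ((N : ℝ) + s * p x y)) +
    (∫ x, |u x| ^ (pbar - 2) * u x * v x) - (∫ x, f x (u x) * v x) -
    lam * ∫ x, |u x| ^ (q x - 2) * u x * v x

def psi (p t : ℝ) : ℝ := |t| ^ (p - 2) * t

theorem psi_abs {p : ℝ} (hp : 1 < p) (t : ℝ) : |psi p t| = |t| ^ (p - 1) := by
  unfold psi
  rcases eq_or_ne t 0 with rfl | ht
  · rw [mul_zero, abs_zero, Real.zero_rpow (by linarith)]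
  · have h : 0 < |t| := abs_pos.2 ht
    rw [abs_mul, abs_of_nonneg (Real.rpow_nonneg h.le _), ← Real.rpow_add_one h.ne']
    congr 1; ring

theorem psi_mul {p : ℝ} (hp : 1 < p) (t : ℝ) : psi p t * t = |t| ^ p := by
  unfold psi
  rcases eq_or_ne t 0 with rfl | ht
  · rw [mul_zero, abs_zero, Real.zero_rpow (by linarith)]
  · have h : 0 < |t| := abs_pos.2 ht
    rw [mul_assoc, ← abs_mul_abs_self t, ← mul_assoc, ← Real.rpow_add_one h.ne',
      ← Real.rpow_add_one h.ne']
    congr 1; ring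

theorem psi_neg (p t : ℝ) : psi p (-t) = - psi p t := by
  unfold psi; rw [abs_neg]; ring

theorem psi_pos {p t : ℝ} (ht : 0 < t) : psi p t = t ^ (p - 1) := by
  unfold psi
  rw [abs_of_pos ht, ← Real.rpow_add_one ht.ne']
  congr 1; ring

theorem rpow_split {p t : ℝ} (hp : 1 < p) (ht : 0 ≤ t) : t ^ (p - 1) * t = t ^ p := by
  rcases eq_or_ne t 0 with rfl | h
  · rw [mul_zero, Real.zero_rpow (by linarith)]
  · rw [← Real.rpow_add_one h]; congr 1; ring

theorem exists_eta (P : ℝ) {δ : ℝ} (hδ : 0 < δ) :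
    ∃ η : ℝ, 0 < η ∧ η ≤ 1 / 2 ∧ (1 + η) ^ P ≤ 1 + δ ∧ 1 - δ ≤ (1 - η) ^ P := by
  have h1 : Tendsto (fun η : ℝ => (1 + η) ^ P) (𝓝[>] 0) (𝓝 1) := by
    have : ContinuousAt (fun η : ℝ => (1 + η) ^ P) 0 :=
      ContinuousAt.rpow_const (by fun_prop) (by simp)
    have := this.tendsto
    simp only [add_zero, Real.one_rpow] at this
    exact this.mono_left nhdsWithin_le_nhds
  have h2 : Tendsto (fun η : ℝ => (1 - η) ^ P) (𝓝[>] 0) (𝓝 1) := by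
    have : ContinuousAt (fun η : ℝ => (1 - η) ^ P) 0 :=
      ContinuousAt.rpow_const (by fun_prop) (by simp)
    have := this.tendsto
    simp only [sub_zero, Real.one_rpow] at this
    exact this.mono_left nhdsWithin_le_nhds
  have h3 := h1.eventually (eventually_lt_nhds (show (1:ℝ) < 1 + δ by linarith))
  have h4 := h2.eventually (eventually_gt_nhds (show 1 - δ < (1:ℝ) by linarith))
  have h5 : ∀ᶠ η : ℝ in 𝓝[>] 0, 0 < η := eventually_mem_nhdsWithin
  have h6 : ∀ᶠ η : ℝ in 𝓝[>] 0, η < 1 / 2 :=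
    nhdsWithin_le_nhds (eventually_lt_nhds (by norm_num))
  obtain ⟨η, a, b, c, d⟩ := (h3.and (h4.and (h5.and h6))).exists
  exact ⟨η, c, d.le, a.le, b.le⟩

theorem elemE1 (P : ℝ) {δ : ℝ} (hδ : 0 < δ) : ∃ C : ℝ, 0 ≤ C ∧ ∀ p b c : ℝ, 1 < p → p ≤ P →
    |psi p (c + b) - psi p c| * |c| ≤ δ * |c| ^ p + C * |b| ^ p := by
  obtain ⟨η, h0, h12, hu, hl⟩ := exists_eta P hδ
  refine ⟨2 * (1 + 1 / η) ^ P, by positivity, fun p b c hp hpP => ?_⟩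
  by_cases hbc : |b| ≤ η * |c|
  · suffices h : |psi p (c + b) - psi p c| * |c| ≤ δ * |c| ^ p by
      have : 0 ≤ 2 * (1 + 1 / η) ^ P * |b| ^ p := by positivity
      linarith
    have key : ∀ b c : ℝ, 0 < c → |b| ≤ η * |c| → |psi p (c + b) - psi p c| * |c| ≤ δ * |c| ^ p := by
      intro b c hc hbc
      rw [abs_of_pos hc] at hbc ⊢
      obtain ⟨hb1, hb2⟩ := abs_le.1 hbc
      have hcb1 : (1 - η) * c ≤ c + b := by linarith
      have hcb2 : c + b ≤ (1 + η) * c := by linarith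
      have hcp : 0 < (1 - η) * c := mul_pos (by linarith) hc
      rw [psi_pos (by linarith), psi_pos hc]
      have i1 : (c + b) ^ (p - 1) ≤ (1 + δ) * c ^ (p - 1) := by
        calc (c + b) ^ (p - 1) ≤ ((1 + η) * c) ^ (p - 1) :=
              Real.rpow_le_rpow (by linarith) hcb2 (by linarith)
          _ = (1 + η) ^ (p - 1) * c ^ (p - 1) := Real.mul_rpow (by linarith) hc.le
          _ ≤ (1 + δ) * c ^ (p - 1) := by
              gcongr
              refine le_trans ?_ hu
              exact Real.rpow_le_rpow_of_exponent_le (by linarith) (by linarith)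
      have i2 : (1 - δ) * c ^ (p - 1) ≤ (c + b) ^ (p - 1) := by
        calc (1 - δ) * c ^ (p - 1) ≤ (1 - η) ^ (p - 1) * c ^ (p - 1) := by
              gcongr
              refine le_trans hl ?_
              exact Real.rpow_le_rpow_of_exponent_ge (by linarith) (by linarith) (by linarith)
          _ = ((1 - η) * c) ^ (p - 1) := (Real.mul_rpow (by linarith) hc.le).symm
          _ ≤ (c + b) ^ (p - 1) := Real.rpow_le_rpow hcp.le hcb1 (by linarith)
      calc |(c + b) ^ (p - 1) - c ^ (p - 1)| * c ≤ (δ * c ^ (p - 1)) * c := by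
            gcongr
            rw [abs_le]; constructor <;> linarith
        _ = δ * c ^ p := by rw [mul_assoc, rpow_split hp hc.le]
    rcases lt_trichotomy c 0 with hc | hc | hc
    · have := key (-b) (-c) (by linarith) (by simpa using hbc)
      rw [← neg_add, psi_neg, psi_neg, abs_neg] at this
      rwa [← neg_sub', abs_neg] at this
    · subst hc; rw [abs_zero, mul_zero]; positivity
    · exact key b c hc hbc
  · have hbc : |c| ≤ (1 + 1 / η) * |b| := by
      have : |c| ≤ |b| / η := by rw [le_div_iff₀ h0]; linarith
      have e : (1 + 1 / η) * |b| = |b| + |b| / η := by ring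
      rw [e]; linarith [abs_nonneg b]
    have hcb : |c + b| ≤ (1 + 1 / η) * |b| := by
      have : |c| ≤ |b| / η := by rw [le_div_iff₀ h0]; linarith
      have e : (1 + 1 / η) * |b| = |b| + |b| / η := by ring
      rw [e]; linarith [abs_add_le c b]
    set A := 1 + 1 / η with hA
    have hA1 : 1 ≤ A := by rw [hA]; have : 0 < 1 / η := by positivity
                           linarith
    have e1 : |psi p (c + b)| ≤ (A * |b|) ^ (p - 1) := by
      rw [psi_abs hp]; exact Real.rpow_le_rpow (abs_nonneg _) hcb (by linarith)
    have e2 : |psi p c| ≤ (A * |b|) ^ (p - 1) := by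
      rw [psi_abs hp]; exact Real.rpow_le_rpow (abs_nonneg _) hbc (by linarith)
    have hAb : 0 ≤ A * |b| := by positivity
    calc |psi p (c + b) - psi p c| * |c| ≤ (2 * (A * |b|) ^ (p - 1)) * (A * |b|) := by
          gcongr
          exact (abs_sub _ _).trans (by linarith)
      _ = 2 * (A ^ p * |b| ^ p) := by
          rw [mul_assoc, rpow_split hp hAb, Real.mul_rpow (by linarith) (abs_nonneg _)]
      _ ≤ 2 * (A ^ P * |b| ^ p) := by
          gcongr
      _ ≤ _ := by
          have : 0 ≤ δ * |c| ^ p := by positivity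
          linarith

theorem elemE2 (P : ℝ) {δ : ℝ} (hδ : 0 < δ) : ∃ C : ℝ, 0 ≤ C ∧ ∀ p b c : ℝ, 0 < p → p ≤ P →
    |c + b| ^ p ≤ (1 + δ) * |c| ^ p + C * |b| ^ p := by
  obtain ⟨η, h0, h12, hu, hl⟩ := exists_eta P hδ
  refine ⟨(1 + 1 / η) ^ P, by positivity, fun p b c hp hpP => ?_⟩
  by_cases hbc : |b| ≤ η * |c|
  · have h1 : |c + b| ≤ (1 + η) * |c| := by linarith [abs_add_le c b]
    calc |c + b| ^ p ≤ ((1 + η) * |c|) ^ p := Real.rpow_le_rpow (abs_nonneg _) h1 hp.le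
      _ = (1 + η) ^ p * |c| ^ p := Real.mul_rpow (by linarith) (abs_nonneg _)
      _ ≤ (1 + δ) * |c| ^ p := by
          gcongr
          refine le_trans ?_ hu
          exact Real.rpow_le_rpow_of_exponent_le (by linarith) (by linarith)
      _ ≤ _ := by
        have : 0 ≤ (1 + 1 / η) ^ P * |b| ^ p := by positivity
        linarith
  · have hcb : |c + b| ≤ (1 + 1 / η) * |b| := by
      have : |c| ≤ |b| / η := by rw [le_div_iff₀ h0]; linarith
      have e : (1 + 1 / η) * |b| = |b| + |b| / η := by ring
      rw [e]; linarith [abs_add_le c b]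
    set A := 1 + 1 / η with hA
    have hA1 : 1 ≤ A := by rw [hA]; have : 0 < 1 / η := by positivity
                           linarith
    calc |c + b| ^ p ≤ (A * |b|) ^ p := Real.rpow_le_rpow (abs_nonneg _) hcb hp.le
      _ = A ^ p * |b| ^ p := Real.mul_rpow (by linarith) (abs_nonneg _)
      _ ≤ A ^ P * |b| ^ p := by gcongr
      _ ≤ _ := by
          have : 0 ≤ (1 + δ) * |c| ^ p := by positivity
          linarith

theorem elemE4 (P : ℝ) {δ : ℝ} (hδ : 0 < δ) : ∃ C : ℝ, 0 ≤ C ∧ ∀ p a b : ℝ, 1 < p → p ≤ P →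
    |a| ^ (p - 1) * |b| ≤ δ * |a| ^ p + C * |b| ^ p := by
  refine ⟨(1 + 1 / δ) ^ P, by positivity, fun p a b hp hpP => ?_⟩
  by_cases hbc : |b| ≤ δ * |a|
  · calc |a| ^ (p - 1) * |b| ≤ |a| ^ (p - 1) * (δ * |a|) := by gcongr
      _ = δ * (|a| ^ (p - 1) * |a|) := by ring
      _ = δ * |a| ^ p := by rw [rpow_split hp (abs_nonneg _)]
      _ ≤ _ := by
        have : 0 ≤ (1 + 1 / δ) ^ P * |b| ^ p := by positivity
        linarith
  · have ha : |a| ≤ (1 + 1 / δ) * |b| := by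
      have : |a| ≤ |b| / δ := by rw [le_div_iff₀ hδ]; linarith
      have e : (1 + 1 / δ) * |b| = |b| + |b| / δ := by ring
      rw [e]; linarith [abs_nonneg b]
    set A := 1 + 1 / δ with hA
    have hA1 : 1 ≤ A := by rw [hA]; have : 0 < 1 / δ := by positivity
                           linarith
    calc |a| ^ (p - 1) * |b| ≤ (A * |b|) ^ (p - 1) * |b| := by
          gcongr
      _ = A ^ (p - 1) * (|b| ^ (p - 1) * |b|) := by
          rw [Real.mul_rpow (by linarith) (abs_nonneg _)]; ring
      _ = A ^ (p - 1) * |b| ^ p := by rw [rpow_split hp (abs_nonneg _)]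
      _ ≤ A ^ P * |b| ^ p := by gcongr; linarith
      _ ≤ _ := by
          have : 0 ≤ δ * |a| ^ p := by positivity
          linarith

theorem elemE6 (Q d : ℝ) (hd : 0 < d) {δ : ℝ} (hδ : 0 < δ) : ∃ C : ℝ, 0 ≤ C ∧ ∀ a t r q : ℝ,
    0 ≤ a → 0 ≤ t → 0 < r → r + d ≤ q → q ≤ Q →
    a * t ^ r ≤ δ * t ^ q + C * a ^ (q / (q - r)) := by
  refine ⟨(1 + 1 / δ) ^ (Q / d), by positivity, fun a t r q ha ht hr hrq hqQ => ?_⟩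
  have hqr : 0 < q - r := by linarith
  by_cases h : a ≤ δ * t ^ (q - r)
  · have : t ^ (q - r) * t ^ r = t ^ q := by
      rw [← Real.rpow_add_of_nonneg ht hqr.le hr.le]; congr 1; ring
    calc a * t ^ r ≤ δ * t ^ (q - r) * t ^ r := by gcongr
      _ = δ * t ^ q := by rw [mul_assoc, this]
      _ ≤ _ := by
        have : 0 ≤ (1 + 1 / δ) ^ (Q / d) * a ^ (q / (q - r)) := by positivity
        linarith
  · set A := 1 + 1 / δ with hA
    have hA1 : 1 ≤ A := by rw [hA]; have : 0 < 1 / δ := by positivity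
                           linarith
    have h1 : t ^ (q - r) ≤ A * a := by
      have : t ^ (q - r) ≤ a / δ := by rw [le_div_iff₀ hδ]; linarith
      have e : A * a = a + a / δ := by rw [hA]; ring
      rw [e]; linarith
    have h2 : t ^ r ≤ (A * a) ^ (r / (q - r)) := by
      calc t ^ r = (t ^ (q - r)) ^ (r / (q - r)) := by
            rw [← Real.rpow_mul ht]; congr 1; field_simp
        _ ≤ _ := Real.rpow_le_rpow (by positivity) h1 (by positivity)
    have h3 : r / (q - r) ≤ Q / d := by
      rw [div_le_div_iff₀ hqr hd]; nlinarith
    have hapos : 0 < a := by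
      have : 0 ≤ δ * t ^ (q - r) := by positivity
      linarith
    calc a * t ^ r ≤ a * (A * a) ^ (r / (q - r)) := by gcongr
      _ = A ^ (r / (q - r)) * (a ^ (r / (q - r)) * a) := by
          rw [Real.mul_rpow (by linarith) ha]; ring
      _ = A ^ (r / (q - r)) * a ^ (q / (q - r)) := by
          rw [← Real.rpow_add_one hapos.ne']; congr 2; field_simp; ring
      _ ≤ A ^ (Q / d) * a ^ (q / (q - r)) := by gcongr
      _ ≤ _ := by
          have : 0 ≤ δ * t ^ q := by positivity
          linarith

theorem elemE5 (P qm Q : ℝ) (hd : P < qm) {δ : ℝ} (hδ : 0 < δ) : ∃ C : ℝ, 0 ≤ C ∧ ∀ t p q : ℝ,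
    0 ≤ t → 0 < p → p ≤ P → qm ≤ q → q ≤ Q → t ^ p ≤ δ * t ^ q + C := by
  obtain ⟨C, hC, h⟩ := elemE6 Q (qm - P) (by linarith) hδ
  refine ⟨C, hC, fun t p q ht hp hpP hq hqQ => ?_⟩
  have := h 1 t p q zero_le_one ht hp (by linarith) hqQ
  simpa using this

theorem add_rpow_le {p P : ℝ} (hp : 0 < p) (hpP : p ≤ P) (a b : ℝ) :
    |a + b| ^ p ≤ 2 ^ P * (|a| ^ p + |b| ^ p) := by
  have key : ∀ a b : ℝ, |a| ≤ |b| → |a + b| ^ p ≤ 2 ^ P * (|a| ^ p + |b| ^ p) := by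
    intro a b h
    calc |a + b| ^ p ≤ (2 * |b|) ^ p :=
          Real.rpow_le_rpow (abs_nonneg _) (by linarith [abs_add_le a b]) hp.le
      _ = 2 ^ p * |b| ^ p := Real.mul_rpow (by norm_num) (abs_nonneg _)
      _ ≤ 2 ^ P * (|a| ^ p + |b| ^ p) := by
          gcongr
          · norm_num
          · have : 0 ≤ |a| ^ p := by positivity
            linarith
  rcases le_total |a| |b| with h | h
  · exact key a b h
  · have := key b a h
    rwa [add_comm b a, add_comm (|b| ^ p)] at this

section bl
variable {Ω : Type*} [MeasurableSpace Ω] {μ : Measure Ω}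

theorem bl_real {K G : ℕ → Ω → ℝ} (hKm : ∀ n, AEStronglyMeasurable (K n) μ)
    (hG0 : ∀ n x, 0 ≤ G n x)
    (hGi : ∀ n, Integrable (G n) μ) (C : ℝ) (hGC : ∀ n, ∫ x, G n x ∂μ ≤ C)
    (h : ∀ δ > 0, ∃ H : Ω → ℝ, Integrable H μ ∧ ∀ n, ∀ᵐ x ∂μ, |K n x| ≤ δ * G n x + H x)
    (h0 : ∀ᵐ x ∂μ, Tendsto (fun n => K n x) atTop (𝓝 0)) :
    (∀ n, Integrable (K n) μ) ∧ Tendsto (fun n => ∫ x, |K n x| ∂μ) atTop (𝓝 0) := by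
  have hint : ∀ n, Integrable (K n) μ := by
    intro n
    obtain ⟨H, hH, hb⟩ := h 1 one_pos
    refine Integrable.mono' (((hGi n).const_mul 1).add hH) (hKm n) ?_
    filter_upwards [hb n] with x hx
    exact hx
  refine ⟨hint, ?_⟩
  rw [Metric.tendsto_atTop]
  intro ε hε
  have hC0 : 0 ≤ C := le_trans (integral_nonneg (hG0 0)) (hGC 0)
  set δ := ε / (2 * (C + 1)) with hδ
  have hδ0 : 0 < δ := by positivity
  obtain ⟨H, hH, hb⟩ := h δ hδ0
  have hm : Tendsto (fun n => ∫ x, min |K n x| |H x| ∂μ) atTop (𝓝 (∫ x, (0:ℝ) ∂μ)) := by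
    refine tendsto_integral_of_dominated_convergence (fun x => |H x|) ?_ hH.abs ?_ ?_
    · intro n
      exact (hKm n).norm.inf hH.1.norm
    · intro n
      refine Eventually.of_forall fun x => ?_
      rw [Real.norm_eq_abs, abs_of_nonneg (le_min (abs_nonneg _) (abs_nonneg _))]
      exact min_le_right _ _
    · filter_upwards [h0] with x hx
      have h1 : Tendsto (fun n => |K n x|) atTop (𝓝 0) := by simpa using hx.abs
      exact squeeze_zero (fun n => le_min (abs_nonneg _) (abs_nonneg _)) (fun n => min_le_left _ _) h1
  rw [integral_zero, Metric.tendsto_atTop] at hm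
  obtain ⟨n0, hn0⟩ := hm (ε / 2) (by positivity)
  refine ⟨n0, fun n hn => ?_⟩
  have h1 := hn0 n hn
  have hmi : Integrable (fun x => min |K n x| |H x|) μ := by
    refine hH.abs.mono' ((hKm n).norm.inf hH.1.norm) (Eventually.of_forall fun x => ?_)
    rw [Real.norm_eq_abs, abs_of_nonneg (le_min (abs_nonneg _) (abs_nonneg _))]
    exact min_le_right _ _
  rw [Real.dist_eq, sub_zero] at h1 ⊢
  have h2 := (le_abs_self _).trans_lt h1
  rw [abs_of_nonneg (integral_nonneg fun x => abs_nonneg _)]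
  calc ∫ x, |K n x| ∂μ ≤ ∫ x, (δ * G n x + min |K n x| |H x|) ∂μ := by
        refine integral_mono_ae (hint n).abs (((hGi n).const_mul δ).add hmi) ?_
        filter_upwards [hb n] with x hx
        have := le_abs_self (H x)
        have h3 : 0 ≤ δ * G n x := mul_nonneg hδ0.le (hG0 n x)
        rcases min_choice |K n x| |H x| with e | e <;> simp only [e] <;> linarith
    _ = δ * ∫ x, G n x ∂μ + ∫ x, min |K n x| |H x| ∂μ := by
        rw [integral_add ((hGi n).const_mul δ) hmi, integral_const_mul]
    _ < δ * (C + 1) + ε / 2 := by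
        have := mul_le_mul_of_nonneg_left (hGC n) hδ0.le
        nlinarith
    _ = ε := by rw [hδ]; field_simp; norm_num

theorem G1 {r : Ω → ℝ} {R : ℝ} (hr : Measurable r) (hr1 : ∀ x, 1 < r x) (hrR : ∀ x, r x ≤ R)
    {θ : Ω → ℝ} (hθ : Measurable θ) (hθ0 : ∀ x, 0 ≤ θ x) (hθ1 : ∀ x, θ x ≤ 1)
    {U : Ω → ℝ} (hU : Measurable U) (hUi : Integrable (fun x => |U x| ^ r x) μ)
    {W : ℕ → Ω → ℝ} (hW : ∀ n, Measurable (W n)) (hWi : ∀ n, Integrable (fun x => |W n x| ^ r x) μ)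
    (C : ℝ) (hWC : ∀ n, ∫ x, |W n x| ^ r x ∂μ ≤ C)
    (hW0 : ∀ᵐ x ∂μ, Tendsto (fun n => W n x) atTop (𝓝 0)) :
    (∀ n, Integrable (fun x => θ x * (psi (r x) (W n x + U x) * W n x)) μ) ∧
    (∀ n, Integrable (fun x => θ x * |W n x| ^ r x) μ) ∧
    Tendsto (fun n => (∫ x, θ x * (psi (r x) (W n x + U x) * W n x) ∂μ)
      - ∫ x, θ x * |W n x| ^ r x ∂μ) atTop (𝓝 0) := by
  have hψ : ∀ n, Measurable fun x => psi (r x) (W n x + U x) := by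
    intro n
    unfold psi
    exact (((hW n).add hU).abs.pow (hr.sub_const 2)).mul ((hW n).add hU)
  have hψ' : ∀ n, Measurable fun x => psi (r x) (W n x) := by
    intro n
    unfold psi
    exact ((hW n).abs.pow (hr.sub_const 2)).mul (hW n)
  have hbl := bl_real (μ := μ) (K := fun n x => θ x * ((psi (r x) (W n x + U x) - psi (r x) (W n x)) * W n x))
    (G := fun n x => |W n x| ^ r x)
    (fun n => (hθ.mul (((hψ n).sub (hψ' n)).mul (hW n))).aestronglyMeasurable)
    (fun n x => by positivity) hWi C hWC ?_ ?_
  · have i2 : ∀ n, Integrable (fun x => θ x * |W n x| ^ r x) μ := by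
      intro n
      refine (hWi n).mono' (hθ.mul ((hW n).abs.pow hr)).aestronglyMeasurable
        (Eventually.of_forall fun x => ?_)
      have : 0 ≤ |W n x| ^ r x := by positivity
      rw [Real.norm_eq_abs, abs_of_nonneg (mul_nonneg (hθ0 x) this)]
      exact mul_le_of_le_one_left this (hθ1 x)
    have heq : ∀ n x, θ x * (psi (r x) (W n x + U x) * W n x) =
        θ x * ((psi (r x) (W n x + U x) - psi (r x) (W n x)) * W n x) + θ x * |W n x| ^ r x := by
      intro n x
      rw [← psi_mul (hr1 x)]; ring
    refine ⟨fun n => ?_, i2, ?_⟩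
    · simp_rw [heq]
      exact (hbl.1 n).add (i2 n)
    · have : ∀ n, (∫ x, θ x * (psi (r x) (W n x + U x) * W n x) ∂μ) - ∫ x, θ x * |W n x| ^ r x ∂μ
          = ∫ x, θ x * ((psi (r x) (W n x + U x) - psi (r x) (W n x)) * W n x) ∂μ := by
        intro n
        simp_rw [heq]
        rw [integral_add (hbl.1 n) (i2 n)]; ring
      simp_rw [this]
      exact squeeze_zero_norm (fun n => norm_integral_le_integral_norm _) hbl.2
  · intro δ hδ
    obtain ⟨C', hC', h⟩ := elemE1 R hδ
    refine ⟨fun x => C' * |U x| ^ r x, hUi.const_mul _, fun n => Eventually.of_forall fun x => ?_⟩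
    have := h (r x) (U x) (W n x) (hr1 x) (hrR x)
    rw [abs_mul, abs_mul, abs_of_nonneg (hθ0 x)]
    exact (mul_le_of_le_one_left (by positivity) (hθ1 x)).trans this
  · filter_upwards [hW0] with x hx
    have hb : ∀ n, |θ x * ((psi (r x) (W n x + U x) - psi (r x) (W n x)) * W n x)| ≤
        (|W n x + U x| ^ (r x - 1) + |W n x| ^ (r x - 1)) * |W n x| := by
      intro n
      rw [abs_mul, abs_mul, abs_of_nonneg (hθ0 x)]
      refine (mul_le_of_le_one_left (by positivity) (hθ1 x)).trans ?_
      gcongr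
      rw [← psi_abs (hr1 x), ← psi_abs (hr1 x)]
      exact abs_sub _ _
    refine squeeze_zero_norm hb ?_
    have hr' : 0 ≤ r x - 1 := by linarith [hr1 x]
    have t1 : Tendsto (fun n => |W n x + U x| ^ (r x - 1)) atTop (𝓝 (|0 + U x| ^ (r x - 1))) :=
      ((hx.add_const (U x)).abs).rpow_const (Or.inr hr')
    have t2 : Tendsto (fun n => |W n x| ^ (r x - 1)) atTop (𝓝 (|0| ^ (r x - 1))) :=
      (hx.abs).rpow_const (Or.inr hr')
    have := (t1.add t2).mul hx.abs
    simpa using this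

end bl

structure Ctx {N : ℕ} (s P ε₀ : ℝ) (p : Euc N → Euc N → ℝ) : Prop where
  s0 : 0 < s
  s1 : s < 1
  P1 : 1 < P
  sP : s * P < N
  e0 : 0 < ε₀
  e1 : ε₀ < 1 / 2
  pc : Continuous (fun z : Euc N × Euc N => p z.1 z.2)
  sym : ∀ x y, p x y = p y x
  p1 : ∀ x y, 1 < p x y
  pP : ∀ x y, p x y ≤ P
  diag : ∀ x y : Euc N, dist x y < ε₀ → p x y = P

def kern {N : ℕ} (s : ℝ) (p : Euc N → Euc N → ℝ) (z : Euc N × Euc N) : ℝ :=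
  1 / dist z.1 z.2 ^ ((N : ℝ) + s * p z.1 z.2)

def kap {N : ℕ} (s : ℝ) (p : Euc N → Euc N → ℝ) : Measure (Euc N × Euc N) :=
  (volume.prod volume).withDensity (fun z => ENNReal.ofReal (kern s p z))

theorem kern_nonneg {N : ℕ} (s : ℝ) (p : Euc N → Euc N → ℝ) (z) : 0 ≤ kern s p z := by
  unfold kern; positivity

section
variable {N : ℕ} {s P ε₀ : ℝ} {p : Euc N → Euc N → ℝ}

theorem Ctx.N0 (h : Ctx s P ε₀ p) : 0 < N := by
  have h1 : 0 < s * P := mul_pos h.s0 (by linarith [h.P1])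
  have := h1.trans h.sP
  exact_mod_cast this

theorem Ctx.kern_meas (h : Ctx s P ε₀ p) : Measurable (kern s p) := by
  unfold kern
  have := h.pc.measurable
  have h2 : Measurable fun z : Euc N × Euc N => dist z.1 z.2 := continuous_dist.measurable
  exact (h2.pow ((this.const_mul s).const_add _)).const_div 1

theorem kap_ac : kap s p ≪ (volume.prod volume : Measure (Euc N × Euc N)) :=
  withDensity_absolutelyContinuous _ _

theorem ae_kap_fst {Q : Euc N → Prop} (h : ∀ᵐ x ∂(volume : Measure (Euc N)), Q x) :
    ∀ᵐ z ∂(kap s p), Q z.1 :=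
  kap_ac.ae_le (Measure.quasiMeasurePreserving_fst.ae h)

theorem ae_kap_snd {Q : Euc N → Prop} (h : ∀ᵐ x ∂(volume : Measure (Euc N)), Q x) :
    ∀ᵐ z ∂(kap s p), Q z.2 :=
  kap_ac.ae_le (Measure.quasiMeasurePreserving_snd.ae h)

theorem Ctx.lint_kap (h : Ctx s P ε₀ p) {F : Euc N × Euc N → ℝ} (hF : Measurable F) :
    ∫⁻ z, ENNReal.ofReal (F z) ∂(kap s p) =
      ∫⁻ x, ∫⁻ y, ENNReal.ofReal (F (x, y) * kern s p (x, y)) := by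
  have hm : Measurable fun z => ENNReal.ofReal (F z) := hF.ennreal_ofReal
  unfold kap
  rw [lintegral_withDensity_eq_lintegral_mul _ h.kern_meas.ennreal_ofReal hm,
    lintegral_prod _ (h.kern_meas.ennreal_ofReal.mul hm).aemeasurable]
  congr 1; ext x; congr 1; ext y
  rw [Pi.mul_apply, mul_comm, ENNReal.ofReal_mul' (kern_nonneg _ _ _)]

theorem Ctx.lint_kap' (h : Ctx s P ε₀ p) {F : Euc N × Euc N → ℝ} (hF : Measurable F) :
    ∫⁻ z, ENNReal.ofReal (F z) ∂(kap s p) =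
      ∫⁻ y, ∫⁻ x, ENNReal.ofReal (F (x, y) * kern s p (x, y)) := by
  have hm : Measurable fun z => ENNReal.ofReal (F z) := hF.ennreal_ofReal
  unfold kap
  rw [lintegral_withDensity_eq_lintegral_mul _ h.kern_meas.ennreal_ofReal hm,
    lintegral_prod_symm _ (h.kern_meas.ennreal_ofReal.mul hm).aemeasurable]
  congr 1; ext x; congr 1; ext y
  rw [Pi.mul_apply, mul_comm, ENNReal.ofReal_mul' (kern_nonneg _ _ _)]

theorem Ctx.kern_sym (h : Ctx s P ε₀ p) (x y : Euc N) : kern s p (x, y) = kern s p (y, x) := by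
  simp only [kern, dist_comm x y, h.sym x y]

/-- integrable majorant -/
theorem Ctx.major (h : Ctx s P ε₀ p) (L : ℝ) (hL : 0 ≤ L) : ∃ g : ℝ → ℝ,
    (∀ ρ, 0 ≤ ρ → 0 ≤ g ρ) ∧
    Integrable (fun x : Euc N => g ‖x‖) ∧ ∀ x y : Euc N, ∀ t : ℝ, 0 ≤ t → t ≤ 1 → t ≤ L * dist x y →
      t ^ p x y * kern s p (x, y) ≤ g (dist x y) := by
  have : NeZero N := ⟨h.N0.ne'⟩
  have : Nontrivial (Euc N) := inferInstance
  set A := 1 + 1 / ε₀ with hA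
  have hA1 : 1 ≤ A := by
    have : 0 < 1 / ε₀ := by have := h.e0; positivity
    rw [hA]; linarith
  refine ⟨fun ρ => L ^ P * (Iio (1:ℝ)).indicator (fun ρ => ρ ^ ((1 - s) * P - N)) ρ +
    A ^ (N + s * P) * (1 + ρ) ^ (-((N : ℝ) + s)), ?_, ?_, ?_⟩
  · intro ρ hρ
    have : 0 ≤ (Iio (1:ℝ)).indicator (fun ρ => ρ ^ ((1 - s) * P - N)) ρ := by
      by_cases h1 : ρ < 1 <;> simp [h1]; positivity
    positivity
  · apply Integrable.add
    · apply Integrable.const_mul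
      have := (integrableOn_fun_norm_addHaar (volume : Measure (Euc N)) (r := 1)
        (f := fun ρ => ρ ^ ((1 - s) * P - N))).2 ?_
      · rw [← integrable_indicator_iff Metric.isOpen_ball.measurableSet] at this
        refine this.congr (Eventually.of_forall fun x => ?_)
        by_cases h1 : ‖x‖ < 1 <;> simp [h1]
      · have h2 := (intervalIntegral.integrableOn_Ioo_rpow_iff (s := (1 - s) * P - 1) (t := 1)
          one_pos).2 (by
            have : 0 < (1 - s) * P := mul_pos (by linarith [h.s1]) (by linarith [h.P1])
            linarith)
        refine h2.congr_fun ?_ measurableSet_Ioo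
        intro ρ hρ
        simp only [finrank_euclideanSpace, Fintype.card_fin, smul_eq_mul]
        rw [← Real.rpow_natCast, ← Real.rpow_add hρ.1]
        congr 1
        have := h.N0
        push_cast [Nat.cast_sub (show 1 ≤ N from this)]
        ring
    · apply Integrable.const_mul
      apply integrable_one_add_norm
      rw [finrank_euclideanSpace, Fintype.card_fin]
      linarith [h.s0]
  · intro x y t ht ht1 htL
    set ρ := dist x y with hρ
    have hρ0 : 0 ≤ ρ := dist_nonneg
    have hp1 := h.p1 x y
    have hpP := h.pP x y
    have hs0 := h.s0
    have hP1 := h.P1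
    have hN : (0:ℝ) < N := by exact_mod_cast h.N0
    rcases lt_or_ge ρ ε₀ with hlt | hge
    · have hpp := h.diag x y hlt
      have h1 : ρ < 1 := by linarith [h.e1]
      have hnn : 0 ≤ A ^ (N + s * P) * (1 + ρ) ^ (-((N : ℝ) + s)) := by positivity
      have : t ^ p x y * kern s p (x, y) ≤ L ^ P * ρ ^ ((1 - s) * P - N) := by
        rcases hρ0.eq_or_lt with h0 | h0
        · have : t = 0 := by rw [← h0] at htL; linarith
          rw [this, Real.zero_rpow (by linarith), zero_mul]
          positivity
        · unfold kern
          simp only [← hρ]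
          rw [hpp]
          calc t ^ P * (1 / ρ ^ (N + s * P)) ≤ (L * ρ) ^ P * (1 / ρ ^ (N + s * P)) := by
                gcongr
            _ = L ^ P * ρ ^ ((1 - s) * P - N) := by
                rw [Real.mul_rpow hL hρ0, mul_assoc, mul_one_div, ← Real.rpow_sub h0]
                congr 2; ring
      simp only [indicator, mem_Iio, h1, if_true]
      linarith
    · have h0 : 0 < ρ := h.e0.trans_le hge
      have hnn : 0 ≤ L ^ P * (Iio (1:ℝ)).indicator (fun ρ => ρ ^ ((1 - s) * P - N)) ρ := by
        have : 0 ≤ (Iio (1:ℝ)).indicator (fun ρ => ρ ^ ((1 - s) * P - N)) ρ := by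
          by_cases h1 : ρ < 1 <;> simp [h1]; positivity
        positivity
      have h1ρ : 1 + ρ ≤ A * ρ := by
        have : 1 ≤ ρ / ε₀ := by rw [le_div_iff₀ h.e0]; linarith
        have e : A * ρ = ρ + ρ / ε₀ := by rw [hA]; ring
        linarith
      have hbase : (1 + ρ) ^ ((N:ℝ) + s) ≤ A ^ (N + s * P) * ρ ^ ((N:ℝ) + s * p x y) := by
        calc (1 + ρ) ^ ((N:ℝ) + s) ≤ (1 + ρ) ^ ((N:ℝ) + s * p x y) := by
              gcongr
              · linarith
              · nlinarith
          _ ≤ (A * ρ) ^ ((N:ℝ) + s * p x y) := by gcongr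
          _ = A ^ ((N:ℝ) + s * p x y) * ρ ^ ((N:ℝ) + s * p x y) :=
              Real.mul_rpow (by linarith) hρ0
          _ ≤ _ := by gcongr
      have : t ^ p x y * kern s p (x, y) ≤ A ^ (N + s * P) * (1 + ρ) ^ (-((N : ℝ) + s)) := by
        have ht' : t ^ p x y ≤ 1 := Real.rpow_le_one ht ht1 (by linarith)
        refine (mul_le_of_le_one_left (kern_nonneg _ _ _) ht').trans ?_
        unfold kern
        simp only [← hρ]
        rw [Real.rpow_neg (by linarith), ← div_eq_mul_inv, div_le_div_iff₀ (by positivity) (by positivity)]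
        linarith
      linarith

structure Good (s : ℝ) (p : Euc N → Euc N → ℝ) (Φ : Euc N × Euc N → ℝ) : Prop where
  meas : Measurable Φ
  nn : ∀ z, 0 ≤ Φ z
  int : Integrable Φ (kap s p)
  sl : ∃ C : ℝ, 0 ≤ C ∧ ∀ g : Euc N → ℝ, Measurable g → (∀ x, 0 ≤ g x) → Integrable g →
    (Integrable (fun z => g z.1 * Φ z) (kap s p) ∧ ∫ z, g z.1 * Φ z ∂(kap s p) ≤ C * ∫ x, g x) ∧
    (Integrable (fun z => g z.2 * Φ z) (kap s p) ∧ ∫ z, g z.2 * Φ z ∂(kap s p) ≤ C * ∫ x, g x)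

theorem int_of_lint {Ω : Type*} [MeasurableSpace Ω] {μ : Measure Ω} {F : Ω → ℝ} (hF : Measurable F)
    (h0 : ∀ x, 0 ≤ F x) {c : ℝ} (hc : 0 ≤ c) (h : ∫⁻ x, ENNReal.ofReal (F x) ∂μ ≤ ENNReal.ofReal c) :
    Integrable F μ ∧ ∫ x, F x ∂μ ≤ c := by
  have hi : Integrable F μ := by
    refine ⟨hF.aestronglyMeasurable, ?_⟩
    rw [hasFiniteIntegral_iff_ofReal (Eventually.of_forall h0)]
    exact h.trans_lt ENNReal.ofReal_lt_top
  refine ⟨hi, ?_⟩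
  rw [integral_eq_lintegral_of_nonneg_ae (Eventually.of_forall h0) hF.aestronglyMeasurable]
  exact ENNReal.toReal_le_of_le_ofReal hc h

theorem Ctx.slice (h : Ctx s P ε₀ p) {Φ : Euc N × Euc N → ℝ} (hm : Measurable Φ) (L : ℝ) (hL : 0 ≤ L)
    (ht : ∃ t : Euc N × Euc N → ℝ, (∀ z, 0 ≤ t z ∧ t z ≤ 1 ∧ t z ≤ L * dist z.1 z.2) ∧
      ∀ z, Φ z = t z ^ p z.1 z.2) :
    (∀ z, 0 ≤ Φ z) ∧
    ∃ C : ℝ, 0 ≤ C ∧ ∀ g : Euc N → ℝ, Measurable g → (∀ x, 0 ≤ g x) → Integrable g →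
    (Integrable (fun z => g z.1 * Φ z) (kap s p) ∧ ∫ z, g z.1 * Φ z ∂(kap s p) ≤ C * ∫ x, g x) ∧
    (Integrable (fun z => g z.2 * Φ z) (kap s p) ∧ ∫ z, g z.2 * Φ z ∂(kap s p) ≤ C * ∫ x, g x) := by
  obtain ⟨t, ht, hΦ⟩ := ht
  obtain ⟨g, hg0, hgi, hg⟩ := h.major L hL
  set C := ∫ x : Euc N, g ‖x‖ with hC
  have hC0 : 0 ≤ C := integral_nonneg fun x => hg0 _ (norm_nonneg _)
  have hlC : ∫⁻ x : Euc N, ENNReal.ofReal (g ‖x‖) = ENNReal.ofReal C := by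
    rw [hC, ofReal_integral_eq_lintegral_ofReal hgi (Eventually.of_forall fun x => hg0 _ (norm_nonneg _))]
  have h1 : ∀ y, ∫⁻ x, ENNReal.ofReal (Φ (x, y) * kern s p (x, y)) ≤ ENNReal.ofReal C := by
    intro y
    rw [← hlC, ← lintegral_sub_right_eq_self (fun x : Euc N => ENNReal.ofReal (g ‖x‖)) y]
    refine lintegral_mono fun x => ENNReal.ofReal_le_ofReal ?_
    rw [hΦ, ← dist_eq_norm]
    exact hg x y _ (ht _).1 (ht _).2.1 (ht _).2.2
  have h2 : ∀ x, ∫⁻ y, ENNReal.ofReal (Φ (x, y) * kern s p (x, y)) ≤ ENNReal.ofReal C := by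
    intro x
    rw [← hlC, ← lintegral_sub_right_eq_self (fun x : Euc N => ENNReal.ofReal (g ‖x‖)) x]
    refine lintegral_mono fun y => ENNReal.ofReal_le_ofReal ?_
    rw [hΦ, ← dist_eq_norm, dist_comm]
    exact hg x y _ (ht _).1 (ht _).2.1 (ht _).2.2
  have hnn : ∀ z, 0 ≤ Φ z := fun z => by rw [hΦ]; exact Real.rpow_nonneg (ht z).1 _
  have sl : ∀ g : Euc N → ℝ, Measurable g → (∀ x, 0 ≤ g x) → Integrable g →
    (Integrable (fun z => g z.1 * Φ z) (kap s p) ∧ ∫ z, g z.1 * Φ z ∂(kap s p) ≤ C * ∫ x, g x) ∧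
    (Integrable (fun z => g z.2 * Φ z) (kap s p) ∧ ∫ z, g z.2 * Φ z ∂(kap s p) ≤ C * ∫ x, g x) := by
    intro g gm g0 gi
    have hI : 0 ≤ ∫ x, g x := integral_nonneg g0
    have hIe := ofReal_integral_eq_lintegral_ofReal gi (Eventually.of_forall g0)
    have km : Measurable fun z => Φ z * kern s p z := hm.mul h.kern_meas
    constructor
    · have m : Measurable (fun z : Euc N × Euc N => g z.1 * Φ z) := (gm.comp measurable_fst).mul hm
      refine int_of_lint m (fun z => mul_nonneg (g0 _) (hnn _)) (mul_nonneg hC0 hI) ?_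
      rw [h.lint_kap m]
      calc ∫⁻ x, ∫⁻ y, ENNReal.ofReal (g x * Φ (x, y) * kern s p (x, y))
          = ∫⁻ x, ENNReal.ofReal (g x) * ∫⁻ y, ENNReal.ofReal (Φ (x, y) * kern s p (x, y)) := by
            congr 1; ext x
            rw [← lintegral_const_mul (f := fun y => ENNReal.ofReal (Φ (x, y) * kern s p (x, y))) _
              (km.comp measurable_prodMk_left).ennreal_ofReal]
            congr 1; ext y
            rw [mul_assoc, ENNReal.ofReal_mul (g0 x)]
        _ ≤ ∫⁻ x, ENNReal.ofReal (g x) * ENNReal.ofReal C := by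
            gcongr with x; exact h2 x
        _ = ENNReal.ofReal (C * ∫ x, g x) := by
            rw [lintegral_mul_const _ gm.ennreal_ofReal, ← hIe, ← ENNReal.ofReal_mul hI, mul_comm]
    · have m : Measurable (fun z : Euc N × Euc N => g z.2 * Φ z) := (gm.comp measurable_snd).mul hm
      refine int_of_lint m (fun z => mul_nonneg (g0 _) (hnn _)) (mul_nonneg hC0 hI) ?_
      rw [h.lint_kap' m]
      calc ∫⁻ y, ∫⁻ x, ENNReal.ofReal (g y * Φ (x, y) * kern s p (x, y))
          = ∫⁻ y, ENNReal.ofReal (g y) * ∫⁻ x, ENNReal.ofReal (Φ (x, y) * kern s p (x, y)) := by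
            congr 1; ext y
            rw [← lintegral_const_mul (f := fun x => ENNReal.ofReal (Φ (x, y) * kern s p (x, y))) _
              (km.comp measurable_prodMk_right).ennreal_ofReal]
            congr 1; ext x
            rw [mul_assoc, ENNReal.ofReal_mul (g0 y)]
        _ ≤ ∫⁻ x, ENNReal.ofReal (g x) * ENNReal.ofReal C := by
            gcongr with x; exact h1 x
        _ = ENNReal.ofReal (C * ∫ x, g x) := by
            rw [lintegral_mul_const _ gm.ennreal_ofReal, ← hIe, ← ENNReal.ofReal_mul hI, mul_comm]
  exact ⟨hnn, C, hC0, sl⟩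

theorem Ctx.good (h : Ctx s P ε₀ p) {Φ : Euc N × Euc N → ℝ} (hm : Measurable Φ) (L : ℝ) (hL : 0 ≤ L)
    (ht : ∃ t : Euc N × Euc N → ℝ, (∀ z, 0 ≤ t z ∧ t z ≤ 1 ∧ t z ≤ L * dist z.1 z.2) ∧
      ∀ z, Φ z = t z ^ p z.1 z.2)
    (R : ℝ) (hR : ∀ z, Φ z ≠ 0 → ‖z.1‖ ≤ R ∨ ‖z.2‖ ≤ R) : Good s p Φ := by
  obtain ⟨hnn, C, hC0, sl⟩ := h.slice hm L hL ht
  refine ⟨hm, hnn, ?_, C, hC0, sl⟩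
  have hB := sl ((Metric.closedBall (0 : Euc N) R).indicator 1)
    (measurable_one.indicator Metric.isClosed_closedBall.measurableSet)
    (fun x => indicator_nonneg (fun _ _ => zero_le_one) _)
    ((integrable_indicator_iff Metric.isClosed_closedBall.measurableSet).2
      (integrableOn_const (C := (1:ℝ)) measure_closedBall_lt_top.ne))
  refine (hB.1.1.add hB.2.1).mono' hm.aestronglyMeasurable (Eventually.of_forall fun z => ?_)
  rw [Real.norm_eq_abs, abs_of_nonneg (hnn z)]
  simp only [Pi.add_apply, indicator, Metric.mem_closedBall, dist_zero_right, Pi.one_apply]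
  by_cases hz : Φ z = 0
  · simp [hz]
  · have := hnn z
    rcases hR z hz with h1 | h1
    · rw [if_pos h1]; split_ifs <;> linarith
    · rw [if_pos h1]; split_ifs <;> linarith

theorem Ctx.comm (h : Ctx s P ε₀ p) {q : Euc N → ℝ} (hq : Measurable q) {qm qM : ℝ} (hPq : P < qm)
    (hqm : ∀ x, qm ≤ q x) (hqM : ∀ x, q x ≤ qM)
    {Φ : Euc N × Euc N → ℝ} (hΦ : Good s p Φ)
    {w : ℕ → Euc N → ℝ} (hw : ∀ n, Measurable (w n)) (hwi : ∀ n, Integrable fun x => |w n x| ^ q x)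
    (C : ℝ) (hwC : ∀ n, ∫ x, |w n x| ^ q x ≤ C)
    (hw0 : ∀ᵐ x, Tendsto (fun n => w n x) atTop (𝓝 0)) :
    ((∀ n, Integrable (fun z => |w n z.1| ^ p z.1 z.2 * Φ z) (kap s p)) ∧
      Tendsto (fun n => ∫ z, |w n z.1| ^ p z.1 z.2 * Φ z ∂(kap s p)) atTop (𝓝 0)) ∧
    ((∀ n, Integrable (fun z => |w n z.2| ^ p z.1 z.2 * Φ z) (kap s p)) ∧
      Tendsto (fun n => ∫ z, |w n z.2| ^ p z.1 z.2 * Φ z ∂(kap s p)) atTop (𝓝 0)) := by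
  obtain ⟨B, hB0, hB⟩ := hΦ.sl
  have pm := h.pc.measurable
  have qwm : ∀ n, Measurable fun x => |w n x| ^ q x := fun n => (hw n).abs.pow hq
  have qn : ∀ n x, 0 ≤ |w n x| ^ q x := fun n x => by positivity
  have gen : ∀ π : Euc N × Euc N → Euc N, Measurable π →
      (∀ᵐ z ∂(kap s p), Tendsto (fun n => w n (π z)) atTop (𝓝 0)) →
      (∀ n, Integrable (fun z => |w n (π z)| ^ q (π z) * Φ z) (kap s p) ∧
        ∫ z, |w n (π z)| ^ q (π z) * Φ z ∂(kap s p) ≤ B * ∫ x, |w n x| ^ q x) →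
      ((∀ n, Integrable (fun z => |w n (π z)| ^ p z.1 z.2 * Φ z) (kap s p)) ∧
      Tendsto (fun n => ∫ z, |w n (π z)| ^ p z.1 z.2 * Φ z ∂(kap s p)) atTop (𝓝 0)) := by
    intro π hπ h0 hs
    have nnK : ∀ n z, 0 ≤ |w n (π z)| ^ p z.1 z.2 * Φ z := fun n z =>
      mul_nonneg (by positivity) (hΦ.nn z)
    have := bl_real (μ := kap s p) (K := fun n z => |w n (π z)| ^ p z.1 z.2 * Φ z)
      (G := fun n z => |w n (π z)| ^ q (π z) * Φ z)
      (fun n => ((((hw n).comp hπ).abs.pow pm).mul hΦ.meas).aestronglyMeasurable)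
      (fun n z => mul_nonneg (by positivity) (hΦ.nn z)) (fun n => (hs n).1) (B * C)
      (fun n => (hs n).2.trans (mul_le_mul_of_nonneg_left (hwC n) hB0)) ?_ ?_
    · refine ⟨this.1, this.2.congr fun n => ?_⟩
      congr 1; ext z; exact abs_of_nonneg (nnK n z)
    · intro δ hδ
      obtain ⟨C', hC', he⟩ := elemE5 P qm qM hPq hδ
      refine ⟨fun z => C' * Φ z, hΦ.int.const_mul _, fun n => Eventually.of_forall fun z => ?_⟩
      rw [abs_of_nonneg (nnK n z)]
      have := mul_le_mul_of_nonneg_right (he |w n (π z)| (p z.1 z.2) (q (π z)) (abs_nonneg _)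
        (by linarith [h.p1 z.1 z.2]) (h.pP _ _) (hqm _) (hqM _)) (hΦ.nn z)
      linarith
    · filter_upwards [h0] with z hz
      have hp : 0 < p z.1 z.2 := by linarith [h.p1 z.1 z.2]
      have := (hz.abs.rpow_const (p := p z.1 z.2) (Or.inr hp.le)).mul_const (Φ z)
      simpa [Real.zero_rpow hp.ne'] using this
  have e1 := gen Prod.fst measurable_fst (ae_kap_fst (Q := fun x => Tendsto (fun n => w n x) atTop (𝓝 0)) hw0)
    fun n => (hB (fun x => |w n x| ^ q x) (qwm n) (qn n) (hwi n)).1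
  have e2 := gen Prod.snd measurable_snd (ae_kap_snd (Q := fun x => Tendsto (fun n => w n x) atTop (𝓝 0)) hw0)
    fun n => (hB (fun x => |w n x| ^ q x) (qwm n) (qn n) (hwi n)).2
  exact ⟨e1, e2⟩

end

theorem fatou_real {Ω : Type*} [MeasurableSpace Ω] {μ : Measure Ω} {F : ℕ → Ω → ℝ} {G : Ω → ℝ}
    (hF : ∀ n, Measurable (F n)) (hG : Measurable G) (hF0 : ∀ n x, 0 ≤ F n x) (hG0 : ∀ x, 0 ≤ G x)
    (hFi : ∀ n, Integrable (F n) μ) {C : ℝ} (hC : ∀ n, ∫ x, F n x ∂μ ≤ C)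
    (hl : ∀ᵐ x ∂μ, Tendsto (fun n => F n x) atTop (𝓝 (G x))) :
    Integrable G μ ∧ ∫ x, G x ∂μ ≤ C := by
  have hC0 : 0 ≤ C := le_trans (integral_nonneg (hF0 0)) (hC 0)
  refine int_of_lint hG hG0 hC0 ?_
  calc ∫⁻ x, ENNReal.ofReal (G x) ∂μ
      = ∫⁻ x, liminf (fun n => ENNReal.ofReal (F n x)) atTop ∂μ := by
        refine lintegral_congr_ae ?_
        filter_upwards [hl] with x hx
        exact ((ENNReal.tendsto_ofReal hx).liminf_eq).symm
    _ ≤ liminf (fun n => ∫⁻ x, ENNReal.ofReal (F n x) ∂μ) atTop :=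
        lintegral_liminf_le fun n => (hF n).ennreal_ofReal
    _ ≤ ENNReal.ofReal C := by
        refine liminf_le_of_le (by isBoundedDefault) fun b hb => ?_
        obtain ⟨n, hn⟩ := hb.exists
        refine hn.trans ?_
        rw [← ofReal_integral_eq_lintegral_ofReal (hFi n) (Eventually.of_forall (hF0 n))]
        exact ENNReal.ofReal_le_ofReal (hC n)

section
variable {N : ℕ} {s P ε₀ : ℝ} {p : Euc N → Euc N → ℝ}

theorem Ctx.int_kap_iff (h : Ctx s P ε₀ p) {F : Euc N × Euc N → ℝ} :
    Integrable F (kap s p) ↔ Integrable (fun z => F z * kern s p z) (volume.prod volume) := by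
  unfold kap
  rw [integrable_withDensity_iff_integrable_smul' h.kern_meas.ennreal_ofReal
    (Eventually.of_forall fun _ => ENNReal.ofReal_lt_top)]
  simp only [ENNReal.toReal_ofReal (kern_nonneg s p _), smul_eq_mul, mul_comm]

theorem Ctx.integral_kap (h : Ctx s P ε₀ p) {F : Euc N × Euc N → ℝ} (hF : Integrable F (kap s p)) :
    ∫ z, F z ∂(kap s p) = ∫ x, ∫ y, F (x, y) * kern s p (x, y) := by
  rw [← integral_prod (fun z => F z * kern s p z) (h.int_kap_iff.1 hF)]
  unfold kap
  rw [integral_withDensity_eq_integral_toReal_smul h.kern_meas.ennreal_ofReal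
    (Eventually.of_forall fun _ => ENNReal.ofReal_lt_top)]
  simp only [ENNReal.toReal_ofReal (kern_nonneg s p _), smul_eq_mul, mul_comm]

theorem Ctx.const (h : Ctx s P ε₀ p) : Ctx (N := N) s P ε₀ (fun _ _ => P) :=
  ⟨h.s0, h.s1, h.P1, h.sP, h.e0, h.e1, continuous_const, fun _ _ => rfl, fun _ _ => h.P1,
    fun _ _ => le_rfl, fun _ _ _ => rfl⟩

theorem Ctx.toConst (h : Ctx s P ε₀ p) {u : Euc N → ℝ} (hu : Measurable u)
    (h1 : Integrable fun x => |u x| ^ P)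
    (h2 : Integrable (fun z => |u z.1 - u z.2| ^ p z.1 z.2) (kap s p)) :
    Integrable (fun z => |u z.1 - u z.2| ^ P * kern s (fun _ _ => P) z)
      ((volume : Measure (Euc N)).prod volume) := by
  have hdm : Measurable fun z : Euc N × Euc N => dist z.1 z.2 := continuous_dist.measurable
  have hSm : MeasurableSet {z : Euc N × Euc N | ε₀ ≤ dist z.1 z.2} := measurableSet_le measurable_const hdm
  set I : Euc N × Euc N → ℝ := {z : Euc N × Euc N | ε₀ ≤ dist z.1 z.2}.indicator 1 with hI
  have hIm : Measurable I := measurable_one.indicator hSm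
  have he := h.e0
  have hP := h.P1
  obtain ⟨_, C, hC0, sl⟩ := h.const.slice hIm (1 / ε₀) (by positivity) ⟨I, fun z => by
      by_cases hz : ε₀ ≤ dist z.1 z.2
      · simp only [hI, indicator, mem_ofPred_eq, hz, if_true, Pi.one_apply]
        refine ⟨zero_le_one, le_rfl, ?_⟩
        rw [one_div_mul_eq_div, le_div_iff₀ he]; linarith
      · simp only [hI, indicator, mem_ofPred_eq, hz, if_false]
        exact ⟨le_rfl, zero_le_one, by positivity⟩, fun z => by
      by_cases hz : ε₀ ≤ dist z.1 z.2
      · simp only [hI, indicator, mem_ofPred_eq, hz, if_true, Pi.one_apply, Real.one_rpow]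
      · simp only [hI, indicator, mem_ofPred_eq, hz, if_false]
        rw [Real.zero_rpow (by linarith)]⟩
  have hs := sl _ (hu.abs.pow_const P) (fun x => by positivity) h1
  have i1 := h.const.int_kap_iff.1 hs.1.1
  have i2 := h.const.int_kap_iff.1 hs.2.1
  have i3 := h.int_kap_iff.1 h2
  refine (i3.add ((i1.add i2).const_mul (2 ^ P))).mono' ?_ (Eventually.of_forall fun z => ?_)
  · exact ((((hu.comp measurable_fst).sub (hu.comp measurable_snd)).abs.pow_const P).mul
      h.const.kern_meas).aestronglyMeasurable
  · have k0 := kern_nonneg s p z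
    have k1 := kern_nonneg s (fun _ _ : Euc N => P) z
    rw [Real.norm_eq_abs, abs_of_nonneg (by positivity)]
    simp only [Pi.add_apply]
    by_cases hz : ε₀ ≤ dist z.1 z.2
    · have e1 : I z = 1 := by simp only [hI, indicator, mem_ofPred_eq, hz, if_true, Pi.one_apply]
      have e2 : |u z.1 - u z.2| ^ P ≤ 2 ^ P * (|u z.1| ^ P + |u z.2| ^ P) := by
        have := add_rpow_le (by linarith : 0 < P) (le_refl P) (u z.1) (-u z.2)
        rwa [abs_neg, ← sub_eq_add_neg] at this
      rw [e1]
      have := mul_le_mul_of_nonneg_right e2 k1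
      have : 0 ≤ |u z.1 - u z.2| ^ p z.1 z.2 * kern s p z := by positivity
      nlinarith
    · have e1 : I z = 0 := by simp only [hI, indicator, mem_ofPred_eq, hz, if_false]
      have e2 := h.diag z.1 z.2 (not_le.1 hz)
      rw [e1]
      have : kern s p z = kern s (fun _ _ => P) z := by simp only [kern, e2]
      rw [this, e2]; simp

/-- ball volume -/
theorem ball_vol (x : Euc N) {r : ℝ} (hr : 0 < r) :
    volume.real (Metric.ball x r) = r ^ (N : ℝ) * volume.real (Metric.ball (0 : Euc N) 1) := by
  have := Measure.addHaar_ball_of_pos (volume : Measure (Euc N)) x hr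
  simp only [Measure.real, this, ENNReal.toReal_mul, finrank_euclideanSpace, Fintype.card_fin]
  rw [ENNReal.toReal_ofReal (by positivity), Real.rpow_natCast]

theorem sob_pt (h : Ctx s P ε₀ p) {u v : Euc N → ℝ} (hv0 : ∀ x, 0 ≤ v x)
    (huv : ∀ x y, |v x - v y| ≤ |u x - u y|) {Q X : ℝ} (hQ : P < Q)
    (hvQ : Integrable fun x => v x ^ Q) (hX : ∫ x, v x ^ Q = X)
    (x : Euc N) (hD : Integrable fun y => |u x - u y| ^ P * kern s (fun _ _ => P) (x, y))
    {r a : ℝ} (hr : 0 < r) (ha : 0 < a) :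
    v x ^ P * (r ^ (N : ℝ) * volume.real (Metric.ball (0 : Euc N) 1)) ≤
      2 ^ P * (r ^ (N + s * P) * ∫ y, |u x - u y| ^ P * kern s (fun _ _ => P) (x, y)) +
      2 ^ P * (a ^ (P - Q) * X + a ^ P * (r ^ (N : ℝ) * volume.real (Metric.ball (0 : Euc N) 1))) := by
  have hP := h.P1
  have hfin : volume (Metric.ball x r) ≠ ⊤ := measure_ball_lt_top.ne
  have hB : MeasurableSet (Metric.ball x r) := Metric.isOpen_ball.measurableSet
  rw [← ball_vol x hr]
  have e1 : v x ^ P * volume.real (Metric.ball x r) = ∫ y in Metric.ball x r, v x ^ P := by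
    rw [setIntegral_const, smul_eq_mul, mul_comm]
  have e2 : a ^ P * volume.real (Metric.ball x r) = ∫ y in Metric.ball x r, a ^ P := by
    rw [setIntegral_const, smul_eq_mul, mul_comm]
  have ic : ∀ c : ℝ, IntegrableOn (fun _ : Euc N => c) (Metric.ball x r) := fun c => integrableOn_const hfin
  have k0 : ∀ y, 0 ≤ |u x - u y| ^ P * kern s (fun _ _ => P) (x, y) := fun y => by
    have := kern_nonneg s (fun _ _ : Euc N => P) (x, y); positivity
  have b1 : ∫ y in Metric.ball x r, |u x - u y| ^ P * kern s (fun _ _ => P) (x, y) ≤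
      ∫ y, |u x - u y| ^ P * kern s (fun _ _ => P) (x, y) :=
    setIntegral_le_integral hD (Eventually.of_forall k0)
  have b2 : ∫ y in Metric.ball x r, v y ^ Q ≤ X := by
    rw [← hX]; exact setIntegral_le_integral hvQ (Eventually.of_forall fun y => Real.rpow_nonneg (hv0 y) _)
  have key : ∫ y in Metric.ball x r, v x ^ P ≤ ∫ y in Metric.ball x r,
      (2 ^ P * (r ^ (N + s * P) * (|u x - u y| ^ P * kern s (fun _ _ => P) (x, y))) +
       2 ^ P * (a ^ (P - Q) * v y ^ Q + a ^ P)) := by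
    refine setIntegral_mono_on (ic _) ?_ hB fun y hy => ?_
    · exact ((hD.integrableOn.const_mul _).const_mul _).add
        (((hvQ.integrableOn.const_mul _).add (ic _)).const_mul _)
    · have s1 := add_rpow_le (by linarith : 0 < P) (le_refl P) (v x - v y) (v y)
      rw [sub_add_cancel, abs_of_nonneg (hv0 x), abs_of_nonneg (hv0 y)] at s1
      have s2 : |v x - v y| ^ P ≤ r ^ (N + s * P) * (|u x - u y| ^ P * kern s (fun _ _ => P) (x, y)) := by
        by_cases hxy : x = y
        · subst hxy; simp only [sub_self, abs_zero]
          rw [Real.zero_rpow (by linarith)]; simp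
        have hd : 0 < dist x y := dist_pos.2 hxy
        have hd2 : dist x y ≤ r := by rw [dist_comm]; exact (Metric.mem_ball.1 hy).le
        have hsP := mul_pos h.s0 (by linarith : 0 < P)
        have : (dist x y) ^ ((N:ℝ) + s * P) ≤ r ^ ((N:ℝ) + s * P) :=
          Real.rpow_le_rpow hd.le hd2 (by positivity)
        have h1 : |v x - v y| ^ P ≤ |u x - u y| ^ P :=
          Real.rpow_le_rpow (abs_nonneg _) (huv x y) (by linarith)
        refine h1.trans ?_
        simp only [kern]
        rw [mul_one_div, mul_div_assoc', le_div_iff₀ (by positivity), mul_comm]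
        exact mul_le_mul_of_nonneg_right this (by positivity)
      have s3 : v y ^ P ≤ a ^ (P - Q) * v y ^ Q + a ^ P := by
        rcases le_or_gt (v y) a with h1 | h1
        · have : v y ^ P ≤ a ^ P := Real.rpow_le_rpow (hv0 y) h1 (by linarith)
          have : 0 ≤ a ^ (P - Q) * v y ^ Q := mul_nonneg (by positivity) (Real.rpow_nonneg (hv0 y) _)
          linarith
        · have hvy : 0 < v y := ha.trans h1
          have : v y ^ (P - Q) ≤ a ^ (P - Q) :=
            Real.rpow_le_rpow_of_nonpos ha h1.le (by linarith)
          have e : v y ^ P = v y ^ (P - Q) * v y ^ Q := by rw [← Real.rpow_add hvy]; ring_nf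
          have : 0 ≤ a ^ P := by positivity
          have : v y ^ (P - Q) * v y ^ Q ≤ a ^ (P - Q) * v y ^ Q := by gcongr
          linarith
      have : (0:ℝ) < 2 ^ P := by positivity
      nlinarith
  have j1 : IntegrableOn (fun y => 2 ^ P * (r ^ (N + s * P) * (|u x - u y| ^ P *
      kern s (fun _ _ => P) (x, y)))) (Metric.ball x r) := (hD.integrableOn.const_mul _).const_mul _
  have j2 : IntegrableOn (fun y => a ^ (P - Q) * v y ^ Q) (Metric.ball x r) := hvQ.integrableOn.const_mul _
  have j3 : IntegrableOn (fun y => 2 ^ P * (a ^ (P - Q) * v y ^ Q + a ^ P)) (Metric.ball x r) :=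
    (j2.add (ic _)).const_mul _
  rw [integral_add j1 j3, integral_const_mul, integral_const_mul,
    integral_const_mul, integral_add j2 (ic _), integral_const_mul, ← e1, ← e2] at key
  refine key.trans ?_
  gcongr

theorem sob_alg {n s P Q ω : ℝ} (hn : 0 < n) (hs : 0 < s) (hP : 1 < P) (hsP : s * P < n)
    (hQ : Q = n * P / (n - s * P)) (hω : 0 < ω) : ∃ C : ℝ, 0 < C ∧ ∀ V X D : ℝ, 0 < V → 0 < X → 0 ≤ D →
    (∀ r a : ℝ, 0 < r → 0 < a → V ^ P * (r ^ n * ω) ≤ 2 ^ P * (r ^ (n + s * P) * D) +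
      2 ^ P * (a ^ (P - Q) * X + a ^ P * (r ^ n * ω))) →
    V ^ Q ≤ C * X ^ (s * P / n) * D := by
  set K : ℝ := 2 * 4 ^ (1 / P) with hK
  have hK0 : 0 < K := by positivity
  set c : ℝ := 4 * 2 ^ P * K ^ (Q - P) with hc
  have hc0 : 0 < c := by positivity
  refine ⟨2 ^ (P + 1) / ω * (c / ω) ^ (s * P / n), by positivity, fun V X D hV hX hD hh => ?_⟩
  have hQe : P + Q * (s * P / n) = Q := by
    have h0 : n - s * P ≠ 0 := by linarith
    have h1 : Q * (n - s * P) = n * P := by rw [hQ, div_mul_cancel₀ _ h0]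
    have h2 : Q - Q * (s * P / n) = P := by
      have : Q - Q * (s * P / n) = Q * (n - s * P) / n := by field_simp
      rw [this, h1]; field_simp
    linarith
  set a := V / K with ha
  set r := (c / ω * X * V ^ (-Q)) ^ (1 / n) with hr
  have hbase : 0 < c / ω * X * V ^ (-Q) := by positivity
  have hr0 : 0 < r := by positivity
  have hrn : r ^ n * ω = c * X * V ^ (-Q) := by
    rw [hr, ← Real.rpow_mul hbase.le, one_div_mul_cancel hn.ne', Real.rpow_one]; field_simp
  have hrs : r ^ (s * P) = (c / ω) ^ (s * P / n) * X ^ (s * P / n) * V ^ (-(Q * (s * P / n))) := by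
    have e1 : 1 / n * (s * P) = s * P / n := by ring
    rw [hr, ← Real.rpow_mul hbase.le, e1, Real.mul_rpow (by positivity) (by positivity),
      Real.mul_rpow (by positivity) (by positivity), ← Real.rpow_mul hV.le, neg_mul]
  have h1 := hh r a hr0 (by positivity)
  have eK : K ^ P = 2 ^ P * 4 := by
    rw [hK, Real.mul_rpow (by norm_num) (by positivity), ← Real.rpow_mul (by norm_num),
      one_div_mul_cancel (by linarith), Real.rpow_one]
  have ea : 2 ^ P * (a ^ P * (r ^ n * ω)) = V ^ P * (r ^ n * ω) / 4 := by
    rw [ha, Real.div_rpow hV.le hK0.le, eK]; field_simp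
  have ea2 : 2 ^ P * (a ^ (P - Q) * X) = V ^ P * (r ^ n * ω) / 4 := by
    rw [hrn, ha, Real.div_rpow hV.le hK0.le, hc, Real.rpow_sub hV, Real.rpow_sub hK0, Real.rpow_sub hK0,
      Real.rpow_neg hV.le]
    field_simp
  have h2 : V ^ P * (r ^ n * ω) / 2 ≤ 2 ^ P * (r ^ (n + s * P) * D) := by
    rw [mul_add, ea, ea2] at h1; linarith
  have h3 : V ^ P * ω / 2 ≤ 2 ^ P * (r ^ (s * P) * D) := by
    rw [Real.rpow_add hr0] at h2
    have : 0 < r ^ n := by positivity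
    have e : V ^ P * (r ^ n * ω) / 2 = r ^ n * (V ^ P * ω / 2) := by ring
    have e' : 2 ^ P * (r ^ n * r ^ (s * P) * D) = r ^ n * (2 ^ P * (r ^ (s * P) * D)) := by ring
    rw [e, e'] at h2
    exact le_of_mul_le_mul_left h2 this
  rw [hrs, Real.rpow_neg hV.le] at h3
  have hVQ : V ^ Q = V ^ P * V ^ (Q * (s * P / n)) := by rw [← Real.rpow_add hV, hQe]
  rw [hVQ, Real.rpow_add_one (by norm_num)]
  set W := V ^ (Q * (s * P / n)) with hW
  have hW0 : 0 < W := by positivity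
  have h4 := mul_le_mul_of_nonneg_right h3 hW0.le
  have e5 : 2 ^ P * ((c / ω) ^ (s * P / n) * X ^ (s * P / n) * W⁻¹ * D) * W =
    2 ^ P * ((c / ω) ^ (s * P / n) * X ^ (s * P / n) * D) := by field_simp
  rw [e5] at h4
  have e6 : V ^ P * W = 2 / ω * (V ^ P * ω / 2 * W) := by field_simp
  rw [e6]
  calc _ ≤ 2 / ω * (2 ^ P * ((c / ω) ^ (s * P / n) * X ^ (s * P / n) * D)) := by gcongr
    _ = _ := by ring

/-- fractional Sobolev embedding, qualitative -/
theorem Ctx.sobolev (h : Ctx s P ε₀ p) {u : Euc N → ℝ} (hu : Measurable u)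
    (h1 : Integrable fun x => |u x| ^ P)
    (h2 : Integrable (fun z => |u z.1 - u z.2| ^ p z.1 z.2) (kap s p))
    {Q : ℝ} (hQ : Q = N * P / (N - s * P)) :
    Integrable fun x => |u x| ^ Q := by
  have hP := h.P1
  have hN : (0:ℝ) < N := by exact_mod_cast h.N0
  have hsP := h.sP
  have hsP0 := mul_pos h.s0 (by linarith : 0 < P)
  have hPQ : P < Q := by
    rw [hQ, lt_div_iff₀ (by linarith)]; nlinarith
  have hω : 0 < volume.real (Metric.ball (0 : Euc N) 1) :=
    ENNReal.toReal_pos (Metric.measure_ball_pos _ _ one_pos).ne' measure_ball_lt_top.ne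
  obtain ⟨C, hC0, hC⟩ := sob_alg hN h.s0 hP hsP hQ hω
  have hT := h.toConst hu h1 h2
  have hDi := hT.integral_prod_left
  have hDa := hT.prod_right_ae
  simp only at hDi hDa
  set D : Euc N → ℝ := fun x => ∫ y, |u x - u y| ^ P * kern s (fun _ _ => P) (x, y) with hDd
  have hD0 : ∀ x, 0 ≤ D x := fun x => integral_nonneg fun y => by
    have := kern_nonneg s (fun _ _ : Euc N => P) (x, y); positivity
  set E := ∫ x, D x with hE
  have hE0 : 0 ≤ E := integral_nonneg hD0
  set γ := s * P / N with hγ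
  have hγ1 : γ < 1 := by rw [hγ, div_lt_one hN]; exact hsP
  let v : ℕ → Euc N → ℝ := fun k x => min |u x| k
  have vm : ∀ k, Measurable (v k) := fun k => hu.abs.min measurable_const
  have v0 : ∀ k x, 0 ≤ v k x := fun k x => le_min (abs_nonneg _) (Nat.cast_nonneg _)
  have vi : ∀ k, Integrable fun x => v k x ^ Q := fun k => by
    refine (h1.const_mul ((k:ℝ) ^ (Q - P))).mono' ((vm k).pow_const Q).aestronglyMeasurable
      (Eventually.of_forall fun x => ?_)
    rw [Real.norm_eq_abs, abs_of_nonneg (Real.rpow_nonneg (v0 k x) _)]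
    rcases (v0 k x).eq_or_lt with h0 | h0
    · rw [← h0, Real.zero_rpow (by linarith)]; positivity
    · have : v k x ^ Q = v k x ^ (Q - P) * v k x ^ P := by rw [← Real.rpow_add h0]; ring_nf
      rw [this]
      have a1 : v k x ≤ k := min_le_right _ _
      have a2 : v k x ≤ |u x| := min_le_left _ _
      have := Real.rpow_le_rpow h0.le a1 (by linarith : 0 ≤ Q - P)
      have := Real.rpow_le_rpow h0.le a2 (by linarith : 0 ≤ P)
      gcongr
  have vb : ∀ k, ∫ x, v k x ^ Q ≤ (C * E) ^ (1 / (1 - γ)) := fun k => by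
    have hX0 : 0 ≤ ∫ x, v k x ^ Q := integral_nonneg fun x => Real.rpow_nonneg (v0 k x) _
    set X := ∫ x, v k x ^ Q with hX
    rcases hX0.eq_or_lt with h0 | h0
    · rw [← h0]; positivity
    have hpt : ∀ᵐ x, v k x ^ Q ≤ C * X ^ γ * D x := by
      filter_upwards [hDa] with x hx
      rcases (v0 k x).eq_or_lt with h00 | h00
      · rw [← h00, Real.zero_rpow (by linarith)]
        have := hD0 x
        positivity
      refine hC _ _ _ h00 h0 (hD0 x) fun r a hr ha => ?_
      refine sob_pt h (v0 k) (fun x y => ?_) hPQ (vi k) hX.symm x hx hr ha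
      calc |min |u x| (k:ℝ) - min |u y| k| ≤ max |(|u x| - |u y|)| |(k:ℝ) - k| := abs_min_sub_min_le_max _ _ _ _
        _ ≤ _ := by simp [abs_abs_sub_abs_le]
    have h3 : X ≤ C * X ^ γ * E := by
      rw [hE, ← integral_const_mul]
      exact integral_mono_ae (vi k) (hDi.const_mul _) hpt
    have h4 : X ^ (1 - γ) ≤ C * E := by
      rw [Real.rpow_sub h0, Real.rpow_one, div_le_iff₀ (by positivity)]
      linarith
    have := Real.rpow_le_rpow (by positivity) h4 (by rw [one_div_nonneg]; linarith : 0 ≤ 1 / (1 - γ))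
    rwa [← Real.rpow_mul h0.le, mul_one_div_cancel (by linarith), Real.rpow_one] at this
  refine (fatou_real (fun k => (vm k).pow_const Q) (hu.abs.pow_const Q)
    (fun k x => Real.rpow_nonneg (v0 k x) _) (fun x => by positivity) vi vb
    (Eventually.of_forall fun x => ?_)).1
  refine tendsto_const_nhds.congr' ?_
  filter_upwards [eventually_ge_atTop ⌈|u x|⌉₊] with k hk
  have : |u x| ≤ k := (Nat.le_ceil _).trans (by exact_mod_cast hk)
  simp only [v, min_eq_left this]

theorem Ctx.sobolev_q (h : Ctx s P ε₀ p) {u : Euc N → ℝ} (hu : Measurable u)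
    (h1 : Integrable fun x => |u x| ^ P)
    (h2 : Integrable (fun z => |u z.1 - u z.2| ^ p z.1 z.2) (kap s p))
    {q : Euc N → ℝ} (hq : Measurable q) (hPq : ∀ x, P ≤ q x) (hqQ : ∀ x, q x ≤ N * P / (N - s * P)) :
    Integrable fun x => |u x| ^ q x := by
  have h3 := h.sobolev hu h1 h2 rfl
  refine (h1.add h3).mono' (hu.abs.pow hq).aestronglyMeasurable (Eventually.of_forall fun x => ?_)
  rw [Real.norm_eq_abs, abs_of_nonneg (by positivity), Pi.add_apply]
  have hP := h.P1
  rcases le_total |u x| 1 with h4 | h4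
  · rcases (abs_nonneg (u x)).eq_or_lt with h0 | h0
    · rw [← h0, Real.zero_rpow (by linarith [hPq x])]; positivity
    have := Real.rpow_le_rpow_of_exponent_ge h0 h4 (hPq x)
    have : 0 ≤ |u x| ^ (N * P / (N - s * P)) := by positivity
    linarith
  · have := Real.rpow_le_rpow_of_exponent_le h4 (hqQ x)
    have : 0 ≤ |u x| ^ P := by positivity
    linarith
end

theorem cauchy_l1_ae {Ω : Type*} [MeasurableSpace Ω] {μ : Measure Ω} {u : ℕ → Ω → ℝ}
    (hu : ∀ n, Integrable (u n) μ)
    (h : ∀ ε > (0:ℝ), ∃ n₀, ∀ n ≥ n₀, ∀ m ≥ n₀, ∫ x, |u n x - u m x| ∂μ ≤ ε) :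
    ∃ φ : ℕ → ℕ, StrictMono φ ∧ ∃ v : Ω → ℝ, Measurable v ∧
      ∀ᵐ x ∂μ, Tendsto (fun n => u (φ n) x) atTop (𝓝 (v x)) := by
  have h1 : ∀ j : ℕ, ∀ᶠ k in atTop, ∀ n ≥ k, ∀ m ≥ k, ∫ x, |u n x - u m x| ∂μ ≤ (1/2:ℝ) ^ (j + 1) / 2 := by
    intro j
    obtain ⟨n0, hn0⟩ := h ((1/2:ℝ) ^ (j + 1) / 2) (by positivity)
    filter_upwards [eventually_ge_atTop n0] with k hk n hn m hm
    exact hn0 n (hk.trans hn) m (hk.trans hm)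
  obtain ⟨φ, hφ, hφ2⟩ := extraction_forall_of_eventually h1
  refine ⟨φ, hφ, ?_⟩
  refine measurable_limit_of_tendsto_metrizable_ae (fun n => (hu (φ n)).1.aemeasurable) ?_
  refine Lp.ae_tendsto_of_cauchy_eLpNorm (p := 1) (fun n => (hu (φ n)).1) le_rfl
    (B := fun j => ENNReal.ofReal ((1/2:ℝ) ^ (j + 1))) ?_ ?_
  · rw [← ENNReal.ofReal_tsum_of_nonneg (fun n => by positivity)]
    · exact ENNReal.ofReal_ne_top
    · exact (summable_nat_add_iff 1).2 summable_geometric_two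
  · intro j n m hn hm
    rw [eLpNorm_one_eq_lintegral_enorm]
    have h2 : ∫⁻ x, ‖(u (φ n) - u (φ m)) x‖ₑ ∂μ = ENNReal.ofReal (∫ x, |u (φ n) x - u (φ m) x| ∂μ) := by
      have hi : Integrable (fun x => |u (φ n) x - u (φ m) x|) μ := ((hu _).sub (hu _)).abs
      rw [ofReal_integral_eq_lintegral_ofReal hi
        (Eventually.of_forall fun x => abs_nonneg _)]
      refine lintegral_congr fun x => ?_
      rw [Pi.sub_apply, ← Real.norm_eq_abs, ofReal_norm]
    rw [h2]
    refine (ENNReal.ofReal_le_ofReal (hφ2 j _ (hφ.monotone hn) _ (hφ.monotone hm))).trans_lt ?_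
    rw [ENNReal.ofReal_lt_ofReal_iff (by positivity)]
    have : (0:ℝ) < (1/2) ^ (j + 1) := by positivity
    linarith

theorem diag_subseq (x : ℕ → ℕ × ℕ → ℝ) (b : ℕ × ℕ → ℝ) (hb : ∀ n k, |x n k| ≤ b k) :
    ∃ φ : ℕ → ℕ, StrictMono φ ∧ ∃ a : ℕ × ℕ → ℝ, ∀ k, Tendsto (fun n => x (φ n) k) atTop (𝓝 (a k)) := by
  have hc : IsCompact (univ.pi fun k : ℕ × ℕ => Icc (-b k) (b k)) := isCompact_univ_pi fun k => isCompact_Icc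
  have hx : ∀ n, x n ∈ (univ.pi fun k : ℕ × ℕ => Icc (-b k) (b k)) := fun n k _ => abs_le.1 (hb n k)
  obtain ⟨a, -, φ, hφ, ha⟩ := hc.tendsto_subseq hx
  exact ⟨φ, hφ, a, fun k => (tendsto_pi_nhds.1 ha) k⟩

theorem abs_le_one_add {P : ℝ} (hP : 1 < P) (t : ℝ) : |t| ≤ 1 + |t| ^ P := by
  rcases le_total |t| 1 with h | h
  · have : 0 ≤ |t| ^ P := by positivity
    linarith
  · have := Real.rpow_le_rpow_of_exponent_le h hP.le
    rw [Real.rpow_one] at this; linarith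

theorem abs_le_eta {P η : ℝ} (hP : 1 < P) (hη : 0 < η) (t : ℝ) : |t| ≤ η + η ^ (1 - P) * |t| ^ P := by
  have := mul_le_mul_of_nonneg_left (abs_le_one_add hP (t / η)) hη.le
  rw [abs_div, abs_of_pos hη, Real.div_rpow (abs_nonneg _) hη.le] at this
  rw [Real.rpow_sub hη, Real.rpow_one]
  calc |t| = η * (|t| / η) := by field_simp
    _ ≤ _ := this
    _ = _ := by ring

section
variable {N : ℕ} {s P ε₀ : ℝ} {p : Euc N → Euc N → ℝ}

def avg (u : Euc N → ℝ) (z : Euc N) (r : ℝ) : ℝ :=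
  (∫ y in Metric.ball z r, u y) / volume.real (Metric.ball z r)

theorem exists_idx {r : ℝ} (hr : 0 < r) : ∃ i : Euc N → ℕ, Measurable i ∧
    ∀ x, dist x (TopologicalSpace.denseSeq (Euc N) (i x)) < r := by
  classical
  have h : ∀ x : Euc N, ∃ i, dist x (TopologicalSpace.denseSeq (Euc N) i) < r := fun x =>
    (TopologicalSpace.denseRange_denseSeq (Euc N)).exists_dist_lt x hr
  refine ⟨fun x => Nat.find (h x), measurable_find h fun k => ?_, fun x => Nat.find_spec (h x)⟩
  exact measurableSet_lt (measurable_id.dist measurable_const) measurable_const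

theorem loc_int (hP : 1 < P) {u : Euc N → ℝ} (hu : Measurable u) (h1 : Integrable fun x => |u x| ^ P)
    {μ : Measure (Euc N)} [IsFiniteMeasure μ] (hμ : μ ≤ volume) : Integrable u μ := by
  refine ((integrable_const (1:ℝ)).add (h1.mono_measure hμ)).mono' hu.aestronglyMeasurable
    (Eventually.of_forall fun x => ?_)
  exact abs_le_one_add hP (u x)

theorem loc_int_ball (hP : 1 < P) {u : Euc N → ℝ} (hu : Measurable u) (h1 : Integrable fun x => |u x| ^ P)
    (z : Euc N) (r : ℝ) : IntegrableOn u (Metric.ball z r) := by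
  have : IsFiniteMeasure (volume.restrict (Metric.ball z r)) := ⟨by
    rw [Measure.restrict_apply_univ]; exact measure_ball_lt_top⟩
  exact loc_int hP hu h1 Measure.restrict_le_self

theorem ball_pos (z : Euc N) {r : ℝ} (hr : 0 < r) : 0 < volume.real (Metric.ball z r) :=
  ENNReal.toReal_pos (Metric.measure_ball_pos _ _ hr).ne' measure_ball_lt_top.ne

theorem avg_bd (hP : 1 < P) {u : Euc N → ℝ} (hu : Measurable u) (h1 : Integrable fun x => |u x| ^ P)
    {C : ℝ} (hC : ∫ x, |u x| ^ P ≤ C) (z : Euc N) {r : ℝ} (hr : 0 < r) :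
    |avg u z r| ≤ 1 + C / volume.real (Metric.ball z r) := by
  have hb := ball_pos z hr
  rw [avg, abs_div, abs_of_pos hb, div_le_iff₀ hb, add_mul, div_mul_cancel₀ _ hb.ne', one_mul]
  have i1 : IntegrableOn (fun _ : Euc N => (1:ℝ)) (Metric.ball z r) :=
    integrableOn_const measure_ball_lt_top.ne
  calc |∫ y in Metric.ball z r, u y| ≤ ∫ y in Metric.ball z r, |u y| := abs_integral_le_integral_abs
    _ ≤ ∫ y in Metric.ball z r, (1 + |u y| ^ P) :=
      integral_mono (loc_int_ball hP hu h1 z r).abs (i1.add h1.integrableOn)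
        fun y => abs_le_one_add hP (u y)
    _ = volume.real (Metric.ball z r) + ∫ y in Metric.ball z r, |u y| ^ P := by
      rw [integral_add i1 h1.integrableOn, setIntegral_const, smul_eq_mul, mul_one]
    _ ≤ _ := by
      have := setIntegral_le_integral (s := Metric.ball z r) h1 (Eventually.of_forall fun x => by positivity)
      linarith

theorem avg_pt (h : Ctx s P ε₀ p) {u : Euc N → ℝ} (hu : Measurable u)
    (h1 : Integrable fun x => |u x| ^ P) (x z : Euc N) {r η : ℝ} (hr : 0 < r) (hr2 : 2 * r < ε₀)
    (hη : 0 < η) (hz : dist x z < r)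
    (hD : Integrable fun y => |u x - u y| ^ p x y * kern s p (x, y)) :
    |u x - avg u z r| ≤ η + η ^ (1 - P) * ((2 * r) ^ (N + s * P) / volume.real (Metric.ball z r) *
      ∫ y, |u x - u y| ^ p x y * kern s p (x, y)) := by
  have hP := h.P1
  have hb := ball_pos z hr
  have ic : ∀ c : ℝ, IntegrableOn (fun _ : Euc N => c) (Metric.ball z r) := fun c =>
    integrableOn_const measure_ball_lt_top.ne
  have iu := loc_int_ball hP hu h1 z r
  have k0 : ∀ y, 0 ≤ |u x - u y| ^ p x y * kern s p (x, y) := fun y => by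
    have := kern_nonneg s p (x, y); positivity
  set V := volume.real (Metric.ball z r) with hV
  have e1 : (u x - avg u z r) * V = ∫ y in Metric.ball z r, (u x - u y) := by
    rw [integral_sub (ic _) iu, setIntegral_const, smul_eq_mul, avg, sub_mul, div_mul_cancel₀ _ hb.ne']
    ring
  have e2 : |u x - avg u z r| * V ≤ ∫ y in Metric.ball z r, (η + η ^ (1 - P) * ((2 * r) ^ (N + s * P) *
      (|u x - u y| ^ p x y * kern s p (x, y)))) := by
    rw [← abs_of_pos hb, ← abs_mul, e1]
    refine abs_integral_le_integral_abs.trans ?_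
    refine setIntegral_mono_on ((ic _).sub iu).abs ((ic _).add
      ((hD.integrableOn.const_mul _).const_mul _)) Metric.isOpen_ball.measurableSet fun y hy => ?_
    refine (abs_le_eta hP hη _).trans ?_
    gcongr
    by_cases hxy : x = y
    · subst hxy; simp only [sub_self, abs_zero]
      rw [Real.zero_rpow (by linarith)]; 
      have := k0 x
      simp only [sub_self, abs_zero] at this
      positivity
    have hd : 0 < dist x y := dist_pos.2 hxy
    have hd2 : dist x y ≤ 2 * r := by
      have := dist_triangle x z y
      have h3 := Metric.mem_ball.1 hy
      rw [dist_comm] at h3; linarith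
    have hpe := h.diag x y (by linarith)
    have hsP := mul_pos h.s0 (by linarith : 0 < P)
    have : (dist x y) ^ ((N:ℝ) + s * P) ≤ (2 * r) ^ ((N:ℝ) + s * P) :=
      Real.rpow_le_rpow hd.le hd2 (by positivity)
    simp only [kern, hpe]
    rw [mul_one_div, mul_div_assoc', le_div_iff₀ (by positivity), mul_comm]
    exact mul_le_mul_of_nonneg_right this (by positivity)
  rw [integral_add (ic _) ((hD.integrableOn.const_mul _).const_mul _), setIntegral_const, smul_eq_mul,
    integral_const_mul, integral_const_mul] at e2
  have e3 := setIntegral_le_integral (s := Metric.ball z r) hD (Eventually.of_forall k0)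
  rw [← le_div_iff₀ hb] at e2
  refine e2.trans ?_
  rw [add_div, ← hV, mul_div_cancel_left₀ _ hb.ne', mul_div_assoc, div_mul_eq_mul_div]
  gcongr

set_option maxHeartbeats 400000 in
theorem Ctx.compact (h : Ctx s P ε₀ p) {u : ℕ → Euc N → ℝ} (hu : ∀ n, Measurable (u n))
    (h1 : ∀ n, Integrable fun x => |u n x| ^ P)
    (h2 : ∀ n, Integrable (fun z => |u n z.1 - u n z.2| ^ p z.1 z.2) (kap s p))
    {C : ℝ} (hC1 : ∀ n, ∫ x, |u n x| ^ P ≤ C)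
    (hC2 : ∀ n, ∫ z, |u n z.1 - u n z.2| ^ p z.1 z.2 ∂(kap s p) ≤ C) :
    ∃ φ : ℕ → ℕ, StrictMono φ ∧ ∃ v : Euc N → ℝ, Measurable v ∧
      ∀ᵐ x, Tendsto (fun n => u (φ n) x) atTop (𝓝 (v x)) := by
  have hP := h.P1
  have he := h.e0
  have hC0 : 0 ≤ C := le_trans (integral_nonneg fun x => by positivity) (hC1 0)
  set ρ : Euc N → ℝ := fun x => (1 + ‖x‖) ^ (-((N:ℝ) + 1)) with hρ
  have hρi : Integrable ρ := integrable_one_add_norm (by simp)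
  have hρ0 : ∀ x, 0 < ρ x := fun x => by have := norm_nonneg x; positivity
  have hρ1 : ∀ x, ρ x ≤ 1 := fun x => by
    refine Real.rpow_le_one_of_one_le_of_nonpos (by linarith [norm_nonneg x]) ?_
    have : (0:ℝ) ≤ N := Nat.cast_nonneg _
    linarith
  have hρm : Measurable ρ := (measurable_norm.const_add _).pow_const _
  set μ : Measure (Euc N) := volume.withDensity (fun x => ENNReal.ofReal (ρ x)) with hμ
  have hμle : μ ≤ volume := by
    conv_rhs => rw [← withDensity_one (μ := (volume : Measure (Euc N)))]
    refine withDensity_mono (Eventually.of_forall fun x => ?_)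
    exact ENNReal.ofReal_le_one.2 (hρ1 x)
  have hμac : volume ≪ μ := withDensity_absolutelyContinuous' hρm.ennreal_ofReal.aemeasurable
    (Eventually.of_forall fun x => (ENNReal.ofReal_pos.2 (hρ0 x)).ne')
  have hμf : IsFiniteMeasure μ := isFiniteMeasure_withDensity_ofReal hρi.2
  set d := TopologicalSpace.denseSeq (Euc N) with hd
  set r : ℕ → ℝ := fun k => ε₀ / 4 / (k + 1) with hr
  have hr0 : ∀ k, 0 < r k := fun k => by positivity
  have hr2 : ∀ k, 2 * r k < ε₀ := fun k => by
    have : r k ≤ ε₀ / 4 := div_le_self (by positivity) (by linarith [(Nat.cast_nonneg k : (0:ℝ) ≤ k)])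
    linarith
  have hrt : Tendsto r atTop (𝓝 0) :=
    tendsto_const_div_atTop_nhds_zero_nat (ε₀ / 4) |>.comp (tendsto_add_atTop_nat 1) |>.congr fun k => by
      simp [hr]
  set ω := volume.real (Metric.ball (0 : Euc N) 1) with hω
  have hω0 : 0 < ω := ball_pos 0 one_pos
  choose idx im hidx using fun k => exists_idx (N := N) (hr0 k)
  -- subsequence
  set b : ℕ → ℝ := fun k => 1 + C / (r k ^ (N:ℝ) * ω) with hb
  have hbd : ∀ n k i, |avg (u n) (d i) (r k)| ≤ b k := fun n k i => by
    have := avg_bd hP (hu n) (h1 n) (hC1 n) (d i) (hr0 k)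
    rwa [ball_vol _ (hr0 k)] at this
  obtain ⟨φ, hφ, a, ha⟩ := diag_subseq (fun n ki => avg (u n) (d ki.2) (r ki.1)) (fun ki => b ki.1)
    (fun n ki => hbd n ki.1 ki.2)
  have iu : ∀ n, Integrable (u n) μ := fun n => loc_int hP (hu n) (h1 n) hμle
  set A : ℕ → ℕ → Euc N → ℝ := fun n k x => avg (u n) (d (idx k x)) (r k) with hA
  have Am : ∀ n k, Measurable (A n k) := fun n k =>
    (measurable_from_nat (f := fun i => avg (u n) (d i) (r k))).comp (im k)
  have Ai : ∀ n k, Integrable (A n k) μ := fun n k =>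
    (integrable_const (b k)).mono' (Am n k).aestronglyMeasurable (Eventually.of_forall fun x => hbd _ _ _)
  have est : ∀ η > 0, ∀ k n, ∫ x, |u n x - A n k x| ∂μ ≤ η * μ.real univ +
      η ^ (1 - P) * (2 ^ (N + s * P) / ω * r k ^ (s * P) * C) := by
    intro η hη k n
    have hD := h.int_kap_iff.1 (h2 n)
    have hDi := hD.integral_prod_left
    have hDa := hD.prod_right_ae
    simp only at hDi hDa
    have hIC := hC2 n
    rw [h.integral_kap (h2 n)] at hIC
    set D : Euc N → ℝ := fun x => ∫ y, |u n x - u n y| ^ p x y * kern s p (x, y) with hDd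
    have hD0 : ∀ x, 0 ≤ D x := fun x => integral_nonneg fun y => by
      have := kern_nonneg s p (x, y); positivity
    have hpt : ∀ᵐ x ∂μ, |u n x - A n k x| ≤ η + η ^ (1 - P) * (2 ^ (N + s * P) / ω * r k ^ (s * P)) * D x := by
      filter_upwards [(Measure.absolutelyContinuous_of_le hμle).ae_le hDa] with x hx
      refine (avg_pt h (hu n) (h1 n) x _ (hr0 k) (hr2 k) hη (hidx k x) hx).trans (le_of_eq ?_)
      rw [ball_vol _ (hr0 k), ← hω, Real.mul_rpow (by norm_num) (hr0 k).le, Real.rpow_add (hr0 k) (N:ℝ)]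
      have : 0 < r k ^ (N:ℝ) := Real.rpow_pos_of_pos (hr0 k) _
      simp only [hDd]
      field_simp
    have iD : Integrable (fun x => η ^ (1 - P) * (2 ^ (N + s * P) / ω * r k ^ (s * P)) * D x) μ :=
      (hDi.mono_measure hμle).const_mul _
    refine (integral_mono_ae ((iu n).sub (Ai n k)).abs ((integrable_const η).add iD) hpt).trans ?_
    rw [integral_add' (integrable_const η) iD, integral_const,
      smul_eq_mul, mul_comm _ η, integral_const_mul, ← mul_assoc (η ^ (1 - P))]
    have := integral_mono_measure hμle (Eventually.of_forall hD0) hDi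
    have := (hr0 k).le
    have hfin : ∫ a, D a ∂μ ≤ C := by linarith
    have hpos : 0 ≤ η ^ (1 - P) * (2 ^ (N + s * P) / ω * r k ^ (s * P)) := by positivity
    have := mul_le_mul_of_nonneg_left hfin hpos
    linarith
  have hcau : ∀ ε > (0:ℝ), ∃ n₀, ∀ n ≥ n₀, ∀ m ≥ n₀, ∫ x, |u (φ n) x - u (φ m) x| ∂μ ≤ ε := by
    intro ε hε
    set M := μ.real univ with hM
    have hM0 : 0 ≤ M := measureReal_nonneg
    set η := ε / (8 * (M + 1)) with hη
    have hη0 : 0 < η := by positivity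
    have hηM : η * M ≤ ε / 8 := by
      rw [hη, div_mul_eq_mul_div, div_le_div_iff₀ (by positivity) (by norm_num)]; nlinarith
    have hk : ∀ᶠ k in atTop, η ^ (1 - P) * (2 ^ (N + s * P) / ω * r k ^ (s * P) * C) < ε / 8 := by
      have hsP := mul_pos h.s0 (by linarith : 0 < P)
      have t1 : Tendsto (fun k => r k ^ (s * P)) atTop (𝓝 0) := by
        have := hrt.rpow_const (p := s * P) (Or.inr hsP.le)
        rwa [Real.zero_rpow hsP.ne'] at this
      have t2 := (((t1.const_mul (2 ^ (N + s * P) / ω)).mul_const C).const_mul (η ^ (1 - P)))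
      simp only [mul_zero, zero_mul] at t2
      exact t2.eventually_lt_const (by positivity)
    obtain ⟨k, hk⟩ := hk.exists
    have hE : ∀ n, ∫ x, |u n x - A n k x| ∂μ ≤ ε / 4 := fun n => (est η hη0 k n).trans (by linarith)
    have hT : Tendsto (fun n => ∫ x, |A (φ n) k x - a (k, idx k x)| ∂μ) atTop (𝓝 0) := by
      have := tendsto_integral_of_dominated_convergence (μ := μ) (F := fun n x => |A (φ n) k x - a (k, idx k x)|)
        (f := fun _ => 0) (fun _ => 2 * b k) (fun n => ?_) (integrable_const _) (fun n => ?_) ?_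
      · simpa using this
      · exact ((Am _ k).sub ((measurable_from_nat (f := fun i => a (k, i))).comp (im k))).abs.aestronglyMeasurable
      · refine Eventually.of_forall fun x => ?_
        rw [Real.norm_eq_abs, abs_abs]
        have h3 := hbd (φ n) k (idx k x)
        have h4 : |a (k, idx k x)| ≤ b k :=
          le_of_tendsto (ha (k, idx k x)).abs (Eventually.of_forall fun n => hbd _ _ _)
        exact (abs_sub _ _).trans (by simp only [hA]; linarith)
      · refine Eventually.of_forall fun x => ?_
        have := ((ha (k, idx k x)).sub_const (a (k, idx k x))).abs
        simpa using this
    have iA : Integrable (fun x => a (k, idx k x)) μ := by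
      refine (integrable_const (b k)).mono' ((measurable_from_nat (f := fun i => a (k, i))).comp
        (im k)).aestronglyMeasurable (Eventually.of_forall fun x => ?_)
      exact le_of_tendsto (ha (k, idx k x)).abs (Eventually.of_forall fun n => hbd _ _ _)
    obtain ⟨n0, hn0⟩ := eventually_atTop.1 (hT.eventually_lt_const (by positivity : 0 < ε / 4))
    refine ⟨n0, fun n hn m hm => ?_⟩
    have j1 : ∀ n, Integrable (fun x => |u (φ n) x - A (φ n) k x|) μ := fun n =>
      ((iu (φ n)).sub (Ai (φ n) k)).abs
    have j2 : ∀ n, Integrable (fun x => |A (φ n) k x - a (k, idx k x)|) μ := fun n =>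
      ((Ai (φ n) k).sub iA).abs
    have j3 : ∀ n, Integrable (fun x => |u (φ n) x - A (φ n) k x| + |A (φ n) k x - a (k, idx k x)|) μ :=
      fun n => (j1 n).add (j2 n)
    have hh : ∫ x, |u (φ n) x - u (φ m) x| ∂μ ≤ ∫ x, ((|u (φ n) x - A (φ n) k x| +
        |A (φ n) k x - a (k, idx k x)|) + (|u (φ m) x - A (φ m) k x| + |A (φ m) k x - a (k, idx k x)|)) ∂μ := by
      refine integral_mono ((iu _).sub (iu _)).abs ((j3 n).add (j3 m)) fun x => ?_
      simp only
      have e : u (φ n) x - u (φ m) x = ((u (φ n) x - A (φ n) k x) + (A (φ n) k x - a (k, idx k x))) -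
        ((u (φ m) x - A (φ m) k x) + (A (φ m) k x - a (k, idx k x))) := by ring
      rw [e]
      exact (abs_sub _ _).trans (add_le_add (abs_add_le _ _) (abs_add_le _ _))
    refine hh.trans ?_
    rw [integral_add (j3 n) (j3 m), integral_add (j1 n) (j2 n), integral_add (j1 m) (j2 m)]
    have := hE (φ n); have := hE (φ m); have := hn0 n hn; have := hn0 m hm
    linarith
  obtain ⟨ψ, hψ, v, hv, hl⟩ := cauchy_l1_ae (u := fun n => u (φ n)) (fun n => iu _) hcau
  exact ⟨φ ∘ ψ, hφ.comp hψ, v, hv, hμac.ae_le hl⟩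
end

section
variable {N : ℕ} {s P ε₀ : ℝ} {p : Euc N → Euc N → ℝ}

structure InW (s P : ℝ) (p : Euc N → Euc N → ℝ) (u : Euc N → ℝ) : Prop where
  meas : Measurable u
  iP : Integrable fun x => |u x| ^ P
  iD : Integrable (fun z => |u z.1 - u z.2| ^ p z.1 z.2) (kap s p)

def Md (s P : ℝ) (p : Euc N → Euc N → ℝ) (u : Euc N → ℝ) : ℝ :=
  (∫ x, |u x| ^ P) + ∫ z, |u z.1 - u z.2| ^ p z.1 z.2 ∂(kap s p)

theorem Md_nonneg (u : Euc N → ℝ) : 0 ≤ Md s P p u :=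
  add_nonneg (integral_nonneg fun x => by positivity) (integral_nonneg fun x => by positivity)

theorem Dmeas {u : Euc N → ℝ} (hu : Measurable u) :
    Measurable fun z : Euc N × Euc N => u z.1 - u z.2 :=
  (hu.comp measurable_fst).sub (hu.comp measurable_snd)

theorem Ctx.Dpow (h : Ctx s P ε₀ p) {u : Euc N → ℝ} (hu : Measurable u) :
    Measurable fun z : Euc N × Euc N => |u z.1 - u z.2| ^ p z.1 z.2 :=
  (Dmeas hu).abs.pow h.pc.measurable

theorem Ctx.sobMod (h : Ctx s P ε₀ p) {u : Euc N → ℝ} (hu : Measurable u) :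
    sobModular Set.univ s p u = (∫⁻ x, ENNReal.ofReal (|u x| ^ P)) +
      ∫⁻ z, ENNReal.ofReal (|u z.1 - u z.2| ^ p z.1 z.2) ∂(kap s p) := by
  rw [h.lint_kap (h.Dpow hu)]
  have hd : ∀ x, p x x = P := fun x => h.diag x x (by rw [dist_self]; exact h.e0)
  simp only [sobModular, sobKernel, Measure.restrict_univ, hd, kern, mul_one_div]

theorem Ctx.inW_of (h : Ctx s P ε₀ p) {u : Euc N → ℝ} (hu : Measurable u)
    (hm : sobModular Set.univ s p u < ⊤) : InW s P p u := by
  rw [h.sobMod hu] at hm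
  have := ENNReal.add_lt_top.1 hm
  refine ⟨hu, ⟨(hu.abs.pow_const P).aestronglyMeasurable, ?_⟩, ⟨(h.Dpow hu).aestronglyMeasurable, ?_⟩⟩
  · rw [hasFiniteIntegral_iff_ofReal (Eventually.of_forall fun x => by positivity)]; exact this.1
  · rw [hasFiniteIntegral_iff_ofReal (Eventually.of_forall fun x => by positivity)]; exact this.2

theorem InW.mod (h : Ctx s P ε₀ p) {u : Euc N → ℝ} (hu : InW s P p u) :
    sobModular Set.univ s p u = ENNReal.ofReal (Md s P p u) := by
  rw [h.sobMod hu.meas, Md, ENNReal.ofReal_add (integral_nonneg fun x => by positivity)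
    (integral_nonneg fun x => by positivity),
    ofReal_integral_eq_lintegral_ofReal hu.iP (Eventually.of_forall fun x => by positivity),
    ofReal_integral_eq_lintegral_ofReal hu.iD (Eventually.of_forall fun x => by positivity)]

theorem InW.memSob (h : Ctx s P ε₀ p) {u : Euc N → ℝ} (hu : InW s P p u) : MemSob Set.univ s p u :=
  ⟨hu.meas.aestronglyMeasurable, by rw [hu.mod h]; exact ENNReal.ofReal_lt_top⟩

theorem sobNorm_nonneg (u : Euc N → ℝ) : 0 ≤ sobNorm Set.univ s p u :=
  Real.sInf_nonneg fun _ hx => hx.1.le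

theorem InW.norm_le (h : Ctx s P ε₀ p) {u : Euc N → ℝ} {c : ℝ} (hc : 0 < c)
    (hu : InW s P p (fun x => u x / c)) (h1 : Md s P p (fun x => u x / c) ≤ 1) :
    sobNorm Set.univ s p u ≤ c := by
  refine csInf_le ⟨0, fun x hx => hx.1.le⟩ ⟨hc, ?_⟩
  rw [hu.mod h]
  exact ENNReal.ofReal_le_one.2 h1

theorem div_rpow_le {c r t : ℝ} (hc : 1 ≤ c) (hr : 1 ≤ r) : |t / c| ^ r ≤ |t| ^ r / c := by
  have hc0 : 0 < c := by linarith
  rw [abs_div, abs_of_pos hc0, Real.div_rpow (abs_nonneg _) hc0.le]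
  have : c ≤ c ^ r := by
    have := Real.rpow_le_rpow_of_exponent_le hc hr
    rwa [Real.rpow_one] at this
  gcongr

theorem InW.div (h : Ctx s P ε₀ p) {u : Euc N → ℝ} (hu : InW s P p u) {c : ℝ} (hc : 0 < c) :
    InW s P p (fun x => u x / c) := by
  refine ⟨hu.meas.div_const c, ?_, ?_⟩
  · refine (hu.iP.const_mul ((1 / c) ^ P)).congr (Eventually.of_forall fun x => ?_)
    simp only [abs_div, abs_of_pos hc]
    rw [div_eq_mul_one_div |u x|, Real.mul_rpow (abs_nonneg _) (by positivity), mul_comm]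
  · refine (hu.iD.const_mul (max 1 ((1 / c) ^ P))).mono' (h.Dpow (hu.meas.div_const c)).aestronglyMeasurable
      (Eventually.of_forall fun z => ?_)
    rw [Real.norm_eq_abs, abs_of_nonneg (by positivity), ← sub_div, abs_div, abs_of_pos hc,
      div_eq_mul_one_div, Real.mul_rpow (abs_nonneg _) (by positivity), mul_comm]
    gcongr
    rcases le_total (1 / c) 1 with h1 | h1
    · exact (Real.rpow_le_one (by positivity) h1 (by linarith [h.p1 z.1 z.2])).trans (le_max_left _ _)
    · exact (Real.rpow_le_rpow_of_exponent_le h1 (h.pP z.1 z.2)).trans (le_max_right _ _)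

theorem InW.Md_div (h : Ctx s P ε₀ p) {u : Euc N → ℝ} (hu : InW s P p u) {c : ℝ} (hc : 1 ≤ c) :
    Md s P p (fun x => u x / c) ≤ Md s P p u / c := by
  have hd := hu.div h (by linarith : 0 < c)
  unfold Md
  rw [add_div, ← integral_div, ← integral_div]
  refine add_le_add (integral_mono hd.iP (hu.iP.div_const c) fun x => ?_)
    (integral_mono hd.iD (hu.iD.div_const c) fun z => ?_)
  · exact div_rpow_le hc h.P1.le
  · simp only [← sub_div]
    exact div_rpow_le hc (h.p1 _ _).le

theorem InW.sub (h : Ctx s P ε₀ p) {u v : Euc N → ℝ} (hu : InW s P p u) (hv : InW s P p v) :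
    InW s P p (fun x => u x - v x) ∧
    Md s P p (fun x => u x - v x) ≤ 2 ^ P * (Md s P p u + Md s P p v) := by
  have hP := h.P1
  have e1 : ∀ x, |u x - v x| ^ P ≤ 2 ^ P * (|u x| ^ P + |v x| ^ P) := fun x => by
    have := add_rpow_le (by linarith : 0 < P) (le_refl P) (u x) (-v x)
    rwa [abs_neg, ← sub_eq_add_neg] at this
  have e2 : ∀ z : Euc N × Euc N, |(u z.1 - v z.1) - (u z.2 - v z.2)| ^ p z.1 z.2 ≤
      2 ^ P * (|u z.1 - u z.2| ^ p z.1 z.2 + |v z.1 - v z.2| ^ p z.1 z.2) := fun z => by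
    have := add_rpow_le (by linarith [h.p1 z.1 z.2] : 0 < p z.1 z.2) (h.pP z.1 z.2) (u z.1 - u z.2) (-(v z.1 - v z.2))
    rw [abs_neg] at this
    convert this using 3; ring
  have m := hu.meas.sub hv.meas
  have i1 : Integrable (fun x => 2 ^ P * (|u x| ^ P + |v x| ^ P)) := (hu.iP.add hv.iP).const_mul _
  have i2 : Integrable (fun z => 2 ^ P * (|u z.1 - u z.2| ^ p z.1 z.2 + |v z.1 - v z.2| ^ p z.1 z.2)) (kap s p) :=
    (hu.iD.add hv.iD).const_mul _
  have I : InW s P p (fun x => u x - v x) := by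
    refine ⟨m, i1.mono' (m.abs.pow_const P).aestronglyMeasurable (Eventually.of_forall fun x => ?_),
      i2.mono' (h.Dpow m).aestronglyMeasurable (Eventually.of_forall fun z => ?_)⟩
    · rw [Real.norm_eq_abs, abs_of_nonneg (by positivity)]; exact e1 x
    · rw [Real.norm_eq_abs, abs_of_nonneg (by positivity)]; exact e2 z
  refine ⟨I, ?_⟩
  have a1 := integral_mono I.iP i1 e1
  have a2 := integral_mono I.iD i2 e2
  rw [integral_const_mul, integral_add hu.iP hv.iP] at a1
  rw [integral_const_mul, integral_add hu.iD hv.iD] at a2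
  unfold Md
  linarith

theorem sobNorm_tendsto (h : Ctx s P ε₀ p) {w : ℕ → Euc N → ℝ} (hw : ∀ n, InW s P p (w n))
    (h0 : Tendsto (fun n => Md s P p (w n)) atTop (𝓝 0)) :
    Tendsto (fun n => sobNorm Set.univ s p (w n)) atTop (𝓝 0) := by
  rw [Metric.tendsto_atTop]
  intro ε hε
  set c := min (ε / 2) 1 with hc
  have hc0 : 0 < c := by positivity
  have hcP : 0 < c ^ P := by positivity
  obtain ⟨n0, hn0⟩ := eventually_atTop.1 (h0.eventually_lt_const hcP)
  refine ⟨n0, fun n hn => ?_⟩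
  rw [Real.dist_0_eq_abs, abs_of_nonneg (sobNorm_nonneg _)]
  refine lt_of_le_of_lt (InW.norm_le h hc0 ((hw n).div h hc0) ?_) (lt_of_le_of_lt (min_le_left _ _) (by linarith))
  have key : Md s P p (fun x => w n x / c) ≤ Md s P p (w n) / c ^ P := by
    have hd := (hw n).div h hc0
    unfold Md
    rw [add_div, ← integral_div, ← integral_div]
    refine add_le_add (integral_mono hd.iP ((hw n).iP.div_const _) fun x => ?_)
      (integral_mono hd.iD ((hw n).iD.div_const _) fun z => ?_)
    · simp only [abs_div, abs_of_pos hc0]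
      rw [Real.div_rpow (abs_nonneg _) hc0.le]
    · simp only [← sub_div, abs_div, abs_of_pos hc0]
      rw [Real.div_rpow (abs_nonneg _) hc0.le]
      have := Real.rpow_le_rpow_of_exponent_ge hc0 (min_le_right _ _) (h.pP z.1 z.2)
      gcongr
  refine key.trans ?_
  rw [div_le_one hcP]
  exact (hn0 n hn).le

/-- cutoffs -/
structure Cut (s : ℝ) (p : Euc N → Euc N → ℝ) (φ : Euc N → ℝ) : Prop where
  meas : Measurable φ
  nn : ∀ x, 0 ≤ φ x
  le1 : ∀ x, φ x ≤ 1
  good : Good s p (fun z => |φ z.1 - φ z.2| ^ p z.1 z.2)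

theorem D_mul (φ w : Euc N → ℝ) (z : Euc N × Euc N) : φ z.1 * w z.1 - φ z.2 * w z.2 =
    φ z.1 * (w z.1 - w z.2) + w z.2 * (φ z.1 - φ z.2) := by ring

theorem Cut.mul_le (h : Ctx s P ε₀ p) {φ : Euc N → ℝ} (hφ : Cut s p φ) (w : Euc N → ℝ) :
    (∀ x, |φ x * w x| ^ P ≤ |w x| ^ P) ∧
    ∀ z : Euc N × Euc N, |φ z.1 * w z.1 - φ z.2 * w z.2| ^ p z.1 z.2 ≤ 2 ^ P * (|w z.1 - w z.2| ^ p z.1 z.2 +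
      |w z.2| ^ p z.1 z.2 * |φ z.1 - φ z.2| ^ p z.1 z.2) := by
  have hP := h.P1
  constructor
  · intro x
    refine Real.rpow_le_rpow (abs_nonneg _) ?_ (by linarith)
    rw [abs_mul, abs_of_nonneg (hφ.nn x)]
    exact mul_le_of_le_one_left (abs_nonneg _) (hφ.le1 x)
  · intro z
    have hp := h.p1 z.1 z.2
    rw [D_mul]
    refine (add_rpow_le (by linarith) (h.pP z.1 z.2) _ _).trans ?_
    rw [← Real.mul_rpow (abs_nonneg _) (abs_nonneg _), ← abs_mul]
    have e : |φ z.1 * (w z.1 - w z.2)| ≤ |w z.1 - w z.2| := by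
      rw [abs_mul, abs_of_nonneg (hφ.nn _)]
      exact mul_le_of_le_one_left (abs_nonneg _) (hφ.le1 _)
    have := Real.rpow_le_rpow (abs_nonneg _) e (by linarith : 0 ≤ p z.1 z.2)
    gcongr

theorem Cut.inW (h : Ctx s P ε₀ p) {φ : Euc N → ℝ} (hφ : Cut s p φ) {w : Euc N → ℝ} (hw : InW s P p w)
    (hc : Integrable (fun z => |w z.2| ^ p z.1 z.2 * |φ z.1 - φ z.2| ^ p z.1 z.2) (kap s p)) :
    InW s P p (fun x => φ x * w x) ∧ Md s P p (fun x => φ x * w x) ≤ 2 ^ P * (Md s P p w +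
      ∫ z, |w z.2| ^ p z.1 z.2 * |φ z.1 - φ z.2| ^ p z.1 z.2 ∂(kap s p)) := by
  have m := hφ.meas.mul hw.meas
  obtain ⟨e1, e2⟩ := hφ.mul_le h w
  have hP := h.P1
  have i2 : Integrable (fun z => 2 ^ P * (|w z.1 - w z.2| ^ p z.1 z.2 +
      |w z.2| ^ p z.1 z.2 * |φ z.1 - φ z.2| ^ p z.1 z.2)) (kap s p) := (hw.iD.add hc).const_mul _
  have I : InW s P p (fun x => φ x * w x) := by
    refine ⟨m, hw.iP.mono' (m.abs.pow_const P).aestronglyMeasurable (Eventually.of_forall fun x => ?_),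
      i2.mono' (h.Dpow m).aestronglyMeasurable (Eventually.of_forall fun z => ?_)⟩
    · rw [Real.norm_eq_abs, abs_of_nonneg (by positivity)]; exact e1 x
    · rw [Real.norm_eq_abs, abs_of_nonneg (by positivity)]; exact e2 z
  refine ⟨I, ?_⟩
  have a1 := integral_mono I.iP hw.iP e1
  have a2 := integral_mono I.iD i2 e2
  rw [integral_const_mul, integral_add hw.iD hc] at a2
  unfold Md
  have b1 : (1:ℝ) ≤ 2 ^ P := Real.one_le_rpow (by norm_num) (by linarith)
  have b2 : 0 ≤ ∫ x, |w x| ^ P := integral_nonneg fun x => by positivity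
  nlinarith
end

section
variable {N : ℕ} {s P ε₀ : ℝ} {p : Euc N → Euc N → ℝ}

structure FHyp (q : Euc N → ℝ) (f : Euc N → ℝ → ℝ) : Prop where
  fm : ∀ u : Euc N → ℝ, Measurable u → AEStronglyMeasurable (fun x => f x (u x)) volume
  Fm : ∀ u : Euc N → ℝ, Measurable u → AEStronglyMeasurable (fun x => Fint f x (u x)) volume
  grow : ∀ δ > (0:ℝ), ∃ H : Euc N → ℝ, Integrable H ∧ ∀ᵐ x, ∀ t w : ℝ,
    |f x t| * |w| ≤ δ * (|t| ^ q x + |w| ^ q x) + H x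
  Fgrow : ∃ H : Euc N → ℝ, Integrable H ∧ ∀ᵐ x, ∀ t : ℝ, |Fint f x t| ≤ |t| ^ q x + H x
  loc : ∀ᵐ x, ∀ R : ℝ, ∃ B : ℝ, ∀ t : ℝ, |t| ≤ R → |f x t| ≤ B

theorem Fint_cont_meas {f : Euc N → ℝ → ℝ} (hm : ∀ t, Measurable fun x => f x t)
    (hc : ∀ x, Continuous fun t => f x t) {u : Euc N → ℝ} (hu : Measurable u) :
    Measurable (fun x => f x (u x)) ∧ Measurable (fun x => Fint f x (u x)) := by
  have h1 : Measurable (fun z : ℝ × Euc N => f z.2 z.1) :=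
    measurable_uncurry_of_continuous_of_measurable (u := fun t x => f x t) hc hm
  refine ⟨h1.comp (hu.prodMk measurable_id), ?_⟩
  have h2 : ∀ x, Fint f x (u x) = u x * ∫ τ in Ioc (0:ℝ) 1, f x (u x * τ) := fun x => by
    have := intervalIntegral.mul_integral_comp_mul_left (a := 0) (b := 1) (f := fun τ => f x τ) (u x)
    rw [mul_zero, mul_one, intervalIntegral.integral_of_le zero_le_one] at this
    rw [Fint, this]
  simp_rw [h2]
  refine hu.mul ?_
  have h3 : Measurable (fun z : Euc N × ℝ => f z.1 (u z.1 * z.2)) :=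
    h1.comp (((hu.comp measurable_fst).mul measurable_snd).prodMk measurable_fst)
  exact (h3.stronglyMeasurable.integral_prod_right' (ν := volume.restrict (Ioc (0:ℝ) 1))).measurable

theorem FHyp.mk' {q : Euc N → ℝ} (hq : Measurable q) {qM : ℝ} (hqM : ∀ x, q x ≤ qM)
    {f : Euc N → ℝ → ℝ} (hf_meas : ∀ t : ℝ, Measurable fun x => f x t)
    (hf_cont : ∀ᵐ x ∂(volume : Measure (Euc N)), Continuous fun t => f x t)
    (m : ℕ) (r a : Fin m → Euc N → ℝ) (hrc : ∀ j, Continuous (r j))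
    (hr : ∀ j, ∃ rlo rhi : ℝ, 1 < rlo ∧ (∀ x, rlo ≤ r j x) ∧ (∀ x, r j x ≤ rhi))
    (hrq : ∀ j, ∃ δ > (0 : ℝ), ∀ x, r j x + δ ≤ q x)
    (ha : ∀ j, MemVarLp volume (fun x => q x / (q x - r j x)) (a j) ∧
        (∀ᵐ x ∂(volume : Measure (Euc N)), 0 < a j x))
    (hfa : ∀ᵐ x ∂(volume : Measure (Euc N)), ∀ t : ℝ, |f x t| ≤ ∑ j, a j x * |t| ^ (r j x - 1)) :
    FHyp q f := by
  have hja : ∀ᵐ x, ∀ j, 0 < a j x := ae_all_iff.2 fun j => (ha j).2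
  have step : ∀ δ > (0:ℝ), ∀ j, ∃ H : Euc N → ℝ, Integrable H ∧ ∀ᵐ x, ∀ t w : ℝ,
      a j x * |t| ^ (r j x - 1) * |w| ≤ δ * (|t| ^ q x + |w| ^ q x) + H x := by
    intro δ hδ j
    obtain ⟨rlo, rhi, h1, hlo, hhi⟩ := hr j
    obtain ⟨d, hd, hrd⟩ := hrq j
    obtain ⟨C1, hC1, e4⟩ := elemE4 rhi one_pos
    obtain ⟨C2, hC2, e6⟩ := elemE6 qM d hd (div_pos hδ (by linarith : 0 < 1 + C1))
    have hai : Integrable fun x => |a j x| ^ (q x / (q x - r j x)) := by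
      refine ⟨((ha j).1.1.aemeasurable.abs.pow (hq.div (hq.sub (hrc j).measurable)).aemeasurable).aestronglyMeasurable, ?_⟩
      rw [hasFiniteIntegral_iff_ofReal (Eventually.of_forall fun x => by positivity)]
      exact (ha j).1.2
    refine ⟨fun x => (1 + C1) * C2 * |a j x| ^ (q x / (q x - r j x)), hai.const_mul _, ?_⟩
    filter_upwards [hja] with x hx t w
    have h0 := (hx j).le
    have a1 := e4 (r j x) t w (by linarith [hlo x]) (hhi x)
    have a2 := e6 (a j x) |t| (r j x) (q x) h0 (abs_nonneg _) (by linarith [hlo x]) (hrd x) (hqM x)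
    have a3 := e6 (a j x) |w| (r j x) (q x) h0 (abs_nonneg _) (by linarith [hlo x]) (hrd x) (hqM x)
    rw [abs_of_nonneg h0]
    set A := a j x ^ (q x / (q x - r j x))
    have hA : 0 ≤ A := by positivity
    have a4 : a j x * |t| ^ (r j x - 1) * |w| ≤ a j x * |t| ^ r j x + C1 * (a j x * |w| ^ r j x) := by
      have := mul_le_mul_of_nonneg_left a1 h0
      linarith
    have b1 : δ / (1 + C1) ≤ δ := div_le_self hδ.le (by linarith)
    have b2 : C1 * (δ / (1 + C1)) ≤ δ := by
      rw [mul_div_assoc', div_le_iff₀ (by linarith)]; nlinarith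
    have t0 : 0 ≤ |t| ^ q x := by positivity
    have w0 : 0 ≤ |w| ^ q x := by positivity
    have := mul_le_mul_of_nonneg_left a3 hC1
    have := mul_le_mul_of_nonneg_right b1 t0
    have := mul_le_mul_of_nonneg_right b2 w0
    linarith
  have sum : ∀ δ > (0:ℝ), ∃ H : Euc N → ℝ, Integrable H ∧ ∀ᵐ x, ∀ t w : ℝ,
      (∑ j, a j x * |t| ^ (r j x - 1)) * |w| ≤ δ * (|t| ^ q x + |w| ^ q x) + H x := by
    intro δ hδ
    choose H hHi hH using step (δ / (m + 1)) (by positivity)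
    refine ⟨fun x => ∑ j, H j x, integrable_finsetSum _ fun j _ => hHi j, ?_⟩
    filter_upwards [ae_all_iff.2 hH] with x hx t w
    rw [Finset.sum_mul]
    have h1 := Finset.sum_le_sum fun j (_ : j ∈ Finset.univ) => hx j t w
    refine h1.trans ?_
    rw [Finset.sum_add_distrib, Finset.sum_const, Finset.card_univ, Fintype.card_fin, nsmul_eq_mul]
    have : (m:ℝ) * (δ / (m + 1)) ≤ δ := by
      rw [mul_div_assoc', div_le_iff₀ (by positivity)]; nlinarith
    have t0 : 0 ≤ |t| ^ q x + |w| ^ q x := by positivity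
    nlinarith
  obtain ⟨S, hSsub, hSm, hS0⟩ := exists_measurable_superset_of_null (ae_iff.1 hf_cont)
  classical
  set f' : Euc N → ℝ → ℝ := fun x t => Sᶜ.indicator (fun x => f x t) x with hf'
  have f'm : ∀ t, Measurable fun x => f' x t := fun t => (hf_meas t).indicator hSm.compl
  have f'c : ∀ x, Continuous fun t => f' x t := fun x => by
    by_cases hx : x ∈ S
    · have : (fun t => f' x t) = fun _ => 0 := by ext t; simp [hf', hx]
      rw [this]; exact continuous_const
    · have : (fun t => f' x t) = fun t => f x t := by ext t; simp [hf', hx]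
      rw [this]
      by_contra hcon
      exact hx (hSsub hcon)
  have hae : ∀ᵐ x, f' x = f x := by
    filter_upwards [compl_mem_ae_iff.2 hS0] with x hx
    ext t; simp only [hf']; rw [indicator_of_mem hx]
  refine ⟨fun u hu => ?_, fun u hu => ?_, fun δ hδ => ?_, ?_, ?_⟩
  · refine (Fint_cont_meas f'm f'c hu).1.aestronglyMeasurable.congr ?_
    filter_upwards [hae] with x hx; rw [hx]
  · refine (Fint_cont_meas f'm f'c hu).2.aestronglyMeasurable.congr ?_
    filter_upwards [hae] with x hx; rw [Fint, Fint, hx]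
  · obtain ⟨H, hHi, hH⟩ := sum δ hδ
    refine ⟨H, hHi, ?_⟩
    filter_upwards [hH, hfa] with x hx hfx t w
    exact (mul_le_mul_of_nonneg_right (hfx t) (abs_nonneg _)).trans (hx t w)
  · obtain ⟨H, hHi, hH⟩ := sum (1 / 2) (by norm_num)
    refine ⟨H, hHi, ?_⟩
    filter_upwards [hH, hfa, hja] with x hx hfx hjx t
    have hr1 : ∀ j, 1 < r j x := fun j => by
      obtain ⟨rlo, rhi, h1, hlo, hhi⟩ := hr j
      linarith [hlo x]
    have h1 : ‖∫ τ in (0:ℝ)..t, f x τ‖ ≤ (∑ j, a j x * |t| ^ (r j x - 1)) * |t - 0| := by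
      refine intervalIntegral.norm_integral_le_of_norm_le_const fun τ hτ => ?_
      have : |τ| ≤ |t| := by
        rw [mem_uIoc] at hτ
        rcases hτ with h | h
        · rw [abs_of_pos h.1, abs_of_nonneg (by linarith)]; exact h.2
        · rw [abs_of_nonpos h.2, abs_of_nonpos (by linarith)]; linarith
      refine (hfx τ).trans (Finset.sum_le_sum fun j _ => ?_)
      have := Real.rpow_le_rpow (abs_nonneg τ) this (by linarith [hr1 j] : 0 ≤ r j x - 1)
      exact mul_le_mul_of_nonneg_left this (hjx j).le
    rw [sub_zero] at h1
    have := hx t t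
    rw [Fint, ← Real.norm_eq_abs]
    linarith
  · filter_upwards [hfa, hja] with x hfx hjx R
    refine ⟨∑ j, a j x * (max R 0) ^ (r j x - 1), fun t ht => (hfx t).trans (Finset.sum_le_sum fun j _ => ?_)⟩
    obtain ⟨rlo, rhi, h1, hlo, hhi⟩ := hr j
    have := Real.rpow_le_rpow (abs_nonneg t) (ht.trans (le_max_left R 0)) (by linarith [hlo x] : 0 ≤ r j x - 1)
    exact mul_le_mul_of_nonneg_left this (hjx j).le
end

section
variable {N : ℕ} {s P ε₀ : ℝ} {p : Euc N → Euc N → ℝ}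

structure QCtx (s P ε₀ : ℝ) (p : Euc N → Euc N → ℝ) (q : Euc N → ℝ) (qm qM : ℝ)
    (f : Euc N → ℝ → ℝ) : Prop where
  h : Ctx s P ε₀ p
  qc : Continuous q
  Pqm : P < qm
  qlo : ∀ x, qm ≤ q x
  qhi : ∀ x, q x ≤ qM
  qS : qM ≤ N * P / (N - s * P)
  F : FHyp q f

variable {q : Euc N → ℝ} {qm qM : ℝ} {f : Euc N → ℝ → ℝ}

theorem psi_int {Ω : Type*} [MeasurableSpace Ω] {μ : Measure Ω} {r : Ω → ℝ} {R : ℝ} (hr : Measurable r)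
    (hr1 : ∀ x, 1 < r x) (hrR : ∀ x, r x ≤ R) {a b : Ω → ℝ} (ha : Measurable a) (hb : Measurable b)
    (hai : Integrable (fun x => |a x| ^ r x) μ) (hbi : Integrable (fun x => |b x| ^ r x) μ) :
    Integrable (fun x => psi (r x) (a x) * b x) μ := by
  obtain ⟨C, hC, h⟩ := elemE4 R (δ := 1) one_pos
  refine ((hai.const_mul 1).add (hbi.const_mul C)).mono' ?_ (Eventually.of_forall fun x => ?_)
  · unfold psi
    exact (((ha.abs.pow (hr.sub_const 2)).mul ha).mul hb).aestronglyMeasurable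
  · rw [Real.norm_eq_abs, abs_mul, psi_abs (hr1 x)]
    exact h _ _ _ (hr1 x) (hrR x)

theorem QCtx.iq (H : QCtx s P ε₀ p q qm qM f) {u : Euc N → ℝ} (hu : InW s P p u) :
    Integrable fun x => |u x| ^ q x :=
  H.h.sobolev_q hu.meas hu.iP hu.iD H.qc.measurable (fun x => H.Pqm.le.trans (H.qlo x))
    fun x => (H.qhi x).trans H.qS

theorem QCtx.q1 (H : QCtx s P ε₀ p q qm qM f) (x) : 1 < q x :=
  H.h.P1.trans (H.Pqm.trans_le (H.qlo x))

theorem QCtx.fint (H : QCtx s P ε₀ p q qm qM f) {u v : Euc N → ℝ} (hu : InW s P p u)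
    (hv : InW s P p v) : Integrable fun x => f x (u x) * v x := by
  obtain ⟨G, hG, hg⟩ := H.F.grow 1 one_pos
  refine ((((H.iq hu).add (H.iq hv)).const_mul 1).add hG).mono'
    ((H.F.fm u hu.meas).mul hv.meas.aestronglyMeasurable) ?_
  filter_upwards [hg] with x hx
  rw [Real.norm_eq_abs, abs_mul]
  exact hx _ _

theorem QCtx.Fi (H : QCtx s P ε₀ p q qm qM f) {u : Euc N → ℝ} (hu : InW s P p u) :
    Integrable fun x => Fint f x (u x) := by
  obtain ⟨G, hG, hg⟩ := H.F.Fgrow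
  refine ((H.iq hu).add hG).mono' (H.F.Fm u hu.meas) ?_
  filter_upwards [hg] with x hx
  exact hx _

theorem QCtx.Jderiv_eq (H : QCtx s P ε₀ p q qm qM f) {u v : Euc N → ℝ} (hu : InW s P p u)
    (hv : InW s P p v) (lam : ℝ) : Jderiv s p P q f lam u v =
    (∫ z, psi (p z.1 z.2) (u z.1 - u z.2) * (v z.1 - v z.2) ∂(kap s p)) +
      (∫ x, psi P (u x) * v x) - (∫ x, f x (u x) * v x) - lam * ∫ x, psi (q x) (u x) * v x := by
  rw [H.h.integral_kap (psi_int H.h.pc.measurable (fun z => H.h.p1 z.1 z.2) (fun z => H.h.pP z.1 z.2)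
    (Dmeas hu.meas) (Dmeas hv.meas) hu.iD hv.iD)]
  simp only [Jderiv, psi, kern, mul_one_div]

theorem QCtx.iDp (H : QCtx s P ε₀ p q qm qM f) {u : Euc N → ℝ} (hu : InW s P p u) :
    Integrable (fun z => |u z.1 - u z.2| ^ p z.1 z.2 / p z.1 z.2) (kap s p) := by
  refine hu.iD.mono' ((H.h.Dpow hu.meas).div H.h.pc.measurable).aestronglyMeasurable
    (Eventually.of_forall fun z => ?_)
  have := H.h.p1 z.1 z.2
  rw [Real.norm_eq_abs, abs_of_nonneg (by positivity)]
  exact div_le_self (by positivity) this.le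

theorem QCtx.iqq (H : QCtx s P ε₀ p q qm qM f) {u : Euc N → ℝ} (hu : InW s P p u) :
    Integrable (fun x => |u x| ^ q x / q x) := by
  refine (H.iq hu).mono' ((hu.meas.abs.pow H.qc.measurable).div H.qc.measurable).aestronglyMeasurable
    (Eventually.of_forall fun z => ?_)
  have := H.q1 z
  rw [Real.norm_eq_abs, abs_of_nonneg (by positivity)]
  exact div_le_self (by positivity) this.le

theorem QCtx.Jfun_eq (H : QCtx s P ε₀ p q qm qM f) {u : Euc N → ℝ} (hu : InW s P p u) (lam : ℝ) :
    Jfun s p P q f lam u =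
    (∫ z, |u z.1 - u z.2| ^ p z.1 z.2 / p z.1 z.2 ∂(kap s p)) +
      (∫ x, |u x| ^ P / P) - (∫ x, Fint f x (u x)) - lam * ∫ x, |u x| ^ q x / q x := by
  rw [H.h.integral_kap (H.iDp hu)]
  simp only [Jfun, kern, div_mul_div_comm, mul_one]

theorem Jderiv_div {lam : ℝ} (u v : Euc N → ℝ) (c : ℝ) :
    Jderiv s p P q f lam u (fun x => v x / c) = Jderiv s p P q f lam u v / c := by
  simp only [Jderiv, ← sub_div, mul_div_assoc', div_right_comm _ c, integral_div]
  ring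

theorem QCtx.dual (H : QCtx s P ε₀ p q qm qM f) {u : Euc N → ℝ} {lam ε : ℝ}
    (h1 : ∀ v : Euc N → ℝ, MemSob Set.univ s p v →
          sobNorm Set.univ s p v ≤ 1 → |Jderiv s p P q f lam u v| ≤ ε) {v : Euc N → ℝ}
    (hv : InW s P p v) : |Jderiv s p P q f lam u v| ≤ ε * (1 + Md s P p v) := by
  set c := 1 + Md s P p v with hc
  have hc1 : 1 ≤ c := by linarith [Md_nonneg (s := s) (P := P) (p := p) v]
  have hc0 : 0 < c := by linarith
  have i1 := hv.div H.h hc0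
  have m1 : Md s P p (fun x => v x / c) ≤ 1 := (hv.Md_div H.h hc1).trans (by
    rw [div_le_one hc0]; linarith)
  have n1 : sobNorm Set.univ s p (fun x => v x / c) ≤ 1 := by
    apply InW.norm_le H.h one_pos <;> simpa using ‹_›
  have := h1 _ (i1.memSob H.h) n1
  rwa [Jderiv_div, abs_div, abs_of_pos hc0, div_le_iff₀ hc0] at this

theorem QCtx.est (H : QCtx s P ε₀ p q qm qM f) {u : Euc N → ℝ} (hu : InW s P p u) {lam α : ℝ}
    (hlam : 0 < lam) {g : Euc N → ℝ} (hα : P ≤ α) (hαq : α < qm) (hg : Integrable g)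
    (hF4 : ∀ᵐ x ∂(volume : Measure (Euc N)), ∀ t : ℝ, α * Fint f x t - f x t * t ≤ g x) :
    lam * (1 / α - 1 / qm) * ∫ x, |u x| ^ q x ≤ Jfun s p P q f lam u
      - Jderiv s p P q f lam u u / α + (∫ x, |g x|) / α := by
  have hP := H.h.P1
  have hα0 : 0 < α := by linarith
  rw [H.Jfun_eq hu, H.Jderiv_eq hu hu]
  have e1 : (∫ z, psi (p z.1 z.2) (u z.1 - u z.2) * (u z.1 - u z.2) ∂(kap s p)) / α ≤
      ∫ z, |u z.1 - u z.2| ^ p z.1 z.2 / p z.1 z.2 ∂(kap s p) := by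
    rw [← integral_div]
    simp only [psi_mul (H.h.p1 _ _)]
    refine integral_mono (hu.iD.div_const α) (H.iDp hu) fun z => ?_
    have := H.h.p1 z.1 z.2
    have := H.h.pP z.1 z.2
    dsimp only
    gcongr
    linarith
  have e2 : (∫ x, psi P (u x) * u x) / α ≤ ∫ x, |u x| ^ P / P := by
    rw [← integral_div]
    simp only [psi_mul hP]
    refine integral_mono (hu.iP.div_const α) (hu.iP.div_const P) fun z => ?_
    dsimp only
    gcongr
  have e3 : (∫ x, Fint f x (u x)) - (∫ x, f x (u x) * u x) / α ≤ (∫ x, |g x|) / α := by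
    rw [← integral_div, ← integral_sub (H.Fi hu) ((H.fint hu hu).div_const α), ← integral_div]
    refine integral_mono_ae ((H.Fi hu).sub ((H.fint hu hu).div_const α)) (hg.abs.div_const α) ?_
    filter_upwards [hF4] with x hx
    have := hx (u x)
    have h2 := le_abs_self (g x)
    rw [le_div_iff₀ hα0]
    rw [sub_mul, div_mul_cancel₀ _ hα0.ne']
    linarith
  have e4 : (∫ x, |u x| ^ q x / q x) ≤ (∫ x, psi (q x) (u x) * u x) / α - (1 / α - 1 / qm) * ∫ x, |u x| ^ q x := by
    simp only [psi_mul (H.q1 _)]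
    have : (∫ x, |u x| ^ q x / q x) ≤ (∫ x, |u x| ^ q x) / qm := by
      rw [← integral_div]
      refine integral_mono (H.iqq hu) ((H.iq hu).div_const _) fun x => ?_
      have := H.qlo x
      dsimp only
      gcongr
      linarith
    refine this.trans (le_of_eq ?_)
    ring
  have e5 := mul_le_mul_of_nonneg_left e4 hlam.le
  have : ∀ a b c d e : ℝ, (a + b - c - d) / e = a / e + b / e - c / e - d / e := fun a b c d e => by ring
  rw [this]
  have e6 : lam * (∫ x, psi (q x) (u x) * u x) / α = lam * ((∫ x, psi (q x) (u x) * u x) / α) := by ring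
  rw [e6]
  linarith

theorem QCtx.est2 (H : QCtx s P ε₀ p q qm qM f) : ∃ C : ℝ, 0 ≤ C ∧ ∀ (u : Euc N → ℝ) (lam : ℝ), InW s P p u →
    0 < lam → Md s P p u ≤ P * (Jfun s p P q f lam u + C + (1 + lam) * ∫ x, |u x| ^ q x) := by
  obtain ⟨G, hG, hg⟩ := H.F.Fgrow
  refine ⟨∫ x, |G x|, integral_nonneg fun x => abs_nonneg _, fun u lam hu hlam => ?_⟩
  have hP := H.h.P1
  rw [H.Jfun_eq hu]
  have e1 : (∫ z, |u z.1 - u z.2| ^ p z.1 z.2 ∂(kap s p)) / P ≤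
      ∫ z, |u z.1 - u z.2| ^ p z.1 z.2 / p z.1 z.2 ∂(kap s p) := by
    rw [← integral_div]
    refine integral_mono (hu.iD.div_const P) (H.iDp hu) fun z => ?_
    have := H.h.p1 z.1 z.2
    have := H.h.pP z.1 z.2
    dsimp only
    gcongr
  have e3 : (∫ x, Fint f x (u x)) ≤ (∫ x, |u x| ^ q x) + ∫ x, |G x| := by
    rw [← integral_add (H.iq hu) hG.abs]
    refine integral_mono_ae (H.Fi hu) ((H.iq hu).add hG.abs) ?_
    filter_upwards [hg] with x hx
    have := hx (u x)
    have h2 := le_abs_self (G x)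
    have h3 := le_abs_self (Fint f x (u x))
    linarith
  have e4 : (∫ x, |u x| ^ q x / q x) ≤ ∫ x, |u x| ^ q x := by
    refine integral_mono (H.iqq hu) (H.iq hu) fun x => ?_
    have := H.q1 x
    exact div_le_self (by positivity) this.le
  have e5 := mul_le_mul_of_nonneg_left e4 hlam.le
  rw [integral_div P, Md, ← div_le_iff₀' (by linarith), add_div]
  linarith

theorem QCtx.bdd (H : QCtx s P ε₀ p q qm qM f) {lam α c : ℝ} {u : ℕ → Euc N → ℝ}
    (hlam : 0 < lam) {g : Euc N → ℝ} (hα : P ≤ α) (hαq : α < qm) (hg : Integrable g)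
    (hF4 : ∀ᵐ x ∂(volume : Measure (Euc N)), ∀ t : ℝ, α * Fint f x t - f x t * t ≤ g x)
    (hu : ∀ n, InW s P p (u n)) (hJ : Tendsto (fun n => Jfun s p P q f lam (u n)) atTop (𝓝 c))
    (hd : ∀ ε > (0 : ℝ), ∃ n₀ : ℕ, ∀ n ≥ n₀, ∀ v : Euc N → ℝ, MemSob Set.univ s p v →
          sobNorm Set.univ s p v ≤ 1 → |Jderiv s p P q f lam (u n) v| ≤ ε) :
    (∃ C : ℝ, ∀ n, Md s P p (u n) ≤ C ∧ ∫ x, |u n x| ^ q x ≤ C) ∧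
    ∀ ε > (0:ℝ), ∀ᶠ n in atTop, lam * (1 / α - 1 / qm) * ∫ x, |u n x| ^ q x ≤ c + (∫ x, |g x|) / α + ε := by
  have hP := H.h.P1
  have hα0 : 0 < α := by linarith
  have hβ : 0 < 1 / α - 1 / qm := sub_pos.2 (one_div_lt_one_div_of_lt hα0 hαq)
  set β := lam * (1 / α - 1 / qm) with hβd
  have hβ0 : 0 < β := by positivity
  have hd' : ∀ ε > (0:ℝ), ∀ᶠ n in atTop, ∀ v, InW s P p v → |Jderiv s p P q f lam (u n) v| ≤ ε * (1 + Md s P p v) := by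
    intro ε hε
    obtain ⟨n0, h0⟩ := hd ε hε
    exact eventually_atTop.2 ⟨n0, fun n hn v hv => H.dual (h0 n hn) hv⟩
  set K := (∫ x, |g x|) / α with hK
  have star : ∀ ε > (0:ℝ), ∀ᶠ n in atTop, β * ∫ x, |u n x| ^ q x ≤ Jfun s p P q f lam (u n) + K + ε * (1 + Md s P p (u n)) := by
    intro ε hε
    filter_upwards [hd' ε hε] with n hn
    have h1 := H.est (hu n) hlam hα hαq hg hF4
    have h2 := hn _ (hu n)
    have h3 : -(Jderiv s p P q f lam (u n) (u n) / α) ≤ ε * (1 + Md s P p (u n)) := by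
      rw [← neg_div]
      refine le_trans (div_le_div_of_nonneg_right (neg_le_abs _) hα0.le) ?_
      exact (div_le_self (abs_nonneg _) (by linarith)).trans h2
    linarith
  obtain ⟨C0, hC0, he⟩ := H.est2
  have hJb : ∀ᶠ n in atTop, Jfun s p P q f lam (u n) ≤ c + 1 := hJ.eventually_le_const (by linarith)
  have hM : ∃ C1 : ℝ, ∀ᶠ n in atTop, Md s P p (u n) ≤ C1 := by
    set D := P * (1 + lam) / β with hD
    have hD0 : 0 < D := by positivity
    refine ⟨2 * (P * (c + 1 + C0) + D * (c + 1 + K + 1 / (2 * D))), ?_⟩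
    filter_upwards [hJb, star (1 / (2 * D)) (by positivity)] with n h1 h2
    have h3 := he (u n) lam (hu n) hlam
    have h4 : P * (1 + lam) * ∫ x, |u n x| ^ q x ≤ D * (c + 1 + K + 1 / (2 * D) * (1 + Md s P p (u n))) := by
      have : P * (1 + lam) * ∫ x, |u n x| ^ q x = D * (β * ∫ x, |u n x| ^ q x) := by
        rw [hD]; field_simp
      rw [this]
      gcongr
      linarith
    have h5 : D * (1 / (2 * D)) = 1 / 2 := by field_simp
    have h6 : P * Jfun s p P q f lam (u n) ≤ P * (c + 1) := by gcongr
    have h7 : D * (c + 1 + K + 1 / (2 * D) * (1 + Md s P p (u n))) = D * (c + 1 + K + 1 / (2 * D)) + (D * (1 / (2 * D))) * Md s P p (u n) := by ring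
    rw [h7, h5] at h4
    nlinarith
  obtain ⟨C1, hC1⟩ := hM
  have tr : ∀ (a : ℕ → ℝ) (C : ℝ), (∀ᶠ n in atTop, a n ≤ C) → ∃ C', ∀ n, a n ≤ C' := by
    intro a C hC
    obtain ⟨b, hb⟩ := (IsBoundedUnder.bddAbove_range (f := a) ⟨C, by simpa using hC⟩)
    exact ⟨b, fun n => hb ⟨n, rfl⟩⟩
  have star2 : ∀ ε > (0:ℝ), ∀ᶠ n in atTop, β * ∫ x, |u n x| ^ q x ≤ c + K + ε := by
    intro ε hε
    have hA : 0 < 1 + |C1| := by positivity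
    filter_upwards [star (ε / 2 / (1 + |C1|)) (by positivity), hC1,
      hJ.eventually_le_const (show c < c + ε / 2 by linarith)] with n h1 h2 h3
    have : ε / 2 / (1 + |C1|) * (1 + Md s P p (u n)) ≤ ε / 2 := by
      rw [div_mul_eq_mul_div, div_le_iff₀ hA]
      gcongr
      exact h2.trans (le_abs_self _)
    linarith
  refine ⟨?_, star2⟩
  obtain ⟨A, hA⟩ := tr _ _ hC1
  obtain ⟨B, hB⟩ := tr (fun n => ∫ x, |u n x| ^ q x) ((c + K + 1) / β) (by
    filter_upwards [star2 1 one_pos] with n hn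
    rwa [le_div_iff₀' hβ0])
  exact ⟨max A B, fun n => ⟨(hA n).trans (le_max_left _ _), (hB n).trans (le_max_right _ _)⟩⟩
end

section
variable {N : ℕ} {s P ε₀ : ℝ} {p : Euc N → Euc N → ℝ}
variable {q : Euc N → ℝ} {qm qM : ℝ} {f : Euc N → ℝ → ℝ}

structure WSeq (s P : ℝ) (p : Euc N → Euc N → ℝ) (q : Euc N → ℝ) (C : ℝ) (w : ℕ → Euc N → ℝ) : Prop where
  W : ∀ n, InW s P p (w n)
  mC : ∀ n, Md s P p (w n) ≤ C
  qC : ∀ n, ∫ x, |w n x| ^ q x ≤ C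
  ae : ∀ᵐ x, Tendsto (fun n => w n x) atTop (𝓝 0)

theorem iP_le_Md (u : Euc N → ℝ) : ∫ x, |u x| ^ P ≤ Md s P p u :=
  le_add_of_nonneg_right (integral_nonneg fun x => by positivity)

theorem iD_le_Md (u : Euc N → ℝ) : ∫ z, |u z.1 - u z.2| ^ p z.1 z.2 ∂(kap s p) ≤ Md s P p u :=
  le_add_of_nonneg_left (integral_nonneg fun x => by positivity)

theorem QCtx.limit (H : QCtx s P ε₀ p q qm qM f) {u : ℕ → Euc N → ℝ} (hu : ∀ n, InW s P p (u n)) {C : ℝ}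
    (hC : ∀ n, Md s P p (u n) ≤ C ∧ ∫ x, |u n x| ^ q x ≤ C) :
    ∃ φ : ℕ → ℕ, StrictMono φ ∧ ∃ v : Euc N → ℝ, InW s P p v ∧
      ∃ C', WSeq s P p q C' (fun n x => u (φ n) x - v x) := by
  have hP := H.h.P1
  obtain ⟨φ, hφ, v, hv, hl⟩ := H.h.compact (fun n => (hu n).meas) (fun n => (hu n).iP) (fun n => (hu n).iD)
    (fun n => (iP_le_Md _).trans (hC n).1) (fun n => (iD_le_Md _).trans (hC n).1)
  have i1 := fatou_real (μ := volume) (F := fun n x => |u (φ n) x| ^ P) (G := fun x => |v x| ^ P)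
    (fun n => (hu _).meas.abs.pow_const P) (hv.abs.pow_const P) (fun n x => by positivity) (fun x => by positivity)
    (fun n => (hu _).iP) (fun n => (iP_le_Md _).trans (hC (φ n)).1) (by
      filter_upwards [hl] with x hx
      exact hx.abs.rpow_const (Or.inr (by linarith)))
  have i2 := fatou_real (μ := kap s p) (F := fun n z => |u (φ n) z.1 - u (φ n) z.2| ^ p z.1 z.2)
    (G := fun z => |v z.1 - v z.2| ^ p z.1 z.2)
    (fun n => H.h.Dpow (hu _).meas) (H.h.Dpow hv) (fun n x => by positivity) (fun x => by positivity)
    (fun n => (hu _).iD) (fun n => (iD_le_Md _).trans (hC (φ n)).1) (by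
      filter_upwards [ae_kap_fst hl, ae_kap_snd hl] with z h1 h2
      exact (h1.sub h2).abs.rpow_const (Or.inr (by linarith [H.h.p1 z.1 z.2])))
  have hV : InW s P p v := ⟨hv, i1.1, i2.1⟩
  refine ⟨φ, hφ, v, hV, ?_⟩
  refine ⟨max (2 ^ P * (C + Md s P p v)) (2 ^ qM * (C + ∫ x, |v x| ^ q x)), fun n => ((hu _).sub H.h hV).1,
    fun n => ?_, fun n => ?_, ?_⟩
  · refine le_trans (((hu _).sub H.h hV).2.trans ?_) (le_max_left _ _)
    have := (hC (φ n)).1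
    gcongr
  · refine le_trans ?_ (le_max_right _ _)
    calc ∫ x, |u (φ n) x - v x| ^ q x ≤ ∫ x, 2 ^ qM * (|u (φ n) x| ^ q x + |v x| ^ q x) := by
          refine integral_mono (H.iq ((hu _).sub H.h hV).1) (((H.iq (hu _)).add (H.iq hV)).const_mul _) fun x => ?_
          have := add_rpow_le (by linarith [H.q1 x] : 0 < q x) (H.qhi x) (u (φ n) x) (-v x)
          rwa [abs_neg, ← sub_eq_add_neg] at this
      _ = 2 ^ qM * ((∫ x, |u (φ n) x| ^ q x) + ∫ x, |v x| ^ q x) := by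
          rw [integral_const_mul, integral_add (H.iq (hu _)) (H.iq hV)]
      _ ≤ _ := by
          have := (hC (φ n)).2
          gcongr
  · filter_upwards [hl] with x hx
    simpa using hx.sub_const (v x)

def Lam (s P : ℝ) (p : Euc N → Euc N → ℝ) (q : Euc N → ℝ) (lam : ℝ) (φ w : Euc N → ℝ) : ℝ :=
  (∫ z, φ z.1 * |w z.1 - w z.2| ^ p z.1 z.2 ∂(kap s p)) + (∫ x, φ x * |w x| ^ P)
    - lam * ∫ x, φ x * |w x| ^ q x

theorem tendsto_zero_of_le {a : ℕ → ℝ} (C : ℝ) (h : ∀ δ > (0:ℝ), ∀ᶠ n in atTop, |a n| ≤ δ * C + δ) :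
    Tendsto a atTop (𝓝 0) := by
  rw [Metric.tendsto_atTop]
  intro ε hε
  have h0 : 0 < |C| + 2 := by positivity
  obtain ⟨n, hn⟩ := eventually_atTop.1 (h (ε / (|C| + 2)) (by positivity))
  refine ⟨n, fun m hm => ?_⟩
  rw [Real.dist_0_eq_abs]
  refine (hn m hm).trans_lt ?_
  have h1 : ε / (|C| + 2) * C + ε / (|C| + 2) = ε * (C + 1) / (|C| + 2) := by ring
  rw [h1, div_lt_iff₀ h0]
  have := le_abs_self C
  exact mul_lt_mul_of_pos_left (by linarith) hε

theorem QCtx.Lam_lim (H : QCtx s P ε₀ p q qm qM f) {w : ℕ → Euc N → ℝ} {C : ℝ} (hw : WSeq s P p q C w)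
    {U : Euc N → ℝ} (hU : InW s P p U) {lam : ℝ}
    (hu : ∀ n, InW s P p (fun x => w n x + U x)) {C' : ℝ} (hC' : ∀ n, Md s P p (fun x => w n x + U x) ≤ C')
    (huq : ∀ n, ∫ x, |w n x + U x| ^ q x ≤ C')
    (hd : ∀ ε > (0:ℝ), ∀ᶠ n in atTop, ∀ v, InW s P p v →
      |Jderiv s p P q f lam (fun x => w n x + U x) v| ≤ ε * (1 + Md s P p v))
    {φ : Euc N → ℝ} (hφ : Cut s p φ) : Tendsto (fun n => Lam s P p q lam φ (w n)) atTop (𝓝 0) := by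
  have hP := H.h.P1
  obtain ⟨ci, c0⟩ := (H.h.comm H.qc.measurable H.Pqm H.qlo H.qhi hφ.good (fun n => (hw.W n).meas)
    (fun n => H.iq (hw.W n)) C hw.qC hw.ae).2
  have hv : ∀ n, InW s P p (fun x => φ x * w n x) := fun n => (hφ.inW H.h (hw.W n) (ci n)).1
  have t1 : Tendsto (fun n => Jderiv s p P q f lam (fun x => w n x + U x) (fun x => φ x * w n x)) atTop (𝓝 0) := by
    refine tendsto_zero_of_le (2 ^ P * (C + 1)) fun δ hδ => ?_
    filter_upwards [hd δ hδ, c0.eventually_le_const one_pos] with n h1 h2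
    refine (h1 _ (hv n)).trans ?_
    have h3 := (hφ.inW H.h (hw.W n) (ci n)).2
    have h4 : Md s P p (fun x => φ x * w n x) ≤ 2 ^ P * (C + 1) := by
      refine h3.trans ?_
      have := hw.mC n
      gcongr
    nlinarith
  obtain ⟨g1, g2, g3⟩ := G1 (μ := kap s p) H.h.pc.measurable (fun z => H.h.p1 z.1 z.2) (fun z => H.h.pP z.1 z.2)
    (hφ.meas.comp measurable_fst) (fun z => hφ.nn z.1) (fun z => hφ.le1 z.1) (Dmeas hU.meas) hU.iD
    (fun n => Dmeas (hw.W n).meas) (fun n => (hw.W n).iD) C (fun n => (iD_le_Md _).trans (hw.mC n)) (by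
      filter_upwards [ae_kap_fst hw.ae, ae_kap_snd hw.ae] with z h1 h2
      simpa using h1.sub h2)
  simp only [Function.comp] at g1 g2 g3
  obtain ⟨k1, k2, k3⟩ := G1 (μ := volume) (r := fun _ => P) measurable_const (fun z => hP) (fun z => le_refl P)
    hφ.meas hφ.nn hφ.le1 hU.meas hU.iP
    (fun n => (hw.W n).meas) (fun n => (hw.W n).iP) C (fun n => (iP_le_Md _).trans (hw.mC n)) hw.ae
  obtain ⟨l1, l2, l3⟩ := G1 (μ := volume) H.qc.measurable H.q1 H.qhi
    hφ.meas hφ.nn hφ.le1 hU.meas (H.iq hU)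
    (fun n => (hw.W n).meas) (fun n => H.iq (hw.W n)) C hw.qC hw.ae
  have bi : ∀ n, Integrable (fun z => |w n z.2 * (φ z.1 - φ z.2)| ^ p z.1 z.2) (kap s p) := fun n => by
    refine (ci n).congr (Eventually.of_forall fun z => ?_)
    dsimp only
    rw [abs_mul, Real.mul_rpow (abs_nonneg _) (abs_nonneg _)]
  have bm : ∀ n, Measurable (fun z : Euc N × Euc N => w n z.2 * (φ z.1 - φ z.2)) := fun n =>
    ((hw.W n).meas.comp measurable_snd).mul (Dmeas hφ.meas)
  have ri : ∀ n, Integrable (fun z => psi (p z.1 z.2) ((w n z.1 + U z.1) - (w n z.2 + U z.2)) * (w n z.2 * (φ z.1 - φ z.2))) (kap s p) :=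
    fun n => psi_int H.h.pc.measurable (fun z => H.h.p1 z.1 z.2) (fun z => H.h.pP z.1 z.2)
      (Dmeas (hu n).meas) (bm n) (hu n).iD (bi n)
  have t2 : Tendsto (fun n => ∫ z, psi (p z.1 z.2) ((w n z.1 + U z.1) - (w n z.2 + U z.2)) * (w n z.2 * (φ z.1 - φ z.2)) ∂(kap s p)) atTop (𝓝 0) := by
    refine tendsto_zero_of_le C' fun δ hδ => ?_
    obtain ⟨K, hK, he⟩ := elemE4 P hδ
    have : Tendsto (fun n => K * ∫ z, |w n z.2| ^ p z.1 z.2 * |φ z.1 - φ z.2| ^ p z.1 z.2 ∂(kap s p)) atTop (𝓝 0) := by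
      simpa using c0.const_mul K
    filter_upwards [this.eventually_le_const hδ] with n hn
    calc _ ≤ ∫ z, |psi (p z.1 z.2) ((w n z.1 + U z.1) - (w n z.2 + U z.2)) * (w n z.2 * (φ z.1 - φ z.2))| ∂(kap s p) :=
          abs_integral_le_integral_abs
      _ ≤ ∫ z, (δ * |(w n z.1 + U z.1) - (w n z.2 + U z.2)| ^ p z.1 z.2 + K * (|w n z.2| ^ p z.1 z.2 * |φ z.1 - φ z.2| ^ p z.1 z.2)) ∂(kap s p) := by
          refine integral_mono (ri n).abs (((hu n).iD.const_mul δ).add ((ci n).const_mul K)) fun z => ?_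
          have := he _ ((w n z.1 + U z.1) - (w n z.2 + U z.2)) (w n z.2 * (φ z.1 - φ z.2)) (H.h.p1 z.1 z.2) (H.h.pP z.1 z.2)
          dsimp only
          rw [abs_mul (psi _ _), psi_abs (H.h.p1 _ _)]
          rwa [abs_mul (w n z.2), Real.mul_rpow (abs_nonneg _) (abs_nonneg _), ← abs_mul] at this
      _ = δ * (∫ z, |(w n z.1 + U z.1) - (w n z.2 + U z.2)| ^ p z.1 z.2 ∂(kap s p)) +
          K * ∫ z, |w n z.2| ^ p z.1 z.2 * |φ z.1 - φ z.2| ^ p z.1 z.2 ∂(kap s p) := by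
          rw [integral_add ((hu n).iD.const_mul δ) ((ci n).const_mul K), integral_const_mul, integral_const_mul]
      _ ≤ _ := by
          have := (iD_le_Md _).trans (hC' n)
          gcongr
  have t3 : Tendsto (fun n => ∫ x, f x (w n x + U x) * (φ x * w n x)) atTop (𝓝 0) := by
    have hb := bl_real (μ := volume) (K := fun n x => f x (w n x + U x) * (φ x * w n x))
      (G := fun n x => |w n x + U x| ^ q x + |w n x| ^ q x)
      (fun n => (H.fint (hu n) (hv n)).aestronglyMeasurable) (fun n x => by positivity)
      (fun n => (H.iq (hu n)).add (H.iq (hw.W n))) (C' + C) (fun n => by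
        rw [integral_add (H.iq (hu n)) (H.iq (hw.W n))]
        exact add_le_add (huq n) (hw.qC n)) ?_ ?_
    · refine squeeze_zero_norm (fun n => ?_) hb.2
      rw [Real.norm_eq_abs]
      exact abs_integral_le_integral_abs
    · intro δ hδ
      obtain ⟨G, hG, hg⟩ := H.F.grow δ hδ
      refine ⟨G, hG, fun n => ?_⟩
      filter_upwards [hg] with x hx
      rw [abs_mul]
      refine le_trans ?_ (hx (w n x + U x) (w n x))
      refine mul_le_mul_of_nonneg_left ?_ (abs_nonneg _)
      rw [abs_mul, abs_of_nonneg (hφ.nn x)]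
      exact mul_le_of_le_one_left (abs_nonneg _) (hφ.le1 x)
    · filter_upwards [hw.ae, H.F.loc] with x hx hl
      obtain ⟨R, hR⟩ := (hx.add_const (U x)).norm.bddAbove_range
      obtain ⟨B, hB⟩ := hl R
      have : Tendsto (fun n => B * |w n x|) atTop (𝓝 0) := by
        simpa using hx.abs.const_mul B
      refine squeeze_zero_norm (fun n => ?_) this
      have h1 := hB (w n x + U x) (hR ⟨n, rfl⟩)
      rw [Real.norm_eq_abs, abs_mul, abs_mul, abs_of_nonneg (hφ.nn x)]
      have := mul_le_of_le_one_left (abs_nonneg (w n x)) (hφ.le1 x)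
      exact mul_le_mul h1 this (mul_nonneg (hφ.nn x) (abs_nonneg _)) ((abs_nonneg _).trans h1)
  have key : ∀ n, Lam s P p q lam φ (w n) =
      Jderiv s p P q f lam (fun x => w n x + U x) (fun x => φ x * w n x)
      - ((∫ z, φ z.1 * (psi (p z.1 z.2) ((w n z.1 - w n z.2) + (U z.1 - U z.2)) * (w n z.1 - w n z.2)) ∂(kap s p))
        - ∫ z, φ z.1 * |w n z.1 - w n z.2| ^ p z.1 z.2 ∂(kap s p))
      - ((∫ x, φ x * (psi P (w n x + U x) * w n x)) - ∫ x, φ x * |w n x| ^ P)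
      + lam * ((∫ x, φ x * (psi (q x) (w n x + U x) * w n x)) - ∫ x, φ x * |w n x| ^ q x)
      - (∫ z, psi (p z.1 z.2) ((w n z.1 + U z.1) - (w n z.2 + U z.2)) * (w n z.2 * (φ z.1 - φ z.2)) ∂(kap s p))
      + ∫ x, f x (w n x + U x) * (φ x * w n x) := by
    intro n
    rw [H.Jderiv_eq (hu n) (hv n)]
    have e1 : (∫ z, psi (p z.1 z.2) ((w n z.1 + U z.1) - (w n z.2 + U z.2)) * (φ z.1 * w n z.1 - φ z.2 * w n z.2) ∂(kap s p))
      = (∫ z, φ z.1 * (psi (p z.1 z.2) ((w n z.1 - w n z.2) + (U z.1 - U z.2)) * (w n z.1 - w n z.2)) ∂(kap s p)) +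
      ∫ z, psi (p z.1 z.2) ((w n z.1 + U z.1) - (w n z.2 + U z.2)) * (w n z.2 * (φ z.1 - φ z.2)) ∂(kap s p) := by
      rw [← integral_add (g1 n) (ri n)]
      congr 1; ext z
      rw [D_mul, add_sub_add_comm]
      ring
    have e2 : ∀ x, psi P (w n x + U x) * (φ x * w n x) = φ x * (psi P (w n x + U x) * w n x) := fun x => by ring
    have e3 : ∀ x, psi (q x) (w n x + U x) * (φ x * w n x) = φ x * (psi (q x) (w n x + U x) * w n x) := fun x => by ring
    simp only [e1, e2, e3, Lam]
    ring
  simp only [key]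
  have := ((((t1.sub g3).sub k3).add (l3.const_mul lam)).sub t2).add t3
  simpa using this
end

section
variable {N : ℕ} {s P ε₀ : ℝ} {p : Euc N → Euc N → ℝ}
variable {q : Euc N → ℝ} {qm qM : ℝ} {f : Euc N → ℝ → ℝ}

theorem Ctx.cut_one (h : Ctx s P ε₀ p) : Cut s p (fun _ => 1) := by
  refine ⟨measurable_const, fun _ => zero_le_one, fun _ => le_rfl, ?_⟩
  refine h.good ?_ 0 le_rfl ⟨fun _ => 0, fun z => ⟨le_rfl, zero_le_one, by simp⟩, fun z => by simp⟩ 0 ?_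
  · simp only [sub_self, abs_zero]
    exact measurable_const.pow h.pc.measurable
  · intro z hz
    have := h.p1 z.1 z.2
    simp [Real.zero_rpow (by linarith : p z.1 z.2 ≠ 0)] at hz

def clampF (d : Euc N → ℝ) (a b : ℝ) (x : Euc N) : ℝ := max 0 (min 1 ((b - d x) / (b - a)))

theorem clampF_one {d : Euc N → ℝ} {a b : ℝ} (hab : a < b) {x} (hx : d x ≤ a) : clampF d a b x = 1 := by
  unfold clampF
  rw [min_eq_left, max_eq_right zero_le_one]
  rw [le_div_iff₀ (by linarith)]; linarith

theorem clampF_zero {d : Euc N → ℝ} {a b : ℝ} (hab : a < b) {x} (hx : b ≤ d x) : clampF d a b x = 0 := by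
  unfold clampF
  apply max_eq_left
  exact (min_le_right _ _).trans (div_nonpos_of_nonpos_of_nonneg (by linarith) (by linarith))

structure Dfun (d : Euc N → ℝ) : Prop where
  lip : ∀ x y, |d x - d y| ≤ dist x y
  bd : (∀ c : ℝ, ∃ R : ℝ, ∀ x, d x ≤ c → ‖x‖ ≤ R) ∨ (∀ c : ℝ, ∃ R : ℝ, ∀ x, c ≤ d x → ‖x‖ ≤ R)

theorem Dfun.meas {d : Euc N → ℝ} (hd : Dfun d) : Measurable d := by
  have : LipschitzWith 1 d := LipschitzWith.of_dist_le_mul fun x y => by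
    rw [Real.dist_eq]; simpa using hd.lip x y
  exact this.continuous.measurable

theorem Ctx.cut_clamp (h : Ctx s P ε₀ p) {d : Euc N → ℝ} (hd : Dfun d) {a b : ℝ} (hab : a < b) :
    Cut s p (clampF d a b) := by
  have h0 : 0 < b - a := by linarith
  have hn : ∀ x, 0 ≤ clampF d a b x := fun x => le_max_left _ _
  have h1 : ∀ x, clampF d a b x ≤ 1 := fun x => max_le zero_le_one (min_le_left _ _)
  have hm : Measurable (clampF d a b) :=
    measurable_const.max (measurable_const.min ((hd.meas.const_sub b).div_const _))
  refine ⟨hm, hn, h1, ?_⟩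
  have hL : ∀ x y, |clampF d a b x - clampF d a b y| ≤ (1 / (b - a)) * dist x y := by
    intro x y
    unfold clampF
    calc _ ≤ |min 1 ((b - d x) / (b - a)) - min 1 ((b - d y) / (b - a))| := by
          have := abs_max_sub_max_le_max 0 (min 1 ((b - d x) / (b - a))) 0 (min 1 ((b - d y) / (b - a)))
          simpa using this
      _ ≤ |(b - d x) / (b - a) - (b - d y) / (b - a)| := by
          have := abs_min_sub_min_le_max 1 ((b - d x) / (b - a)) 1 ((b - d y) / (b - a))
          simpa using this
      _ = (1 / (b - a)) * |d x - d y| := by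
          rw [← sub_div, abs_div, abs_of_pos h0, sub_sub_sub_cancel_left, abs_sub_comm]; ring
      _ ≤ _ := by
          have := hd.lip x y
          gcongr
  have hR : ∃ R : ℝ, ∀ z : Euc N × Euc N, clampF d a b z.1 ≠ clampF d a b z.2 → ‖z.1‖ ≤ R ∨ ‖z.2‖ ≤ R := by
    rcases hd.bd with hb | hb
    · obtain ⟨R, hR⟩ := hb b
      refine ⟨R, fun z hz => ?_⟩
      by_contra! hc
      apply hz
      rw [clampF_zero hab, clampF_zero hab]
      · by_contra! hc'; linarith [hR _ hc'.le]
      · by_contra! hc'; linarith [hR _ hc'.le]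
    · obtain ⟨R, hR⟩ := hb a
      refine ⟨R, fun z hz => ?_⟩
      by_contra! hc
      apply hz
      rw [clampF_one hab, clampF_one hab]
      · by_contra! hc'; linarith [hR _ hc'.le]
      · by_contra! hc'; linarith [hR _ hc'.le]
  obtain ⟨R, hR⟩ := hR
  refine h.good (h.Dpow hm) (1 / (b - a)) (by positivity)
    ⟨fun z => |clampF d a b z.1 - clampF d a b z.2|, fun z => ⟨abs_nonneg _, ?_, hL _ _⟩, fun z => rfl⟩ R ?_
  · rw [abs_le]
    constructor <;> linarith [hn z.1, hn z.2, h1 z.1, h1 z.2]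
  · intro z hz
    apply hR
    intro he
    have := h.p1 z.1 z.2
    simp only [he, sub_self, abs_zero] at hz
    exact hz (Real.zero_rpow (by linarith))

theorem QCtx.Md_tendsto (H : QCtx s P ε₀ p q qm qM f) {w : ℕ → Euc N → ℝ} {lam : ℝ}
    (hΛ : ∀ φ, Cut s p φ → Tendsto (fun n => Lam s P p q lam φ (w n)) atTop (𝓝 0))
    (hq : Tendsto (fun n => ∫ x, |w n x| ^ q x) atTop (𝓝 0)) :
    Tendsto (fun n => Md s P p (w n)) atTop (𝓝 0) := by
  have h1 := (hΛ _ H.h.cut_one).add (hq.const_mul lam)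
  simp only [Lam, one_mul, mul_zero, add_zero, sub_add_cancel] at h1
  refine h1.congr fun n => ?_
  rw [Md, add_comm]

theorem Cut.int_le (h : Ctx s P ε₀ p) {φ : Euc N → ℝ} (hφ : Cut s p φ) {w : Euc N → ℝ} (hw : InW s P p w) :
    Integrable (fun z => φ z.1 * |w z.1 - w z.2| ^ p z.1 z.2) (kap s p) ∧
    Integrable (fun x => φ x * |w x| ^ P) := by
  constructor
  · refine hw.iD.mono' ((hφ.meas.comp measurable_fst).mul (h.Dpow hw.meas)).aestronglyMeasurable
      (Eventually.of_forall fun z => ?_)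
    have h0 := hφ.nn z.1
    rw [Real.norm_eq_abs, abs_of_nonneg (by positivity)]
    exact mul_le_of_le_one_left (by positivity) (hφ.le1 z.1)
  · refine hw.iP.mono' (hφ.meas.mul (hw.meas.abs.pow_const P)).aestronglyMeasurable
      (Eventually.of_forall fun z => ?_)
    have h0 := hφ.nn z
    rw [Real.norm_eq_abs, abs_of_nonneg (by positivity)]
    exact mul_le_of_le_one_left (by positivity) (hφ.le1 z)

theorem rpow_le_self' {t r : ℝ} (h0 : 0 ≤ t) (h1 : t ≤ 1) (hr : 1 ≤ r) : t ^ r ≤ t := by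
  have := Real.rpow_le_rpow_of_exponent_ge' h0 h1 zero_le_one hr
  rwa [Real.rpow_one] at this

theorem QCtx.Md_loc (H : QCtx s P ε₀ p q qm qM f) {w : ℕ → Euc N → ℝ} {C lam : ℝ} (hw : WSeq s P p q C w)
    (hΛ : ∀ φ, Cut s p φ → Tendsto (fun n => Lam s P p q lam φ (w n)) atTop (𝓝 0))
    {φ : Euc N → ℝ} (hφ : Cut s p φ) {δ ε : ℝ} (hδ : 0 < δ) (hε : 0 < ε) :
    (∀ n, InW s P p (fun x => φ x * w n x)) ∧
    ∀ᶠ n in atTop, Md s P p (fun x => φ x * w n x) ≤ (1 + δ) * (lam * ∫ x, φ x * |w n x| ^ q x) + ε := by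
  obtain ⟨ci, c0⟩ := (H.h.comm H.qc.measurable H.Pqm H.qlo H.qhi hφ.good (fun n => (hw.W n).meas)
    (fun n => H.iq (hw.W n)) C hw.qC hw.ae).2
  have hv : ∀ n, InW s P p (fun x => φ x * w n x) := fun n => (hφ.inW H.h (hw.W n) (ci n)).1
  refine ⟨hv, ?_⟩
  have hP := H.h.P1
  obtain ⟨K, hK, he⟩ := elemE2 P hδ
  have t0 : Tendsto (fun n => (1 + δ) * Lam s P p q lam φ (w n) + K * ∫ z, |w n z.2| ^ p z.1 z.2 * |φ z.1 - φ z.2| ^ p z.1 z.2 ∂(kap s p)) atTop (𝓝 0) := by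
    simpa using ((hΛ φ hφ).const_mul (1 + δ)).add (c0.const_mul K)
  filter_upwards [t0.eventually_le_const hε] with n hn
  obtain ⟨i1, i2⟩ := hφ.int_le H.h (hw.W n)
  have e1 : ∫ z, |φ z.1 * w n z.1 - φ z.2 * w n z.2| ^ p z.1 z.2 ∂(kap s p) ≤
      (1 + δ) * (∫ z, φ z.1 * |w n z.1 - w n z.2| ^ p z.1 z.2 ∂(kap s p)) +
      K * ∫ z, |w n z.2| ^ p z.1 z.2 * |φ z.1 - φ z.2| ^ p z.1 z.2 ∂(kap s p) := by
    rw [← integral_const_mul, ← integral_const_mul, ← integral_add (i1.const_mul _) ((ci n).const_mul _)]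
    refine integral_mono (hv n).iD ((i1.const_mul _).add ((ci n).const_mul _)) fun z => ?_
    have hp := H.h.p1 z.1 z.2
    have h1 := he (p z.1 z.2) (w n z.2 * (φ z.1 - φ z.2)) (φ z.1 * (w n z.1 - w n z.2)) (by linarith) (H.h.pP z.1 z.2)
    rw [← D_mul, abs_mul (φ z.1), abs_of_nonneg (hφ.nn z.1), Real.mul_rpow (hφ.nn _) (abs_nonneg _),
      abs_mul (w n z.2), Real.mul_rpow (abs_nonneg _) (abs_nonneg _)] at h1
    refine h1.trans ?_
    have := rpow_le_self' (hφ.nn z.1) (hφ.le1 z.1) hp.le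
    gcongr
  have e2 : ∫ x, |φ x * w n x| ^ P ≤ ∫ x, φ x * |w n x| ^ P := by
    refine integral_mono (hv n).iP i2 fun x => ?_
    dsimp only
    rw [abs_mul (φ x), abs_of_nonneg (hφ.nn x), Real.mul_rpow (hφ.nn _) (abs_nonneg _)]
    have := rpow_le_self' (hφ.nn x) (hφ.le1 x) hP.le
    gcongr
  have e3 : 0 ≤ ∫ x, φ x * |w n x| ^ P := integral_nonneg fun x => mul_nonneg (hφ.nn x) (by positivity)
  unfold Md
  unfold Lam at hn
  nlinarith

theorem QCtx.goodZ (h : Ctx s P ε₀ p) (hpinf : Tendsto (fun z : Euc N × Euc N => p z.1 z.2)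
      ((cocompact (Euc N)) ×ˢ (cocompact (Euc N))) (𝓝 P)) {δ : ℝ} (hδ : 0 < δ) :
    Good s p ({z : Euc N × Euc N | p z.1 z.2 < P - δ}.indicator 1) := by
  have hm : MeasurableSet {z : Euc N × Euc N | p z.1 z.2 < P - δ} :=
    measurableSet_lt h.pc.measurable measurable_const
  have h1 : ∀ᶠ z in (cocompact (Euc N)) ×ˢ (cocompact (Euc N)), P - δ < p z.1 z.2 :=
    hpinf.eventually_const_lt (by linarith)
  obtain ⟨A, hA, B, hB, hAB⟩ := eventually_prod_iff.1 h1
  obtain ⟨K1, hK1, hA'⟩ := mem_cocompact.1 hA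
  obtain ⟨K2, hK2, hB'⟩ := mem_cocompact.1 hB
  obtain ⟨R1, hR1⟩ := hK1.isBounded.exists_norm_le
  obtain ⟨R2, hR2⟩ := hK2.isBounded.exists_norm_le
  refine h.good (measurable_one.indicator hm) (1 / ε₀) (by have := h.e0; positivity)
    ⟨{z : Euc N × Euc N | p z.1 z.2 < P - δ}.indicator 1, fun z => ?_, fun z => ?_⟩ (max R1 R2) fun z hz => ?_
  · by_cases hz : z ∈ {z : Euc N × Euc N | p z.1 z.2 < P - δ}
    · rw [indicator_of_mem hz]
      refine ⟨zero_le_one, le_rfl, ?_⟩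
      have : ε₀ ≤ dist z.1 z.2 := by
        by_contra! hc
        have := h.diag z.1 z.2 hc
        simp only [mem_ofPred_eq] at hz
        linarith
      rw [one_div, ← div_eq_inv_mul]
      exact (one_le_div h.e0).2 this
    · rw [indicator_of_notMem hz]
      exact ⟨le_rfl, zero_le_one, by have := h.e0; positivity⟩
  · by_cases hz : z ∈ {z : Euc N × Euc N | p z.1 z.2 < P - δ}
    · rw [indicator_of_mem hz, Pi.one_apply, Real.one_rpow]
    · have := h.p1 z.1 z.2
      rw [indicator_of_notMem hz, Real.zero_rpow (by linarith)]
  · have hz' : z ∈ {z : Euc N × Euc N | p z.1 z.2 < P - δ} := by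
      by_contra hc
      exact hz (indicator_of_notMem hc _)
    simp only [mem_ofPred_eq] at hz'
    by_cases hz1 : z.1 ∈ K1
    · exact Or.inl ((hR1 _ hz1).trans (le_max_left _ _))
    · by_cases hz2 : z.2 ∈ K2
      · exact Or.inr ((hR2 _ hz2).trans (le_max_right _ _))
      · have := hAB (hA' hz1) (hB' hz2)
        linarith

theorem QCtx.sobUp (H : QCtx s P ε₀ p q qm qM f) {w : ℕ → Euc N → ℝ} {C : ℝ} (hw : WSeq s P p q C w)
    (hpinf : Tendsto (fun z : Euc N × Euc N => p z.1 z.2)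
      ((cocompact (Euc N)) ×ˢ (cocompact (Euc N))) (𝓝 P)) {δ : ℝ} (hδ : 0 < δ) (hδ3 : 3 * δ ≤ 1)
    {φ : Euc N → ℝ} (hφ : Cut s p φ) (β : ℝ) (hv : ∀ n, InW s P p (fun x => φ x * w n x)) :
    ∀ᶠ n in atTop, ∀ b : ℝ, |b| ≤ β → Md s P p (fun x => φ x * w n x) ≤ Real.exp b →
      sobNorm Set.univ s p (fun x => φ x * w n x) ≤ Real.exp (b / P + 3 * δ * (|b| + 1)) := by
  have hP := H.h.P1
  have hZ := QCtx.goodZ H.h hpinf hδ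
  set Z : Euc N × Euc N → ℝ := {z : Euc N × Euc N | p z.1 z.2 < P - δ}.indicator 1 with hZd
  obtain ⟨⟨a1, a2⟩, b1, b2⟩ := H.h.comm H.qc.measurable H.Pqm H.qlo H.qhi hZ (fun n => (hw.W n).meas)
    (fun n => H.iq (hw.W n)) C hw.qC hw.ae
  set K := 2 ^ P * Real.exp (P * (β + 1 * (β + 1))) with hK
  have t0 : Tendsto (fun n => K * ((∫ z, |w n z.1| ^ p z.1 z.2 * Z z ∂(kap s p)) +
      ∫ z, |w n z.2| ^ p z.1 z.2 * Z z ∂(kap s p))) atTop (𝓝 0) := by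
    simpa using (a2.add b2).const_mul K
  have hδ' : 0 < 1 - Real.exp (-δ) := by
    have := Real.exp_lt_one_iff.2 (show -δ < 0 by linarith)
    linarith
  filter_upwards [t0.eventually_le_const hδ'] with n hn b hb hM
  set l := b / P + 3 * δ * (|b| + 1) with hl
  have hb0 := abs_nonneg b
  have hbP : |b / P| ≤ |b| := by
    rw [abs_div, abs_of_pos (by linarith : 0 < P)]
    exact div_le_self hb0 hP.le
  have hl1 : |l| ≤ |b| + 3 * δ * (|b| + 1) := by
    refine (abs_add_le _ _).trans ?_
    rw [abs_of_nonneg (by positivity : 0 ≤ 3 * δ * (|b| + 1))]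
    linarith
  have hl2 : |l| ≤ β + 1 * (β + 1) := by
    have : 3 * δ * (|b| + 1) ≤ 1 * (β + 1) := by gcongr
    linarith
  have hc := hv n
  have hd := hc.div H.h (Real.exp_pos l)
  refine InW.norm_le H.h (Real.exp_pos l) hd ?_
  have pw : ∀ t r : ℝ, |t / Real.exp l| ^ r = |t| ^ r * Real.exp (-(r * l)) := fun t r => by
    rw [abs_div, abs_of_pos (Real.exp_pos l), Real.div_rpow (abs_nonneg _) (Real.exp_pos l).le, ← Real.exp_mul,
      Real.exp_neg, div_eq_mul_inv, mul_comm l]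
  have m1 : b - P * l + δ * |l| ≤ -δ := by
    have e1 : P * l = b + P * (3 * δ * (|b| + 1)) := by rw [hl]; field_simp
    have e2 : δ * |l| ≤ δ * (|b| + 3 * δ * (|b| + 1)) := by gcongr
    have e3 : 3 * δ * (|b| + 1) ≤ P * (3 * δ * (|b| + 1)) := le_mul_of_one_le_left (by positivity) hP.le
    have e4 : δ * (|b| + 3 * δ * (|b| + 1)) ≤ δ * (|b| + 1 * (|b| + 1)) := by gcongr
    rw [e1]
    nlinarith
  set v := fun x => φ x * w n x with hvd
  have pt : ∀ z : Euc N × Euc N, |v z.1 / Real.exp l - v z.2 / Real.exp l| ^ p z.1 z.2 ≤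
      Real.exp (-(P * l) + δ * |l|) * |v z.1 - v z.2| ^ p z.1 z.2 +
      K * (|w n z.1| ^ p z.1 z.2 * Z z + |w n z.2| ^ p z.1 z.2 * Z z) := by
    intro z
    have hp := H.h.p1 z.1 z.2
    have hpP := H.h.pP z.1 z.2
    rw [← sub_div, pw]
    by_cases hz : z ∈ {z : Euc N × Euc N | p z.1 z.2 < P - δ}
    · have hZ1 : Z z = 1 := by rw [hZd, indicator_of_mem hz]; rfl
      rw [hZ1, mul_one, mul_one]
      have e1 : |v z.1 - v z.2| ^ p z.1 z.2 ≤ 2 ^ P * (|w n z.1| ^ p z.1 z.2 + |w n z.2| ^ p z.1 z.2) := by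
        have := add_rpow_le (by linarith : 0 < p z.1 z.2) hpP (v z.1) (-v z.2)
        rw [abs_neg, ← sub_eq_add_neg] at this
        refine this.trans ?_
        have hvw : ∀ x, |v x| ≤ |w n x| := fun x => by
          rw [hvd]; dsimp only
          rw [abs_mul, abs_of_nonneg (hφ.nn x)]
          exact mul_le_of_le_one_left (abs_nonneg _) (hφ.le1 x)
        have h1 := hvw z.1
        have h2 := hvw z.2
        gcongr
      have e2 : Real.exp (-(p z.1 z.2 * l)) ≤ Real.exp (P * (β + 1 * (β + 1))) := by
        apply Real.exp_le_exp.2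
        calc -(p z.1 z.2 * l) ≤ p z.1 z.2 * |l| := by
              rw [← mul_neg]; gcongr; exact neg_le_abs l
          _ ≤ P * (β + 1 * (β + 1)) := by gcongr
      have e3 : |v z.1 - v z.2| ^ p z.1 z.2 * Real.exp (-(p z.1 z.2 * l)) ≤ K * (|w n z.1| ^ p z.1 z.2 + |w n z.2| ^ p z.1 z.2) := by
        calc _ ≤ (2 ^ P * (|w n z.1| ^ p z.1 z.2 + |w n z.2| ^ p z.1 z.2)) * Real.exp (P * (β + 1 * (β + 1))) := by gcongr
          _ = _ := by rw [hK]; ring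
      have : 0 ≤ Real.exp (-(P * l) + δ * |l|) * |v z.1 - v z.2| ^ p z.1 z.2 := by positivity
      linarith
    · have hZ1 : Z z = 0 := by rw [hZd, indicator_of_notMem hz]
      rw [hZ1, mul_zero, mul_zero, add_zero, mul_zero, add_zero, mul_comm]
      simp only [mem_ofPred_eq, not_lt] at hz
      gcongr
      have : (P - p z.1 z.2) * l ≤ δ * |l| := by
        calc (P - p z.1 z.2) * l ≤ (P - p z.1 z.2) * |l| := by
              have := le_abs_self l
              have : 0 ≤ P - p z.1 z.2 := by linarith
              gcongr
          _ ≤ δ * |l| := by gcongr; linarith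
      linarith
  have i3 : Integrable (fun z => |w n z.1| ^ p z.1 z.2 * Z z + |w n z.2| ^ p z.1 z.2 * Z z) (kap s p) := (a1 n).add (b1 n)
  have e1 : ∫ z, |v z.1 / Real.exp l - v z.2 / Real.exp l| ^ p z.1 z.2 ∂(kap s p) ≤
      Real.exp (-(P * l) + δ * |l|) * (∫ z, |v z.1 - v z.2| ^ p z.1 z.2 ∂(kap s p)) + (1 - Real.exp (-δ)) := by
    refine (integral_mono hd.iD ((hc.iD.const_mul _).add (i3.const_mul K)) pt).trans ?_
    rw [integral_add' (hc.iD.const_mul _) (i3.const_mul K), integral_const_mul, integral_const_mul,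
      integral_add (a1 n) (b1 n)]
    linarith
  have e2 : ∫ x, |v x / Real.exp l| ^ P ≤ Real.exp (-(P * l) + δ * |l|) * ∫ x, |v x| ^ P := by
    simp only [pw]
    rw [integral_mul_const, mul_comm]
    refine mul_le_mul_of_nonneg_right (Real.exp_le_exp.2 ?_) (integral_nonneg fun x => by positivity)
    have := abs_nonneg l
    nlinarith
  have e3 : Real.exp (-(P * l) + δ * |l|) * Md s P p v ≤ Real.exp (-δ) := by
    calc _ ≤ Real.exp (-(P * l) + δ * |l|) * Real.exp b := by gcongr
      _ = Real.exp (b - P * l + δ * |l|) := by rw [← Real.exp_add]; congr 1; ring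
      _ ≤ _ := Real.exp_le_exp.2 m1
  have e4 : Md s P p v = (∫ x, |v x| ^ P) + ∫ z, |v z.1 - v z.2| ^ p z.1 z.2 ∂(kap s p) := rfl
  rw [e4] at e3
  unfold Md
  linarith
end

section
variable {N : ℕ} {s P ε₀ : ℝ} {p : Euc N → Euc N → ℝ}
variable {q : Euc N → ℝ} {qm qM : ℝ} {f : Euc N → ℝ → ℝ}

theorem log_low {a l q0 δ : ℝ} (hδ : 0 < δ) (hq0 : 1 ≤ q0 - δ) (h : a ≤ q0 * l + δ * |l|) :
    a / q0 - δ * |a| ≤ l := by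
  have hq : 0 < q0 := by linarith
  have hd : a / q0 * q0 = a := div_mul_cancel₀ _ hq.ne'
  set r := a / q0 with hr
  rcases le_or_gt 0 l with hl | hl
  · rw [abs_of_nonneg hl] at h
    rcases le_or_gt a 0 with ha | ha
    · have : r ≤ 0 := div_nonpos_of_nonpos_of_nonneg ha hq.le
      have := abs_nonneg a
      nlinarith
    · rw [abs_of_pos ha]
      have hr0 : 0 < r := by positivity
      have hra : r ≤ a := div_le_self ha.le (by linarith)
      have : (q0 + δ) * (r - δ * a) ≤ (q0 + δ) * l := by
        have e1 : δ * r ≤ δ * a := by gcongr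
        have e2 : δ * a ≤ (q0 + δ) * (δ * a) := le_mul_of_one_le_left (by positivity) (by linarith)
        nlinarith
      exact le_of_mul_le_mul_left this (by linarith)
  · rw [abs_of_neg hl] at h
    have h2 : a ≤ (q0 - δ) * l := by linarith
    have ha : a < 0 := h2.trans_lt (by nlinarith)
    rw [abs_of_neg ha]
    have hra : a ≤ r := by
      have : -r ≤ -a := by rw [hr, ← neg_div]; exact div_le_self (by linarith) (by linarith)
      linarith
    have : (q0 - δ) * (r + δ * a) ≤ (q0 - δ) * l := by
      have e1 : -(δ * r) ≤ -(δ * a) := by nlinarith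
      have e2 : -(δ * a) ≤ (q0 - δ) * (-(δ * a)) := le_mul_of_one_le_left (by nlinarith) (by linarith)
      nlinarith
    have := le_of_mul_le_mul_left this (by linarith)
    linarith

theorem lux_low {v : Euc N → ℝ} (hv : Measurable v) (hq : Measurable q) (hi : Integrable fun x => |v x| ^ q x)
    (hA : 0 < ∫ x, |v x| ^ q x) {q0 δ : ℝ} (hδ : 0 < δ) (hq0 : 1 ≤ q0 - δ) (hq1 : ∀ x, 1 < q x)
    (hs : ∀ x, v x ≠ 0 → |q x - q0| ≤ δ) :
    Real.exp (Real.log (∫ x, |v x| ^ q x) / q0 - δ * |Real.log (∫ x, |v x| ^ q x)|) ≤ luxNorm volume q v := by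
  set A := ∫ x, |v x| ^ q x with hAd
  have hAl : ∫⁻ x, ENNReal.ofReal (|v x| ^ q x) = ENNReal.ofReal A :=
    (ofReal_integral_eq_lintegral_ofReal hi (Eventually.of_forall fun x => by positivity)).symm
  have lm : ∀ k : ℝ, 0 ≤ k → ∫⁻ x, ENNReal.ofReal (|v x| ^ q x * k) = ENNReal.ofReal (A * k) := by
    intro k hk
    simp_rw [ENNReal.ofReal_mul' hk]
    rw [lintegral_mul_const _ (hv.abs.pow hq).ennreal_ofReal, hAl]
  refine le_csInf ?_ ?_
  · have hm : 1 ≤ max 1 A := le_max_left _ _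
    refine ⟨max 1 A, by linarith, ?_⟩
    unfold varModular
    calc _ ≤ ∫⁻ x, ENNReal.ofReal (|v x| ^ q x * (max 1 A)⁻¹) := by
          refine lintegral_mono fun x => ENNReal.ofReal_le_ofReal ?_
          rw [← div_eq_mul_inv]
          exact div_rpow_le hm (hq1 x).le
      _ = ENNReal.ofReal (A * (max 1 A)⁻¹) := lm _ (by positivity)
      _ ≤ 1 := by
          apply ENNReal.ofReal_le_one.2
          rw [← div_eq_mul_inv]
          exact div_le_one_of_le₀ (le_max_right _ _) (by linarith)
  · rintro c ⟨hc, hm⟩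
    set l := Real.log c with hl
    have hcl : c = Real.exp l := (Real.exp_log hc).symm
    rw [hcl]
    apply Real.exp_le_exp.2
    apply log_low hδ hq0
    rw [Real.log_le_iff_le_exp hA]
    have h1 : ∫⁻ x, ENNReal.ofReal (|v x| ^ q x * Real.exp (-(q0 * l + δ * |l|))) ≤ 1 := by
      refine le_trans (lintegral_mono fun x => ENNReal.ofReal_le_ofReal ?_) hm
      by_cases hx : v x = 0
      · simp [hx, Real.zero_rpow (by linarith [hq1 x] : q x ≠ 0)]
      · have h2 := abs_le.1 (hs x hx)
        have e : |v x / c| ^ q x = |v x| ^ q x * Real.exp (-(q x * l)) := by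
          rw [abs_div, abs_of_pos hc, Real.div_rpow (abs_nonneg _) hc.le, hcl, ← Real.exp_mul,
            Real.exp_neg, div_eq_mul_inv, mul_comm l]
        rw [e]
        gcongr
        have : (q x - q0) * l ≤ δ * |l| := by
          refine (le_abs_self _).trans ?_
          rw [abs_mul]
          have := hs x hx
          gcongr
        linarith
    rw [lm _ (Real.exp_pos _).le, ENNReal.ofReal_le_one, Real.exp_neg, ← div_eq_mul_inv,
      div_le_one (Real.exp_pos _)] at h1
    exact h1

theorem log_final {σ Λ a b q0 P qm δ τ : ℝ} (hP : 1 < P) (hPq : P < qm) (hq : qm ≤ q0) (hδ : 0 < δ)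
    (hδ3 : 3 * δ ≤ 1) (hb : b = a + Λ + 3 * δ)
    (h : σ + (a / q0 - δ * |a|) ≤ b / P + 3 * δ * (|b| + 1))
    (hτ : τ ≤ q0 * (P / (q0 - P)) * σ - P / (q0 - P) * Λ) :
    τ ≤ a + Λ + δ * (qm * P / (qm - P) * (9 + 3 * |Λ|)) * (1 + |a|) := by
  have ha := abs_nonneg a
  have hΛ := abs_nonneg Λ
  have e1 : |b| ≤ |a| + |Λ| + 1 := by
    rw [hb]
    refine (abs_add_le _ _).trans ?_
    have := abs_add_le a Λ
    rw [abs_of_pos (by linarith : 0 < 3 * δ)]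
    linarith
  have e2 : b / P ≤ (a + Λ) / P + 3 * δ := by
    rw [hb, add_div]
    have : 3 * δ / P ≤ 3 * δ := div_le_self (by linarith) hP.le
    linarith
  have e3 : 3 * δ * (|b| + 1) ≤ 3 * δ * (|a| + |Λ| + 2) := 
    mul_le_mul_of_nonneg_left (by linarith) (by linarith)
  have e4 : σ ≤ (a + Λ) / P - a / q0 + δ * ((9 + 3 * |Λ|) * (1 + |a|)) := by
    have : δ * |a| + 3 * δ + 3 * δ * (|a| + |Λ| + 2) ≤ δ * ((9 + 3 * |Λ|) * (1 + |a|)) := by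
      have h1 : 0 ≤ |Λ| * |a| := by positivity
      have : |a| + 3 + 3 * (|a| + |Λ| + 2) ≤ (9 + 3 * |Λ|) * (1 + |a|) := by nlinarith
      nlinarith
    linarith
  have d0 : 0 < q0 - P := by linarith
  have d1 : 0 < qm - P := by linarith
  have hq0 : 0 < q0 := by linarith
  have hG : q0 * (P / (q0 - P)) ≤ qm * P / (qm - P) := by
    rw [mul_div_assoc', div_le_div_iff₀ d0 d1]
    nlinarith [mul_nonneg (mul_nonneg (by linarith : 0 ≤ P) (by linarith : 0 ≤ P)) (by linarith : 0 ≤ q0 - qm)]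
  have hG0 : 0 ≤ q0 * (P / (q0 - P)) := by positivity
  have e5 := mul_le_mul_of_nonneg_left e4 hG0
  have e6 : q0 * (P / (q0 - P)) * ((a + Λ) / P - a / q0) = a + Λ + P / (q0 - P) * Λ := by
    field_simp
    ring
  have e7 : q0 * (P / (q0 - P)) * (δ * ((9 + 3 * |Λ|) * (1 + |a|))) ≤
      qm * P / (qm - P) * (δ * ((9 + 3 * |Λ|) * (1 + |a|))) := by gcongr
  rw [mul_add, e6] at e5
  have e8 : qm * P / (qm - P) * (δ * ((9 + 3 * |Λ|) * (1 + |a|))) = δ * (qm * P / (qm - P) * (9 + 3 * |Λ|)) * (1 + |a|) := by ring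
  linarith

theorem log_contra {τ τ' Λ a K δ : ℝ} (h : τ ≤ a + Λ + δ * K * (1 + |a|)) (ha : a + Λ ≤ τ')
    (h0 : 0 ≤ δ * K) (h1 : δ * K ≤ 1) (h2 : δ * K * (1 + |τ' - Λ|) < τ - τ') : False := by
  have e1 : |a| ≤ |τ' - Λ| + (τ' - Λ - a) := by
    have := abs_sub_abs_le_abs_sub a (τ' - Λ)
    rw [abs_sub_comm a, abs_of_nonneg (by linarith : 0 ≤ τ' - Λ - a)] at this
    linarith
  have e2 : δ * K * |a| ≤ δ * K * (|τ' - Λ| + (τ' - Λ - a)) := by gcongr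
  nlinarith

theorem QCtx.key (H : QCtx s P ε₀ p q qm qM f) {w : ℕ → Euc N → ℝ} {C lam : ℝ} (hw : WSeq s P p q C w)
    (hlam : 0 < lam)
    (hΛ : ∀ φ, Cut s p φ → Tendsto (fun n => Lam s P p q lam φ (w n)) atTop (𝓝 0))
    (hpinf : Tendsto (fun z : Euc N × Euc N => p z.1 z.2)
      ((cocompact (Euc N)) ×ˢ (cocompact (Euc N))) (𝓝 P))
    (hS : 0 < Sq s p q) {τ τ' : ℝ}
    (hτ : ∀ x, τ ≤ q x * (P / (q x - P)) * Real.log (Sq s p q) - P / (q x - P) * Real.log lam)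
    (hub : ∀ᶠ n in atTop, lam * ∫ x, |w n x| ^ q x ≤ Real.exp τ')
    {δ : ℝ} (hδ : 0 < δ) (hδ3 : 3 * δ ≤ 1) (hδq : δ ≤ qm - 1)
    (hk1 : δ * (qm * P / (qm - P) * (9 + 3 * |Real.log lam|)) ≤ 1)
    (hk2 : δ * (qm * P / (qm - P) * (9 + 3 * |Real.log lam|)) * (1 + |τ' - Real.log lam|) < τ - τ')
    {d : Euc N → ℝ} (hd : Dfun d) {t t' : ℝ} (ht : t < t')
    (osc : ∀ x y, d x ≤ t' → d y ≤ t' → |q x - q y| ≤ δ) {η : ℝ} (hη : 0 < η) :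
    ∀ᶠ n in atTop, ¬ (η ≤ ∫ x in {x | d x ≤ t}, |w n x| ^ q x ∧
      ∫ x in {x | d x ≤ t'}, |w n x| ^ q x ≤ (1 + δ) * ∫ x in {x | d x ≤ t}, |w n x| ^ q x) := by
  have hP := H.h.P1
  have hPq := H.Pqm
  obtain ⟨x0, hx0⟩ : ∃ x0, ∀ x, d x ≤ t' → |q x - q x0| ≤ δ := by
    by_cases h : ∃ x0, d x0 ≤ t'
    · obtain ⟨x0, h0⟩ := h
      exact ⟨x0, fun x hx => osc x x0 hx h0⟩
    · push Not at h
      exact ⟨0, fun x hx => absurd hx (h x).not_ge⟩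
  have hφ := H.h.cut_clamp hd ht
  set φ := clampF d t t' with hφd
  have mt : ∀ c, MeasurableSet {x | d x ≤ c} := fun c => measurableSet_le hd.meas measurable_const
  obtain ⟨hv, hM⟩ := H.Md_loc hw hΛ hφ hδ (show 0 < δ * (lam * η) by positivity)
  have hU := H.sobUp hw hpinf hδ hδ3 hφ (|Real.log η| + |τ'| + 2 * |Real.log lam| + 1) hv
  filter_upwards [hM, hU, hub] with n h1 h2 h3
  rintro ⟨h4, h5⟩
  set v := fun x => φ x * w n x with hvd
  have hvi := H.iq (hv n)
  have hwi := H.iq (hw.W n)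
  set A := ∫ x, |v x| ^ q x with hA
  have hle : ∀ x, |v x| ^ q x ≤ |w n x| ^ q x := fun x => by
    refine Real.rpow_le_rpow (abs_nonneg _) ?_ (by linarith [H.q1 x])
    rw [hvd]; dsimp only
    rw [abs_mul, abs_of_nonneg (hφ.nn x)]
    exact mul_le_of_le_one_left (abs_nonneg _) (hφ.le1 x)
  have A1 : ∫ x in {x | d x ≤ t}, |w n x| ^ q x ≤ A := by
    have : ∫ x in {x | d x ≤ t}, |w n x| ^ q x = ∫ x in {x | d x ≤ t}, |v x| ^ q x := by
      refine setIntegral_congr_fun (mt t) fun x hx => ?_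
      simp only [hvd, hφd]
      rw [clampF_one ht hx, one_mul]
    rw [this]
    exact setIntegral_le_integral hvi (Eventually.of_forall fun x => by positivity)
  have A2 : A ≤ ∫ x, |w n x| ^ q x := integral_mono hvi hwi hle
  have A3 : ∫ x, φ x * |w n x| ^ q x ≤ ∫ x in {x | d x ≤ t'}, |w n x| ^ q x := by
    rw [← integral_indicator (mt t')]
    refine integral_mono ?_ (hwi.indicator (mt t')) fun x => ?_
    · refine hwi.mono' (hφ.meas.mul ((hw.W n).meas.abs.pow H.qc.measurable)).aestronglyMeasurable
        (Eventually.of_forall fun z => ?_)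
      have h0 := hφ.nn z
      rw [Real.norm_eq_abs, abs_of_nonneg (by positivity)]
      exact mul_le_of_le_one_left (by positivity) (hφ.le1 z)
    · dsimp only
      by_cases hx : d x ≤ t'
      · rw [indicator_of_mem (show x ∈ {x | d x ≤ t'} from hx)]
        exact mul_le_of_le_one_left (by positivity) (hφ.le1 x)
      · rw [hφd, clampF_zero ht (not_le.1 hx).le, zero_mul]
        exact indicator_nonneg (fun _ _ => by positivity) _
  have hA0 : 0 < A := by linarith
  set a := Real.log A with ha
  set Λ := Real.log lam with hΛd
  have ea : Real.exp a = A := Real.exp_log hA0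
  have eΛ : Real.exp Λ = lam := Real.exp_log hlam
  have a1 : a + Λ ≤ τ' := by
    rw [← Real.exp_le_exp, Real.exp_add, ea, eΛ, mul_comm]
    exact (mul_le_mul_of_nonneg_left A2 hlam.le).trans h3
  have a2 : Real.log η ≤ a := Real.log_le_log hη (by linarith)
  have MdB : Md s P p v ≤ Real.exp (a + Λ + 3 * δ) := by
    have e1 : (1 + δ) ^ 3 ≤ Real.exp (3 * δ) := by
      rw [mul_comm, Real.exp_mul]
      have : 1 + δ ≤ Real.exp δ := by linarith [Real.add_one_le_exp δ]
      calc (1 + δ) ^ 3 ≤ Real.exp δ ^ 3 := by gcongr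
        _ = _ := by rw [← Real.rpow_natCast]; norm_num
    rw [Real.exp_add, Real.exp_add, ea, eΛ]
    have e2 : lam * ∫ x, φ x * |w n x| ^ q x ≤ lam * ((1 + δ) * A) := by
      gcongr
      exact A3.trans (h5.trans (by gcongr))
    have e3 : δ * (lam * η) ≤ δ * (lam * A) := by gcongr; linarith
    calc _ ≤ (1 + δ) * (lam * ((1 + δ) * A)) + δ * (lam * A) := h1.trans (add_le_add (by gcongr) e3)
      _ ≤ A * lam * (1 + δ) ^ 3 := by
          have : 0 < A * lam := by positivity
          have h6 : (1 + δ) * (1 + δ) + δ ≤ (1 + δ) ^ 3 := by nlinarith [pow_pos hδ 3, pow_pos hδ 2]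
          have := mul_le_mul_of_nonneg_left h6 this.le
          linarith
      _ ≤ _ := by gcongr
  have hb : |a + Λ + 3 * δ| ≤ |Real.log η| + |τ'| + 2 * |Λ| + 1 := by
    have := neg_abs_le (Real.log η)
    have := le_abs_self τ'
    have := le_abs_self Λ
    have := neg_abs_le Λ
    have := abs_nonneg τ'
    have := abs_nonneg (Real.log η)
    have := abs_nonneg Λ
    rw [abs_le]
    constructor <;> linarith
  have N1 := h2 _ hb MdB
  have N2 := lux_low (hv n).meas H.qc.measurable hvi hA0 hδ (q0 := q x0) (by linarith [H.qlo x0]) H.q1 (fun x hx => by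
    apply hx0
    by_contra! hc
    apply hx
    simp only [hφd]
    rw [clampF_zero ht hc.le, zero_mul])
  have Lp : 0 < luxNorm volume q v := lt_of_lt_of_le (Real.exp_pos _) N2
  have N3 : Sq s p q ≤ sobNorm Set.univ s p v / luxNorm volume q v := by
    refine csInf_le ⟨0, ?_⟩ ⟨v, (hv n).memSob H.h, fun h0 => ?_, rfl⟩
    · rintro c ⟨u, -, -, rfl⟩
      exact div_nonneg (sobNorm_nonneg _) (Real.sInf_nonneg fun _ hx => hx.1.le)
    · apply hA0.ne'
      rw [hA]
      have : (fun x => |v x| ^ q x) =ᵐ[volume] 0 := by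
        filter_upwards [h0] with x hx
        rw [hx]; simp [Real.zero_rpow (by linarith [H.q1 x] : q x ≠ 0)]
      rw [integral_congr_ae this]; simp
  rw [le_div_iff₀ Lp] at N3
  have N4 : Real.exp (Real.log (Sq s p q) + (a / q x0 - δ * |a|)) ≤ Real.exp ((a + Λ + 3 * δ) / P + 3 * δ * (|a + Λ + 3 * δ| + 1)) := by
    rw [Real.exp_add, Real.exp_log hS]
    exact (mul_le_mul_of_nonneg_left N2 hS.le).trans (N3.trans N1)
  have N5 := log_final hP hPq (H.qlo x0) hδ hδ3 rfl (Real.exp_le_exp.1 N4) (hτ x0)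
  have : 0 < qm - P := by linarith
  have : 0 < qm := by linarith
  exact log_contra N5 a1 (by positivity) hk1 hk2
end

section
variable {N : ℕ} {s P ε₀ : ℝ} {p : Euc N → Euc N → ℝ}
variable {q : Euc N → ℝ} {qm qM : ℝ} {f : Euc N → ℝ → ℝ}

theorem pigeon {M : ℕ → ℝ → ℝ} {δ C a b : ℝ} (hδ : 0 < δ) (hab : a < b) (hC : ∀ n t, M n t ≤ C)
    (h0 : ∀ n t, 0 ≤ M n t)
    (hk : ∀ η > 0, ∀ t t', a ≤ t → t < t' → t' ≤ b →
      ∀ᶠ n in atTop, ¬ (η ≤ M n t ∧ M n t' ≤ (1 + δ) * M n t)) :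
    Tendsto (fun n => M n a) atTop (𝓝 0) := by
  rw [Metric.tendsto_atTop']
  intro η hη
  obtain ⟨k, hk1⟩ := pow_unbounded_of_one_lt (C / η) (by linarith : 1 < 1 + δ)
  rw [div_lt_iff₀ hη] at hk1
  let T : ℕ → ℝ := fun j => a + (b - a) * (j / (k + 1))
  have hT : ∀ j < k + 1, a ≤ T j ∧ T j < T (j + 1) ∧ T (j + 1) ≤ b := by
    intro j hj
    have hb : 0 < b - a := by linarith
    have hk0 : (0:ℝ) < k + 1 := by positivity
    refine ⟨?_, ?_, ?_⟩
    · have : 0 ≤ (b - a) * ((j:ℝ) / (k + 1)) := by positivity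
      simp only [T]; linarith
    · simp only [T]; push_cast; gcongr; linarith
    · have : ((j:ℝ) + 1) / (k + 1) ≤ 1 := by
        rw [div_le_one hk0]; exact_mod_cast hj
      have := mul_le_mul_of_nonneg_left this hb.le
      simp only [T]; push_cast; linarith
  have hall : ∀ᶠ n in atTop, ∀ j ∈ Finset.range (k + 1), ¬ (η ≤ M n (T j) ∧ M n (T (j + 1)) ≤ (1 + δ) * M n (T j)) := by
    rw [Filter.eventually_all_finset]
    intro j hj
    obtain ⟨h1, h2, h3⟩ := hT j (Finset.mem_range.1 hj)
    exact hk η hη _ _ h1 h2 h3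
  obtain ⟨n0, hn0⟩ := eventually_atTop.1 hall
  refine ⟨n0, fun n hn => ?_⟩
  rw [Real.dist_0_eq_abs, abs_of_nonneg (h0 _ _)]
  by_contra! hc
  have ind : ∀ j, j ≤ k + 1 → (1 + δ) ^ j * η ≤ M n (T j) := by
    intro j
    induction j with
    | zero => intro _; simpa [T] using hc
    | succ j ih =>
      intro hj
      have h1 := ih (by omega)
      have h2 : η ≤ M n (T j) := le_trans (le_mul_of_one_le_left hη.le (one_le_pow₀ (by linarith))) h1
      have h3 := hn0 n hn.le j (Finset.mem_range.2 (by omega))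
      push Not at h3
      have h4 := h3 h2
      calc (1 + δ) ^ (j + 1) * η = (1 + δ) * ((1 + δ) ^ j * η) := by ring
        _ ≤ (1 + δ) * M n (T j) := by gcongr
        _ ≤ _ := h4.le
  have := ind k (by omega)
  linarith [hC n (T k)]

theorem exists_delta {K1 K2 D e : ℝ} (hD : 0 < D) (he : 0 < e) :
    ∃ δ : ℝ, 0 < δ ∧ 3 * δ ≤ 1 ∧ δ ≤ e ∧ δ * K1 ≤ 1 ∧ δ * K1 * K2 < D := by
  have t : ∀ K : ℝ, Tendsto (fun δ : ℝ => δ * K) (𝓝[>] 0) (𝓝 0) := fun K => by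
    have : Tendsto (fun δ : ℝ => δ * K) (𝓝 0) (𝓝 (0 * K)) := tendsto_id.mul_const K
    rw [zero_mul] at this
    exact this.mono_left nhdsWithin_le_nhds
  have e1 := (t 3).eventually_le_const one_pos
  have e2 := (t 1).eventually_le_const he
  have e3 := (t K1).eventually_le_const one_pos
  have e4 := (t (K1 * K2)).eventually_lt_const hD
  obtain ⟨δ, h⟩ := ((((e1.and e2).and e3).and e4).and self_mem_nhdsWithin).exists
  obtain ⟨⟨⟨⟨a, b⟩, c⟩, d⟩, g⟩ := h
  exact ⟨δ, g, by linarith, by linarith, c, by rw [mul_assoc]; exact d⟩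

theorem QCtx.w_to_zero (H : QCtx s P ε₀ p q qm qM f) {w : ℕ → Euc N → ℝ} {C lam : ℝ} (hw : WSeq s P p q C w)
    (hlam : 0 < lam)
    (hΛ : ∀ φ, Cut s p φ → Tendsto (fun n => Lam s P p q lam φ (w n)) atTop (𝓝 0))
    (hpinf : Tendsto (fun z : Euc N × Euc N => p z.1 z.2)
      ((cocompact (Euc N)) ×ˢ (cocompact (Euc N))) (𝓝 P))
    (hquc : UniformContinuous q) {qinf : ℝ}
    (hqinf : Tendsto q (cocompact (Euc N)) (𝓝 qinf))
    (hS : 0 < Sq s p q) {τ τ' : ℝ}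
    (hτ : ∀ x, τ ≤ q x * (P / (q x - P)) * Real.log (Sq s p q) - P / (q x - P) * Real.log lam)
    (hττ : τ' < τ)
    (hub : ∀ᶠ n in atTop, lam * ∫ x, |w n x| ^ q x ≤ Real.exp τ') :
    Tendsto (fun n => ∫ x, |w n x| ^ q x) atTop (𝓝 0) := by
  have hP := H.h.P1
  have hPq := H.Pqm
  have hd0 : 0 < qm - P := by linarith
  have hq0 : 0 < qm := by linarith
  obtain ⟨δ, hδ, hδ3, hδq, hk1, hk2⟩ := exists_delta (K1 := qm * P / (qm - P) * (9 + 3 * |Real.log lam|))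
    (K2 := 1 + |τ' - Real.log lam|) (D := τ - τ') (e := qm - 1) (by linarith) (by linarith)
  have hwi := fun n => H.iq (hw.W n)
  have piece : ∀ (d : Euc N → ℝ) (a b : ℝ), Dfun d → a < b →
      (∀ x y, d x ≤ b → d y ≤ b → |q x - q y| ≤ δ) →
      Tendsto (fun n => ∫⁻ x in {x | d x ≤ a}, ENNReal.ofReal (|w n x| ^ q x)) atTop (𝓝 0) := by
    intro d a b hd hab osc
    have := pigeon (M := fun n t => ∫ x in {x | d x ≤ t}, |w n x| ^ q x) (C := C) hδ hab
      (fun n t => (setIntegral_le_integral (hwi n) (Eventually.of_forall fun x => by positivity)).trans (hw.qC n))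
      (fun n t => integral_nonneg fun x => by positivity)
      (fun η hη t t' _ htt htb => H.key hw hlam hΛ hpinf hS hτ hub hδ hδ3 hδq hk1 hk2 hd htt
        (fun x y hx hy => osc x y (hx.trans htb) (hy.trans htb)) hη)
    have h2 := ENNReal.tendsto_ofReal this
    rw [ENNReal.ofReal_zero] at h2
    refine h2.congr fun n => ?_
    exact ofReal_integral_eq_lintegral_ofReal (hwi n).integrableOn (Eventually.of_forall fun x => by positivity)
  obtain ⟨R, hR⟩ : ∃ R : ℝ, ∀ x, R ≤ ‖x‖ → |q x - qinf| ≤ δ / 2 := by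
    have h1 := hqinf.eventually (Metric.closedBall_mem_nhds qinf (half_pos hδ))
    obtain ⟨K, hK, hA⟩ := mem_cocompact.1 h1
    obtain ⟨R, hR⟩ := hK.isBounded.exists_norm_le
    refine ⟨R + 1, fun x hx => ?_⟩
    have : x ∈ Kᶜ := fun hxK => by linarith [hR x hxK]
    simpa [Real.dist_eq] using hA this
  have ext := piece (fun x => -‖x‖) (-R - 1) (-R)
    ⟨fun x y => by
      have := abs_norm_sub_norm_le y x
      rw [neg_sub_neg, dist_comm, dist_eq_norm]; exact this,
    Or.inr fun c => ⟨-c, fun x hx => by linarith⟩⟩ (by linarith) (fun x y hx hy => by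
      have h1 := hR x (by linarith)
      have h2 := hR y (by linarith)
      rw [abs_le] at *
      constructor <;> linarith)
  have int : Tendsto (fun n => ∫⁻ x in Metric.closedBall 0 (R + 1), ENNReal.ofReal (|w n x| ^ q x)) atTop (𝓝 0) := by
    refine (isCompact_closedBall (0 : Euc N) (R + 1)).induction_on
      (p := fun S => Tendsto (fun n => ∫⁻ x in S, ENNReal.ofReal (|w n x| ^ q x)) atTop (𝓝 0)) (by simp) ?_ ?_ ?_
    · intro A B hAB hB
      exact tendsto_of_tendsto_of_tendsto_of_le_of_le tendsto_const_nhds hB (fun n => zero_le)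
        fun n => lintegral_mono_set hAB
    · intro A B hA hB
      have := hA.add hB
      rw [add_zero] at this
      exact tendsto_of_tendsto_of_tendsto_of_le_of_le tendsto_const_nhds this (fun n => zero_le)
        fun n => lintegral_union_le _ _ _
    · intro x0 _
      obtain ⟨r, hr, hr1⟩ := Metric.uniformContinuous_iff.1 hquc δ hδ
      refine ⟨Metric.closedBall x0 (r / 4), mem_nhdsWithin_of_mem_nhds (Metric.closedBall_mem_nhds _ (by positivity)), ?_⟩
      refine piece (fun x => dist x x0) (r / 4) (r / 3) ⟨fun x y => abs_dist_sub_le x y x0,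
        Or.inl fun c => ⟨c + ‖x0‖, fun x hx => ?_⟩⟩ (by linarith) fun x y hx hy => ?_
      · rw [dist_eq_norm] at hx
        linarith [norm_sub_norm_le x x0]
      · have : dist x y < r := by
          have := dist_triangle_right x y x0
          linarith
        exact (hr1 this).le
  have tot : Tendsto (fun n => ∫⁻ x, ENNReal.ofReal (|w n x| ^ q x)) atTop (𝓝 0) := by
    have := ext.add int
    rw [add_zero] at this
    refine tendsto_of_tendsto_of_tendsto_of_le_of_le tendsto_const_nhds this (fun n => zero_le) fun n => ?_
    dsimp only
    refine le_trans ?_ (lintegral_union_le _ _ _)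
    rw [← setLIntegral_univ]
    refine lintegral_mono_set fun x _ => ?_
    by_cases hx : ‖x‖ ≤ R + 1
    · right; simpa using hx
    · left; push Not at hx; simp only [mem_ofPred_eq]; linarith
  have t2 := (ENNReal.tendsto_toReal ENNReal.zero_ne_top).comp tot
  refine t2.congr fun n => ?_
  rw [Function.comp, ← ofReal_integral_eq_lintegral_ofReal (hwi n) (Eventually.of_forall fun x => by positivity),
    ENNReal.toReal_ofReal (integral_nonneg fun x => by positivity)]

theorem QCtx.upper (H : QCtx s P ε₀ p q qm qM f) {w : ℕ → Euc N → ℝ} {C : ℝ} (hw : WSeq s P p q C w)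
    {U : Euc N → ℝ} (hU : InW s P p U) (hu : ∀ n, InW s P p (fun x => w n x + U x)) {C' : ℝ}
    (huq : ∀ n, ∫ x, |w n x + U x| ^ q x ≤ C') {ε : ℝ} (hε : 0 < ε) :
    ∀ᶠ n in atTop, ∫ x, |w n x| ^ q x ≤ (∫ x, |w n x + U x| ^ q x) + ε := by
  have hq := fun x => H.q1 x
  obtain ⟨ki, k0⟩ := bl_real (μ := volume) (K := fun n x => max (|w n x| ^ q x - |w n x + U x| ^ q x) 0)
    (G := fun n x => |w n x + U x| ^ q x)
    (fun n => ((((hw.W n).meas.abs.pow H.qc.measurable).sub ((hu n).meas.abs.pow H.qc.measurable)).max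
      measurable_const).aestronglyMeasurable) (fun n x => by positivity) (fun n => H.iq (hu n)) C' huq
    (fun δ hδ => by
      obtain ⟨D, hD, hb⟩ := elemE2 qM hδ
      refine ⟨fun x => D * |U x| ^ q x, (H.iq hU).const_mul D, fun n => Eventually.of_forall fun x => ?_⟩
      have h1 := hb (q x) (-U x) (w n x + U x) (by linarith [hq x]) (H.qhi x)
      rw [add_neg_cancel_right, abs_neg] at h1
      rw [abs_of_nonneg (le_max_right _ _)]
      exact max_le (by linarith) (by positivity))
    (by
      filter_upwards [hw.ae] with x hx
      have hq0 : 0 < q x := by linarith [hq x]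
      have h1 : Tendsto (fun n => |w n x| ^ q x) atTop (𝓝 (|0| ^ q x)) := hx.abs.rpow_const (Or.inr hq0.le)
      have h2 : Tendsto (fun n => |w n x + U x| ^ q x) atTop (𝓝 (|0 + U x| ^ q x)) :=
        (hx.add_const _).abs.rpow_const (Or.inr hq0.le)
      have h3 := (h1.sub h2).max (tendsto_const_nhds (x := (0:ℝ)))
      rw [abs_zero, Real.zero_rpow hq0.ne', zero_add, zero_sub, max_eq_right (by
        rw [neg_nonpos]; positivity)] at h3
      exact h3)
  filter_upwards [k0.eventually_le_const hε] with n hn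
  have : ∫ x, |w n x| ^ q x ≤ ∫ x, (|w n x + U x| ^ q x + |max (|w n x| ^ q x - |w n x + U x| ^ q x) 0|) := by
    refine integral_mono (H.iq (hw.W n)) ((H.iq (hu n)).add (ki n).abs) fun x => ?_
    have := le_max_left (|w n x| ^ q x - |w n x + U x| ^ q x) 0
    have := le_abs_self (max (|w n x| ^ q x - |w n x + U x| ^ q x) 0)
    dsimp only
    linarith
  rw [integral_add (H.iq (hu n)) (ki n).abs] at this
  linarith
end

section
variable {N : ℕ} {s P ε₀ : ℝ} {p : Euc N → Euc N → ℝ}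
variable {q : Euc N → ℝ} {qm qM : ℝ} {f : Euc N → ℝ → ℝ}

theorem min_rpow_le {S a b t : ℝ} (hS : 0 < S) (ha : a ≤ t) (hb : t ≤ b) : min (S ^ b) (S ^ a) ≤ S ^ t := by
  rcases le_total 1 S with h | h
  · exact (min_le_right _ _).trans (Real.rpow_le_rpow_of_exponent_le h ha)
  · exact (min_le_left _ _).trans (Real.rpow_le_rpow_of_exponent_ge hS h hb)

theorem sobModular_congr {u u' : Euc N → ℝ} (h : u =ᵐ[volume] u') :
    sobModular Set.univ s p u = sobModular Set.univ s p u' := by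
  unfold sobModular
  simp only [Measure.restrict_univ]
  congr 1
  · exact lintegral_congr_ae (by filter_upwards [h] with x hx; rw [hx])
  · refine lintegral_congr_ae ?_
    filter_upwards [h] with x hx
    exact lintegral_congr_ae (by filter_upwards [h] with y hy; rw [sobKernel, sobKernel, hx, hy])

theorem sobNorm_congr {u u' : Euc N → ℝ} (h : u =ᵐ[volume] u') :
    sobNorm Set.univ s p u = sobNorm Set.univ s p u' := by
  unfold sobNorm
  congr 1
  ext c
  have : (fun x => u x / c) =ᵐ[volume] (fun x => u' x / c) := by filter_upwards [h] with x hx; rw [hx]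
  simp only [mem_ofPred_eq, sobModular_congr this]

theorem Jfun_congr {u u' : Euc N → ℝ} (h : u =ᵐ[volume] u') (lam : ℝ) :
    Jfun s p P q f lam u = Jfun s p P q f lam u' := by
  unfold Jfun
  congr 1
  · congr 1
    · congr 1
      · refine integral_congr_ae ?_
        filter_upwards [h] with x hx
        exact integral_congr_ae (by filter_upwards [h] with y hy; rw [hx, hy])
      · exact integral_congr_ae (by filter_upwards [h] with x hx; rw [hx])
    · exact integral_congr_ae (by filter_upwards [h] with x hx; rw [hx])
  · congr 1
    exact integral_congr_ae (by filter_upwards [h] with x hx; rw [hx])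

theorem Jderiv_congr {u u' : Euc N → ℝ} (h : u =ᵐ[volume] u') (lam : ℝ) (v : Euc N → ℝ) :
    Jderiv s p P q f lam u v = Jderiv s p P q f lam u' v := by
  unfold Jderiv
  congr 1
  · congr 1
    · congr 1
      · refine integral_congr_ae ?_
        filter_upwards [h] with x hx
        exact integral_congr_ae (by filter_upwards [h] with y hy; rw [hx, hy])
      · exact integral_congr_ae (by filter_upwards [h] with x hx; rw [hx])
    · exact integral_congr_ae (by filter_upwards [h] with x hx; rw [hx])
  · congr 1
    exact integral_congr_ae (by filter_upwards [h] with x hx; rw [hx])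

theorem QCtx.main (H : QCtx s P ε₀ p q qm qM f) {lam α c T : ℝ} {u : ℕ → Euc N → ℝ}
    (hlam : 0 < lam) {g : Euc N → ℝ} (hα : P ≤ α) (hαq : α < qm) (hg : Integrable g)
    (hF4 : ∀ᵐ x ∂(volume : Measure (Euc N)), ∀ t : ℝ, α * Fint f x t - f x t * t ≤ g x)
    (hpinf : Tendsto (fun z : Euc N × Euc N => p z.1 z.2)
      ((cocompact (Euc N)) ×ˢ (cocompact (Euc N))) (𝓝 P))
    (hquc : UniformContinuous q) {qinf : ℝ}
    (hqinf : Tendsto q (cocompact (Euc N)) (𝓝 qinf))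
    (hT0 : Sq s p q = 0 → T = 0)
    (hT : 0 < Sq s p q → 0 < T ∧
      ∀ x, Real.log T ≤ q x * (P / (q x - P)) * Real.log (Sq s p q) - P / (q x - P) * Real.log lam)
    (hc : c + (∫ x, |g x|) / α < (1 / α - 1 / qm) * T)
    (hu : ∀ n, InW s P p (u n)) (hJ : Tendsto (fun n => Jfun s p P q f lam (u n)) atTop (𝓝 c))
    (hd : ∀ ε > (0 : ℝ), ∃ n₀ : ℕ, ∀ n ≥ n₀, ∀ v : Euc N → ℝ, MemSob Set.univ s p v →
          sobNorm Set.univ s p v ≤ 1 → |Jderiv s p P q f lam (u n) v| ≤ ε) :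
    ∃ (v : Euc N → ℝ) (φ : ℕ → ℕ), StrictMono φ ∧ MemSob Set.univ s p v ∧
          Tendsto (fun k => sobNorm Set.univ s p (fun x => u (φ k) x - v x)) atTop (𝓝 0) := by
  have hP := H.h.P1
  obtain ⟨⟨C, hC⟩, hb⟩ := H.bdd hlam hα hαq hg hF4 hu hJ hd
  obtain ⟨φ, hφ, v, hv, C', hw⟩ := H.limit hu hC
  have hκ : 0 < 1 / α - 1 / qm := by
    rw [sub_pos]; exact one_div_lt_one_div_of_lt (by linarith) hαq
  set κ := 1 / α - 1 / qm with hκd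
  set G := (∫ x, |g x|) / α with hG
  have eu : ∀ n, (fun x => (u (φ n) x - v x) + v x) = u (φ n) := fun n => by ext x; ring
  have hφt := hφ.tendsto_atTop
  have hΛ : ∀ ψ, Cut s p ψ → Tendsto (fun n => Lam s P p q lam ψ (fun x => u (φ n) x - v x)) atTop (𝓝 0) := by
    intro ψ hψ
    refine H.Lam_lim hw hv (fun n => by rw [eu]; exact hu _) (C' := C) (fun n => by rw [eu]; exact (hC _).1)
      (fun n => by simpa using (hC (φ n)).2) (fun ε hε => ?_) hψ
    obtain ⟨n0, hn0⟩ := hd ε hε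
    filter_upwards [hφt.eventually_ge_atTop n0] with n hn z hz
    rw [eu]
    exact H.dual (hn0 _ hn) hz
  have hX : 0 ≤ c + G := by
    by_contra! h
    obtain ⟨n, hn⟩ := (hb (-(c + G) / 2) (by linarith)).exists
    have : 0 ≤ lam * κ * ∫ x, |u n x| ^ q x := mul_nonneg (by positivity) (integral_nonneg fun x => by positivity)
    linarith
  have hS0 : 0 ≤ Sq s p q := by
    refine Real.sInf_nonneg ?_
    rintro c ⟨u, -, -, rfl⟩
    exact div_nonneg (sobNorm_nonneg _) (Real.sInf_nonneg fun _ hx => hx.1.le)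
  have hS : 0 < Sq s p q := by
    refine lt_of_le_of_ne hS0 fun h => ?_
    rw [hT0 h.symm] at hc
    linarith
  obtain ⟨hT1, hτ⟩ := hT hS
  set X := (c + G) / κ with hXd
  have hXT : X < T := by rw [hXd, div_lt_iff₀ hκ]; linarith
  have hX0 : 0 ≤ X := by positivity
  have hXe : c + G = κ * X := by rw [hXd]; field_simp
  have q0 : Tendsto (fun n => ∫ x, |u (φ n) x - v x| ^ q x) atTop (𝓝 0) := by
    refine H.w_to_zero hw hlam hΛ hpinf hquc hqinf hS hτ (τ' := Real.log ((X + T) / 2))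
      (Real.log_lt_log (by linarith) (by linarith)) ?_
    have e1 := hφt.eventually (hb (κ * ((T - X) / 4)) (mul_pos hκ (by linarith)))
    have e2 := H.upper hw hv (fun n => by rw [eu]; exact hu _) (C' := C) (fun n => by simpa using (hC (φ n)).2)
      (ε := (T - X) / 4 / lam) (div_pos (by linarith) hlam)
    filter_upwards [e1, e2] with n h1 h2
    rw [Real.exp_log (by linarith)]
    simp only [sub_add_cancel] at h2
    rw [hXe, mul_comm lam, mul_assoc, ← mul_add] at h1
    have h3 := le_of_mul_le_mul_left h1 hκ
    have h4 := mul_le_mul_of_nonneg_left h2 hlam.le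
    rw [mul_add, mul_div_cancel₀ _ hlam.ne'] at h4
    linarith
  exact ⟨v, φ, hφ, hv.memSob H.h, sobNorm_tendsto H.h hw.W (H.Md_tendsto hΛ q0)⟩
end

/-- Lemma 5.3: for any λ > 0, the functional J_λ satisfies the
Palais–Smale condition at every level c below the explicit threshold. -/
theorem Jlam_palais_smale {N : ℕ}
    (s pminus pbar ε₀ : ℝ) (hs : s ∈ Set.Ioo (0 : ℝ) 1)
    (p : Euc N → Euc N → ℝ) (pstar : Euc N → ℝ)
    (hpuc : UniformContinuous fun z : Euc N × Euc N => p z.1 z.2)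
    (hpsym : ∀ x y, p x y = p y x)
    (hpminus : IsGLB (Set.range fun z : Euc N × Euc N => p z.1 z.2) pminus)
    (hpbar : IsLUB (Set.range fun z : Euc N × Euc N => p z.1 z.2) pbar)
    (hpm1 : 1 < pminus) (hpbarN : pbar < (N : ℝ) / s)
    (hε₀ : ε₀ ∈ Set.Ioo (0 : ℝ) (1 / 2))
    (hdiag : ∀ x y : Euc N, dist x y < ε₀ → p x y = pbar)
    (hsupx : ∀ x : Euc N, IsLUB (Set.range (p x)) pbar)
    (hpstar : ∀ x : Euc N, IsGLB (Set.range (p x)) (pstar x))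
    (hfin : volume {x : Euc N | pstar x ≠ pbar} < ⊤)
    (q : Euc N → ℝ) (hquc : UniformContinuous q)
    (pbarS : ℝ) (hpbarS : pbarS = (N : ℝ) * pbar / ((N : ℝ) - s * pbar))
    (hqlb : ∀ x, pstar x ≤ q x) (hqub : ∀ x, q x ≤ pbarS)
    (hqcrit : {x : Euc N | q x = pbarS}.Nonempty)
    (qminus : ℝ) (hqminus : IsGLB (Set.range q) qminus) (hpq : pbar < qminus)
    (qinf : ℝ) (hqinf1 : 1 < qinf)
    (hpinf : Tendsto (fun z : Euc N × Euc N => p z.1 z.2)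
      ((cocompact (Euc N)) ×ˢ (cocompact (Euc N))) (𝓝 pbar))
    (hqinf : Tendsto q (cocompact (Euc N)) (𝓝 qinf))
    (f : Euc N → ℝ → ℝ)
    -- (F1)
    (hf_meas : ∀ t : ℝ, Measurable fun x => f x t)
    (hf_cont : ∀ᵐ x ∂(volume : Measure (Euc N)), Continuous fun t => f x t)
    (hf_odd : ∀ᵐ x ∂(volume : Measure (Euc N)), ∀ t : ℝ, f x (-t) = - f x t)
    -- (F2)
    (hF2 : ∃ (m : ℕ) (r a : Fin m → Euc N → ℝ),
      (∀ j, Continuous (r j)) ∧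
      (∀ j, ∃ rlo rhi : ℝ, 1 < rlo ∧ (∀ x, rlo ≤ r j x) ∧ (∀ x, r j x ≤ rhi)) ∧
      (∀ j, ∃ δ > (0 : ℝ), ∀ x, r j x + δ ≤ q x) ∧
      (∃ j x, pminus < r j x) ∧
      (∀ j, MemVarLp volume (fun x => q x / (q x - r j x)) (a j) ∧
        (∀ᵐ x ∂(volume : Measure (Euc N)), 0 < a j x)) ∧
      (∀ᵐ x ∂(volume : Measure (Euc N)), ∀ t : ℝ,
        |f x t| ≤ ∑ j, a j x * |t| ^ (r j x - 1)))
    -- (F3)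
    (hF3 : ∃ (x₀ : Euc N) (ε : ℝ), 0 < ε ∧ ∃ a : Euc N → ℝ,
      MemVarLp (volume.restrict (Metric.ball x₀ ε)) (fun x => q x / (q x - pbar)) a ∧
      (∀ᵐ x ∂volume.restrict (Metric.ball x₀ ε), 0 < a x) ∧
      (∀ M : ℝ, 0 < M → ∃ G : Euc N → ℝ, IntegrableOn G (Metric.ball x₀ ε) ∧
        ∀ᵐ x ∂volume.restrict (Metric.ball x₀ ε), ∀ t : ℝ, |t| ≤ M → |Fint f x t| ≤ G x) ∧
      (∀ K : ℝ, ∃ M : ℝ, ∀ᵐ x ∂volume.restrict (Metric.ball x₀ ε), ∀ t : ℝ, M ≤ |t| →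
        K * (a x * |t| ^ pbar) ≤ Fint f x t))
    -- (F4), with α and g explicit
    (α : ℝ) (g : Euc N → ℝ)
    (hα : pbar ≤ α ∧ α < qminus) (hg : Integrable g)
    (hg0 : ∀ᵐ x ∂(volume : Measure (Euc N)), 0 ≤ g x)
    (hF4 : ∀ᵐ x ∂(volume : Measure (Euc N)), ∀ t : ℝ, α * Fint f x t - f x t * t ≤ g x)
    -- the constants h⁺, h⁻, (qh)⁺, (qh)⁻
    (hplus hminus qhplus qhminus : ℝ)
    (hhplus : IsLUB (Set.range fun x => pbar / (q x - pbar)) hplus)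
    (hhminus : IsGLB (Set.range fun x => pbar / (q x - pbar)) hminus)
    (hqhplus : IsLUB (Set.range fun x => q x * (pbar / (q x - pbar))) qhplus)
    (hqhminus : IsGLB (Set.range fun x => q x * (pbar / (q x - pbar))) qhminus) :
    ∀ lam : ℝ, 0 < lam → ∀ c : ℝ,
      c < (1 / α - 1 / qminus) *
            min (Sq s p q ^ qhplus) (Sq s p q ^ qhminus) *
            min (lam ^ (-hplus)) (lam ^ (-hminus)) - (∫ x, |g x|) / α →
      ∀ un : ℕ → Euc N → ℝ, (∀ n, MemSob Set.univ s p (un n)) →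
        Tendsto (fun n => Jfun s p pbar q f lam (un n)) atTop (𝓝 c) →
        (∀ ε > (0 : ℝ), ∃ n₀ : ℕ, ∀ n ≥ n₀, ∀ v : Euc N → ℝ, MemSob Set.univ s p v →
          sobNorm Set.univ s p v ≤ 1 → |Jderiv s p pbar q f lam (un n) v| ≤ ε) →
        ∃ (v : Euc N → ℝ) (φ : ℕ → ℕ), StrictMono φ ∧ MemSob Set.univ s p v ∧
          Tendsto (fun k => sobNorm Set.univ s p (fun x => un (φ k) x - v x))
            atTop (𝓝 0) := by
  intro lam hlam c hc un hun hJ hd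
  have hP : 1 < pbar := by
    have h1 := hpminus.1 (mem_range_self ((0 : Euc N), (0 : Euc N)))
    have h2 := hpbar.1 (mem_range_self ((0 : Euc N), (0 : Euc N)))
    linarith
  have h : Ctx s pbar ε₀ p :=
    { s0 := hs.1, s1 := hs.2, P1 := hP
      sP := by rw [lt_div_iff₀ hs.1] at hpbarN; linarith
      e0 := hε₀.1, e1 := hε₀.2, pc := hpuc.continuous, sym := hpsym
      p1 := fun x y => lt_of_lt_of_le hpm1 (hpminus.1 (mem_range_self (x, y)))
      pP := fun x y => hpbar.1 (mem_range_self (x, y))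
      diag := hdiag }
  obtain ⟨m, r, a, h1, h2, h3, -, h5, h6⟩ := hF2
  have qlo : ∀ x, qminus ≤ q x := fun x => hqminus.1 (mem_range_self x)
  have H : QCtx s pbar ε₀ p q qminus pbarS f :=
    { h := h, qc := hquc.continuous, Pqm := hpq, qlo := qlo, qhi := hqub, qS := hpbarS.le
      F := FHyp.mk' hquc.continuous.measurable hqub hf_meas hf_cont m r a h1 h2 h3 h5 h6 }
  have hm : ∀ n, AEStronglyMeasurable (un n) volume := fun n => by
    have := (hun n).1
    rwa [Measure.restrict_univ] at this
  have hae : ∀ n, un n =ᵐ[volume] (hm n).mk (un n) := fun n => (hm n).ae_eq_mk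
  have hu : ∀ n, InW s pbar p ((hm n).mk (un n)) := fun n =>
    h.inW_of (hm n).stronglyMeasurable_mk.measurable (by
      rw [← sobModular_congr (hae n)]; exact (hun n).2)
  have hd0 : ∀ x, 0 < q x - pbar := fun x => by linarith [qlo x]
  obtain ⟨v, φ, hφ, hv, ht⟩ := H.main (T := min (Sq s p q ^ qhplus) (Sq s p q ^ qhminus) *
            min (lam ^ (-hplus)) (lam ^ (-hminus))) (c := c) (u := fun n => (hm n).mk (un n))
    hlam hα.1 hα.2 hg hF4 hpinf hquc hqinf
    (fun hS => by
      have h0 : 0 < qhplus := lt_of_lt_of_le (by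
        have := hd0 0
        have := H.q1 0
        positivity) (hqhplus.1 (mem_range_self (0 : Euc N)))
      have hn : (0 : ℝ) ≤ 0 ^ qhminus := by positivity
      rw [hS, Real.zero_rpow h0.ne', min_eq_left hn, zero_mul])
    (fun hS => by
      have hT : 0 < min (Sq s p q ^ qhplus) (Sq s p q ^ qhminus) * min (lam ^ (-hplus)) (lam ^ (-hminus)) := by
        positivity
      refine ⟨hT, fun x => ?_⟩
      have e1 := min_rpow_le hS (hqhminus.1 (mem_range_self x)) (hqhplus.1 (mem_range_self x))
      have e2 := min_rpow_le hlam (neg_le_neg (hhplus.1 (mem_range_self x))) (neg_le_neg (hhminus.1 (mem_range_self x)))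
      rw [min_comm] at e2
      have e3 := Real.log_le_log hT (mul_le_mul e1 e2 (by positivity) (by positivity))
      refine e3.trans (le_of_eq ?_)
      rw [Real.log_mul (Real.rpow_pos_of_pos hS _).ne' (Real.rpow_pos_of_pos hlam _).ne',
        Real.log_rpow hS, Real.log_rpow hlam]
      ring)
    (by rw [← mul_assoc]; linarith) hu
    (hJ.congr fun n => Jfun_congr (hae n) lam)
    (fun ε hε => by
      obtain ⟨n0, hn0⟩ := hd ε hε
      exact ⟨n0, fun n hn v hv hv1 => by rw [← Jderiv_congr (hae n)]; exact hn0 n hn v hv hv1⟩)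
  refine ⟨v, φ, hφ, hv, ht.congr fun k => sobNorm_congr ?_⟩
  filter_upwards [hae (φ k)] with x hx
  rw [hx]
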